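/- (a) Every closed flexible graphon property is testable. (b) Every robust flexible graph property is testable. -/

import Mathlib

open MeasureTheory Filter Topology
open scoped ENNReal

noncomputable section

/-- The unit interval `[0,1]` as a subset of `ℝ`. -/
def I01 : Set ℝ := Set.Icc 0 1

/-- `W₀`: symmetric measurable functions `[0,1]² → [0,1]`
(represented as functions `ℝ → ℝ → ℝ`, with the relevant values on `[0,1]²`). -/
def IsGraphon (W : ℝ → ℝ → ℝ) : Prop :=
  Measurable (Function.uncurry W) ∧ (∀ x y, W x y = W y x) ∧
    ∀ x y, W x y ∈ Set.Icc (0 : ℝ) 1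

/-- The `L¹` norm of a kernel on `[0,1]²`. -/
def l1Norm (W : ℝ → ℝ → ℝ) : ℝ :=
  ∫ x in I01, ∫ y in I01, |W x y|

/-- The cut norm of a kernel on `[0,1]²`. -/
def cutNorm (W : ℝ → ℝ → ℝ) : ℝ :=
  sSup { r : ℝ | ∃ S T : Set ℝ, MeasurableSet S ∧ MeasurableSet T ∧ S ⊆ I01 ∧ T ⊆ I01 ∧
    r = |∫ x in S, ∫ y in T, W x y| }

/-- An invertible measure preserving map of `[0,1]`. -/
structure InvMP where
  toFun : ℝ → ℝ
  invFun : ℝ → ℝ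
  maps : ∀ x ∈ I01, toFun x ∈ I01
  mapsInv : ∀ x ∈ I01, invFun x ∈ I01
  measurePreserving :
    MeasurePreserving toFun (volume.restrict I01) (volume.restrict I01)
  measurePreservingInv :
    MeasurePreserving invFun (volume.restrict I01) (volume.restrict I01)
  leftInv : ∀ x ∈ I01, invFun (toFun x) = x
  rightInv : ∀ x ∈ I01, toFun (invFun x) = x

/-- `δ_□`: the cut distance, infimum of the cut norm over invertible measure
preserving transformations of `[0,1]`. -/
def deltaCut (U W : ℝ → ℝ → ℝ) : ℝ :=
  ⨅ φ : InvMP, cutNorm (fun x y => U x y - W (φ.toFun x) (φ.toFun y))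

/-- `δ₁`: the `L¹` distance minimized over invertible measure preserving
transformations of `[0,1]`. -/
def delta1 (U W : ℝ → ℝ → ℝ) : ℝ :=
  ⨅ φ : InvMP, l1Norm (fun x y => U x y - W (φ.toFun x) (φ.toFun y))



/-- A graph property: for each `n`, a set of simple graphs on `Fin n`. -/
def GraphProp := ∀ n : ℕ, Set (SimpleGraph (Fin n))

/-- Invariance under isomorphism (isomorphic graphs necessarily have the same
number of vertices). -/
def IsGraphProperty (P : GraphProp) : Prop :=
  ∀ (n : ℕ) (G H : SimpleGraph (Fin n)), Nonempty (G ≃g H) → (G ∈ P n ↔ H ∈ P n)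

/-- The normalized edit distance between graphs on a common vertex set. -/
def graphD1 {n : ℕ} (G H : SimpleGraph (Fin n)) : ℝ :=
  (symmDiff G.edgeSet H.edgeSet).ncard / (n ^ 2 : ℝ)

/-- The edit distance from a graph to a graph property (∞ if the property
contains no graph on the same number of nodes). -/
def graphD1P {n : ℕ} (G : SimpleGraph (Fin n)) (P : GraphProp) : ℝ≥0∞ :=
  ⨅ (H : SimpleGraph (Fin n)) (_ : H ∈ P n), ENNReal.ofReal (graphD1 G H)

open Classical in
/-- The step function `W_G` associated with a graph `G` on `{1,…,n}`:
its value on `((i−1)/n, i/n] × ((j−1)/n, j/n]` is `1` iff `ij ∈ E(G)`. -/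
def graphonOf {n : ℕ} (G : SimpleGraph (Fin n)) : ℝ → ℝ → ℝ := fun x y =>
  if ∃ i j : Fin n, G.Adj i j ∧ x ∈ Set.Ioc (((i : ℕ) : ℝ) / n) ((((i : ℕ) : ℝ) + 1) / n)
      ∧ y ∈ Set.Ioc (((j : ℕ) : ℝ) / n) ((((j : ℕ) : ℝ) + 1) / n)
  then 1 else 0

/-- `H` is (isomorphic to) an induced subgraph of `G`. -/
def IsInducedSubgraph {n k : ℕ} (G : SimpleGraph (Fin n)) (H : SimpleGraph (Fin k)) : Prop :=
  ∃ f : Fin k ↪ Fin n, ∀ i j, H.Adj i j ↔ G.Adj (f i) (f j)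

/-- The subgraph of `G` induced on the vertex subset `S` has property `P`
(as a graph on `k = |S|` nodes). -/
def inducedMem {n : ℕ} (G : SimpleGraph (Fin n)) (S : Finset (Fin n)) (k : ℕ)
    (P : GraphProp) : Prop :=
  ∃ H : SimpleGraph (Fin k), H ∈ P k ∧
    ∃ f : Fin k ↪ Fin n, (∀ i, f i ∈ S) ∧ ∀ i j, H.Adj i j ↔ G.Adj (f i) (f j)

/-- The number of `k`-element vertex subsets of `G` inducing a subgraph with property `P`. -/
def goodCount {n : ℕ} (G : SimpleGraph (Fin n)) (k : ℕ) (P : GraphProp) : ℕ :=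
  {S : Finset (Fin n) | S.card = k ∧ inducedMem G S k P}.ncard

/-- Testability of a graph property (Definition 1.1 of the paper). -/
def GraphTestable (P : GraphProp) : Prop :=
  ∃ P' : GraphProp, IsGraphProperty P' ∧
    (∀ (n : ℕ) (G : SimpleGraph (Fin n)), G ∈ P n → ∀ k, 1 ≤ k → k ≤ n →
      2 * n.choose k ≤ 3 * goodCount G k P') ∧
    (∀ ε : ℝ, 0 < ε → ∃ kε : ℕ, 1 ≤ kε ∧
      ∀ (n : ℕ) (G : SimpleGraph (Fin n)) (k : ℕ), kε ≤ k → k ≤ n →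
        ENNReal.ofReal ε ≤ graphD1P G P →
        3 * goodCount G k P' ≤ n.choose k)

def cube (k : ℕ) : Set (Fin k → ℝ) := Set.univ.pi fun _ => I01

open Classical in
/-- The homomorphism density `t(F,W)`. -/
def homDensity {k : ℕ} (F : SimpleGraph (Fin k)) (W : ℝ → ℝ → ℝ) : ℝ :=
  ∫ x in cube k, ∏ i : Fin k, ∏ j : Fin k,
    if i < j ∧ F.Adj i j then W (x i) (x j) else 1

open Classical in
/-- The induced density `t_ind(F,W)`. -/
def indDensity {k : ℕ} (F : SimpleGraph (Fin k)) (W : ℝ → ℝ → ℝ) : ℝ :=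
  ∫ x in cube k, ∏ i : Fin k, ∏ j : Fin k,
    if i < j then (if F.Adj i j then W (x i) (x j) else 1 - W (x i) (x j)) else 1

/-- Isomorphism of functions in `W₀`: equality of all homomorphism densities. -/
def GraphonIso (U W : ℝ → ℝ → ℝ) : Prop :=
  ∀ (k : ℕ) (F : SimpleGraph (Fin k)), homDensity F U = homDensity F W

open Classical in
/-- `P(G(k,W) ∈ R')`, the probability that the `W`-random graph on `k` nodes
has property `R'`. -/
def probIn (k : ℕ) (W : ℝ → ℝ → ℝ) (R' : GraphProp) : ℝ :=
  ∑ F : SimpleGraph (Fin k), if F ∈ R' k then indDensity F W else 0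

/-- The `L¹` distance from `W` to a set `R` of kernels, with value `∞` for `R = ∅`. -/
def d1SetE (W : ℝ → ℝ → ℝ) (R : Set (ℝ → ℝ → ℝ)) : ℝ≥0∞ :=
  ⨅ (U : ℝ → ℝ → ℝ) (_ : U ∈ R), ENNReal.ofReal (l1Norm fun x y => W x y - U x y)

/-- The cut-norm distance from `W` to a set `R` of kernels, with value `∞` for `R = ∅`. -/
def dCutSetE (W : ℝ → ℝ → ℝ) (R : Set (ℝ → ℝ → ℝ)) : ℝ≥0∞ :=
  ⨅ (U : ℝ → ℝ → ℝ) (_ : U ∈ R), ENNReal.ofReal (cutNorm fun x y => W x y - U x y)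

/-- The open ball `B₁(R,c)` (within `W₀`). -/
def ball1 (R : Set (ℝ → ℝ → ℝ)) (c : ℝ) : Set (ℝ → ℝ → ℝ) :=
  {W | IsGraphon W ∧ d1SetE W R < ENNReal.ofReal c}

/-- The open ball `B_□(R,c)` (within `W₀`). -/
def ballCut (R : Set (ℝ → ℝ → ℝ)) (c : ℝ) : Set (ℝ → ℝ → ℝ) :=
  {W | IsGraphon W ∧ dCutSetE W R < ENNReal.ofReal c}

/-- A graphon property: a set of graphons invariant under isomorphism. -/
def IsGraphonProperty (R : Set (ℝ → ℝ → ℝ)) : Prop :=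
  (∀ W ∈ R, IsGraphon W) ∧
    ∀ U W, IsGraphon U → IsGraphon W → GraphonIso U W → (U ∈ R ↔ W ∈ R)

/-- A set of graphons is closed if it is closed in the cut norm. -/
def CutClosed (R : Set (ℝ → ℝ → ℝ)) : Prop :=
  ∀ W, IsGraphon W →
    (∀ ε : ℝ, 0 < ε → ∃ U ∈ R, cutNorm (fun x y => W x y - U x y) < ε) → W ∈ R

/-- Testability of a graphon property. -/
def GraphonTestable (R : Set (ℝ → ℝ → ℝ)) : Prop :=
  ∃ R' : GraphProp, IsGraphProperty R' ∧
    (∀ W ∈ R, ∀ k : ℕ, 1 ≤ k → (2 : ℝ) / 3 ≤ probIn k W R') ∧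
    (∀ ε : ℝ, 0 < ε → ∃ kε : ℕ, 1 ≤ kε ∧ ∀ k, kε ≤ k → ∀ W, IsGraphon W →
      ENNReal.ofReal ε ≤ d1SetE W R → probIn k W R' ≤ 1 / 3)

/-- The closure `P̄` of a graph property: limits of convergent sequences
of graphs in `P` with sizes tending to infinity. -/
def closureP (P : GraphProp) : Set (ℝ → ℝ → ℝ) :=
  {W | IsGraphon W ∧ ∃ (n : ℕ → ℕ) (G : ∀ m, SimpleGraph (Fin (n m))),
    (∀ m, G m ∈ P (n m)) ∧ Tendsto n atTop atTop ∧
    Tendsto (fun m => deltaCut (graphonOf (G m)) W) atTop (nhds 0)}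

/-- A graph property is robust if graphs whose `W_G` is `d₁`-close to `P̄`
are themselves close to `P` in edit distance. -/
def Robust (P : GraphProp) : Prop :=
  ∀ ε : ℝ, 0 < ε → ∃ (N : ℕ) (ε' : ℝ), 1 ≤ N ∧ 0 < ε' ∧
    ∀ (n : ℕ), N ≤ n → ∀ G : SimpleGraph (Fin n),
      d1SetE (graphonOf G) (closureP P) ≤ ENNReal.ofReal ε' →
      graphD1P G P ≤ ENNReal.ofReal ε

/-- A hereditary graph property: closed under induced subgraphs. -/
def Hereditary (P : GraphProp) : Prop :=
  ∀ (n : ℕ) (G : SimpleGraph (Fin n)), G ∈ P n →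
    ∀ (k : ℕ) (H : SimpleGraph (Fin k)), IsInducedSubgraph G H → H ∈ P k

/-- `U` is a flexing of `W`: `U ∈ W₀` agrees with `W` wherever `W` takes value `0` or `1`. -/
def Flexing (U W : ℝ → ℝ → ℝ) : Prop :=
  IsGraphon U ∧ ∀ x y, (W x y = 0 ∨ W x y = 1) → U x y = W x y

/-- A function property is flexible if it is preserved under flexing. -/
def FlexibleFamily (R : Set (ℝ → ℝ → ℝ)) : Prop :=
  ∀ W ∈ R, ∀ U, Flexing U W → U ∈ R

/-- `U' ≤ W'` almost everywhere on `[0,1]²`. -/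
def aeLE (U W : ℝ → ℝ → ℝ) : Prop :=
  ∀ᵐ p ∂(volume.restrict (I01 ×ˢ I01)), U p.1 p.2 ≤ W p.1 p.2

/-- `U ⪯ W`: up to isomorphism, `U ≤ W` almost everywhere. -/
def graphonLE (U W : ℝ → ℝ → ℝ) : Prop :=
  ∃ U' W', IsGraphon U' ∧ IsGraphon W' ∧ GraphonIso U U' ∧ GraphonIso W W' ∧ aeLE U' W'

/-- The upward closure of a graph property: graphs having a spanning subgraph in `P`. -/
def upP (P : GraphProp) : GraphProp :=
  fun n => {G | ∃ H : SimpleGraph (Fin n), H ∈ P n ∧ H ≤ G}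

/-- The upward closure of a function property. -/
def upR (R : Set (ℝ → ℝ → ℝ)) : Set (ℝ → ℝ → ℝ) :=
  {W | IsGraphon W ∧ ∃ U ∈ R, graphonLE U W}

/-- A stepfunction: constant on the products of a finite measurable partition of `[0,1]`. -/
def IsStepfunction (W : ℝ → ℝ → ℝ) : Prop :=
  ∃ (m : ℕ) (S : Fin m → Set ℝ), (∀ i, MeasurableSet (S i)) ∧
    (⋃ i, S i) = I01 ∧ (∀ i j, i ≠ j → Disjoint (S i) (S j)) ∧
    ∀ i j : Fin m, ∀ x ∈ S i, ∀ x' ∈ S i, ∀ y ∈ S j, ∀ y' ∈ S j, W x y = W x' y'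

open Classical in
/-- A testable graphon functional: its value can be estimated from `W`-random graphs. -/
def TestableFunctional (f : (ℝ → ℝ → ℝ) → ℝ) : Prop :=
  ∃ g : ∀ n : ℕ, SimpleGraph (Fin n) → ℝ,
    (∀ (n : ℕ) (G H : SimpleGraph (Fin n)), Nonempty (G ≃g H) → g n G = g n H) ∧
    ∀ ε : ℝ, 0 < ε → ∃ kε : ℕ, 1 ≤ kε ∧ ∀ k, kε ≤ k → ∀ W, IsGraphon W →
      (∑ F : SimpleGraph (Fin k), if ε < |f W - g k F| then indDensity F W else 0) < 1 / 3


/-! ### Part 1: kernels on a probability space, weak regularity -/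

/-- Cut norm at most `c`, on a general probability space. -/
def CutLe {Ω : Type} [MeasurableSpace Ω] (m : Measure Ω) (D : Ω → Ω → ℝ) (c : ℝ) : Prop :=
  ∀ S T : Set Ω, MeasurableSet S → MeasurableSet T →
    |∫ p in S ×ˢ T, D p.1 p.2 ∂(m.prod m)| ≤ c

lemma ker_integrable {Ω : Type} [MeasurableSpace Ω] (m : Measure Ω) [IsProbabilityMeasure m]
    {D : Ω → ℝ} (hD : Measurable D) {C : ℝ} (hC : ∀ x, |D x| ≤ C) :
    Integrable D m := by
  refine Integrable.of_bound hD.aestronglyMeasurable C ?_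
  exact Eventually.of_forall fun x => by simpa using hC x

lemma cut_half {Ω : Type} [MeasurableSpace Ω] (m : Measure Ω) [IsProbabilityMeasure m]
    (K : Ω → Ω → ℝ) (hK : Measurable (Function.uncurry K)) (C : ℝ) (hC : ∀ x y, |K x y| ≤ C)
    (f : Ω → ℝ) (hf : Measurable f) (hf0 : ∀ x, 0 ≤ f x) (hf1 : ∀ x, f x ≤ 1) :
    ∃ S : Set Ω, MeasurableSet S ∧ ∫ p, f p.1 * K p.1 p.2 ∂(m.prod m) ≤
      ∫ p, S.indicator (fun _ => (1:ℝ)) p.1 * K p.1 p.2 ∂(m.prod m) := by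
  have hKm : StronglyMeasurable (Function.uncurry K) := hK.stronglyMeasurable
  have hh : Measurable (fun x => ∫ y, K x y ∂m) := hKm.integral_prod_right.measurable
  have hb : ∀ x, |∫ y, K x y ∂m| ≤ C := by
    intro x
    have := norm_integral_le_of_norm_le_const (μ := m) (f := fun y => K x y) (C := C)
      (Eventually.of_forall fun y => by simpa using hC x y)
    simpa using this
  set S : Set Ω := {x | 0 < ∫ y, K x y ∂m} with hS
  have hSm : MeasurableSet S := measurableSet_lt measurable_const hh
  refine ⟨S, hSm, ?_⟩
  have gen : ∀ g : Ω → ℝ, Measurable g → (∀ x, 0 ≤ g x) → (∀ x, g x ≤ 1) →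
      ∫ p, g p.1 * K p.1 p.2 ∂(m.prod m) = ∫ x, g x * ∫ y, K x y ∂m ∂m ∧
      Integrable (fun x => g x * ∫ y, K x y ∂m) m := by
    intro g hg h0 h1
    constructor
    · rw [integral_prod]
      · simp_rw [integral_const_mul]
      · refine ker_integrable _ ((hg.comp measurable_fst).mul hK) (C := C) ?_
        intro p
        rw [abs_mul, abs_of_nonneg (h0 _)]
        calc g p.1 * |K p.1 p.2| ≤ 1 * |K p.1 p.2| := by gcongr; exact h1 _
          _ ≤ C := by simpa using hC _ _
    · refine ker_integrable _ (hg.mul hh) (C := C) ?_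
      intro x
      rw [abs_mul, abs_of_nonneg (h0 _)]
      calc g x * |∫ y, K x y ∂m| ≤ 1 * |∫ y, K x y ∂m| := by gcongr; exact h1 _
          _ ≤ C := by simpa using hb _
  have hg2 := gen (S.indicator (fun _ => (1:ℝ))) (measurable_const.indicator hSm)
    (fun x => Set.indicator_nonneg (fun _ _ => zero_le_one) x)
    (fun x => by by_cases h : x ∈ S <;> simp [h])
  have hg1 := gen f hf hf0 hf1
  rw [hg1.1, hg2.1]
  refine integral_mono hg1.2 hg2.2 fun x => ?_
  by_cases hx : x ∈ S
  · have : 0 < ∫ y, K x y ∂m := hx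
    simp only [Set.indicator_of_mem hx, one_mul]
    nlinarith [hf1 x]
  · have : ∫ y, K x y ∂m ≤ 0 := not_lt.mp hx
    simp only [Set.indicator_of_notMem hx, zero_mul]
    exact mul_nonpos_of_nonneg_of_nonpos (hf0 x) this

lemma cut_fun_le {Ω : Type} [MeasurableSpace Ω] (m : Measure Ω) [IsProbabilityMeasure m]
    (K : Ω → Ω → ℝ) (hK : Measurable (Function.uncurry K)) (C : ℝ) (hC : ∀ x y, |K x y| ≤ C)
    (η : ℝ) (hcut : CutLe m K η)
    (f g : Ω → ℝ) (hf : Measurable f) (hf0 : ∀ x, 0 ≤ f x) (hf1 : ∀ x, f x ≤ 1)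
    (hg : Measurable g) (hg0 : ∀ x, 0 ≤ g x) (hg1 : ∀ x, g x ≤ 1) :
    ∫ p, f p.1 * g p.2 * K p.1 p.2 ∂(m.prod m) ≤ η := by
  obtain ⟨S, hS, h1⟩ := cut_half m (fun x y => g y * K x y)
    ((hg.comp measurable_snd).mul hK) C (fun x y => by
      rw [abs_mul, abs_of_nonneg (hg0 _)]
      calc g y * |K x y| ≤ 1 * |K x y| := by gcongr; exact hg1 _
        _ ≤ C := by simpa using hC x y) f hf hf0 hf1
  have hSi : Measurable (S.indicator (fun _ => (1:ℝ))) := measurable_const.indicator hS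
  obtain ⟨T, hT, h2⟩ := cut_half m (fun y x => S.indicator (fun _ => (1:ℝ)) x * K x y)
    ((hSi.comp measurable_snd).mul (hK.comp measurable_swap)) C (fun y x => by
      by_cases h : x ∈ S
      · simpa [h] using hC x y
      · simpa [h] using (abs_nonneg _).trans (hC x y)) g hg hg0 hg1
  have e1 : ∫ p, f p.1 * g p.2 * K p.1 p.2 ∂(m.prod m)
      = ∫ p, f p.1 * (g p.2 * K p.1 p.2) ∂(m.prod m) := by simp only [mul_assoc]
  have e2 : ∫ p, S.indicator (fun _ => (1:ℝ)) p.1 * (g p.2 * K p.1 p.2) ∂(m.prod m)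
      = ∫ p, g p.1 * (S.indicator (fun _ => (1:ℝ)) p.2 * K p.2 p.1) ∂(m.prod m) := by
    rw [← integral_prod_swap]
    congr 1; ext p; simp only [Prod.fst_swap, Prod.snd_swap]; ring
  have e3 : ∫ p, T.indicator (fun _ => (1:ℝ)) p.1 *
      (S.indicator (fun _ => (1:ℝ)) p.2 * K p.2 p.1) ∂(m.prod m)
      = ∫ p in S ×ˢ T, K p.1 p.2 ∂(m.prod m) := by
    rw [← integral_prod_swap, ← integral_indicator (hS.prod hT)]
    congr 1; ext p
    by_cases h1 : p.1 ∈ S <;> by_cases h2 : p.2 ∈ T <;> simp [h1, h2, Set.indicator]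
  rw [e1]
  refine h1.trans ?_
  rw [e2]
  refine h2.trans ?_
  rw [e3]
  exact (le_abs_self _).trans (hcut S T hS hT)

lemma CutLe.neg {Ω : Type} [MeasurableSpace Ω] {m : Measure Ω}
    {K : Ω → Ω → ℝ} {η : ℝ} (hcut : CutLe m K η) : CutLe m (fun x y => - K x y) η := by
  intro S T hS hT
  rw [integral_neg, abs_neg]
  exact hcut S T hS hT

lemma cut_fun_abs {Ω : Type} [MeasurableSpace Ω] (m : Measure Ω) [IsProbabilityMeasure m]
    (K : Ω → Ω → ℝ) (hK : Measurable (Function.uncurry K)) (C : ℝ) (hC : ∀ x y, |K x y| ≤ C)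
    (η : ℝ) (hcut : CutLe m K η)
    (f g : Ω → ℝ) (hf : Measurable f) (hf0 : ∀ x, 0 ≤ f x) (hf1 : ∀ x, f x ≤ 1)
    (hg : Measurable g) (hg0 : ∀ x, 0 ≤ g x) (hg1 : ∀ x, g x ≤ 1) :
    |∫ p, f p.1 * g p.2 * K p.1 p.2 ∂(m.prod m)| ≤ η := by
  rw [abs_le']
  refine ⟨cut_fun_le m K hK C hC η hcut f g hf hf0 hf1 hg hg0 hg1, ?_⟩
  have := cut_fun_le m (fun x y => - K x y) hK.neg C (by simpa using hC) η hcut.neg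
    f g hf hf0 hf1 hg hg0 hg1
  simpa [integral_neg] using this

lemma cut_fun_signed {Ω : Type} [MeasurableSpace Ω] (m : Measure Ω) [IsProbabilityMeasure m]
    (K : Ω → Ω → ℝ) (hK : Measurable (Function.uncurry K)) (C : ℝ) (hC : ∀ x y, |K x y| ≤ C)
    (η : ℝ) (hcut : CutLe m K η)
    (f g : Ω → ℝ) (hf : Measurable f) (hf1 : ∀ x, |f x| ≤ 1)
    (hg : Measurable g) (hg1 : ∀ x, |g x| ≤ 1) :
    |∫ p, f p.1 * g p.2 * K p.1 p.2 ∂(m.prod m)| ≤ 4 * η := by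
  have main : ∀ f g : Ω → ℝ, Measurable f → (∀ x, |f x| ≤ 1) → Measurable g →
      (∀ x, |g x| ≤ 1) → Integrable (fun p : Ω × Ω => f p.1 * g p.2 * K p.1 p.2) (m.prod m) := by
    intro f g hf hf1 hg hg1
    refine ker_integrable _ (((hf.comp measurable_fst).mul (hg.comp measurable_snd)).mul hK)
      (C := C) ?_
    intro p
    rw [abs_mul, abs_mul]
    calc |f p.1| * |g p.2| * |K p.1 p.2| ≤ 1 * 1 * |K p.1 p.2| := by
          gcongr
          · exact hf1 _
          · exact hg1 _
      _ ≤ C := by simpa using hC _ _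
  have pm : ∀ t : ℝ, |t| ≤ 1 → 0 ≤ max t 0 ∧ max t 0 ≤ 1 ∧ |max t 0| ≤ 1 ∧ 0 ≤ max (-t) 0 ∧
      max (-t) 0 ≤ 1 ∧ |max (-t) 0| ≤ 1 ∧ t = max t 0 - max (-t) 0 := by
    intro t ht
    rw [abs_le] at ht
    rcases le_total 0 t with h | h
    · rw [max_eq_left h, max_eq_right (by linarith : -t ≤ 0)]
      refine ⟨h, ht.2, by rw [abs_of_nonneg h]; exact ht.2, le_rfl, zero_le_one, by simp, by ring⟩
    · rw [max_eq_right h, max_eq_left (by linarith : 0 ≤ -t)]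
      refine ⟨le_rfl, zero_le_one, by simp, by linarith, by linarith, ?_, by ring⟩
      rw [abs_of_nonneg (by linarith)]; linarith
  set fp := fun x => max (f x) 0
  set fm := fun x => max (-f x) 0
  set gp := fun x => max (g x) 0
  set gm := fun x => max (-g x) 0
  have mfp : Measurable fp := hf.max measurable_const
  have mfm : Measurable fm := hf.neg.max measurable_const
  have mgp : Measurable gp := hg.max measurable_const
  have mgm : Measurable gm := hg.neg.max measurable_const
  have Pf := fun x => pm (f x) (hf1 x)
  have Pg := fun x => pm (g x) (hg1 x)
  have e : ∀ p : Ω × Ω, f p.1 * g p.2 * K p.1 p.2 = (fp p.1 * gp p.2 * K p.1 p.2 -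
      fp p.1 * gm p.2 * K p.1 p.2) - (fm p.1 * gp p.2 * K p.1 p.2 -
      fm p.1 * gm p.2 * K p.1 p.2) := by
    intro p
    have h1 : f p.1 = fp p.1 - fm p.1 := (Pf p.1).2.2.2.2.2.2
    have h2 : g p.2 = gp p.2 - gm p.2 := (Pg p.2).2.2.2.2.2.2
    rw [h1, h2]; ring
  have ipp := main fp gp mfp (fun x => (Pf x).2.2.1) mgp (fun x => (Pg x).2.2.1)
  have ipm := main fp gm mfp (fun x => (Pf x).2.2.1) mgm (fun x => (Pg x).2.2.2.2.2.1)
  have imp := main fm gp mfm (fun x => (Pf x).2.2.2.2.2.1) mgp (fun x => (Pg x).2.2.1)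
  have imm := main fm gm mfm (fun x => (Pf x).2.2.2.2.2.1) mgm (fun x => (Pg x).2.2.2.2.2.1)
  simp_rw [e]
  have ia : Integrable (fun p : Ω × Ω => fp p.1 * gp p.2 * K p.1 p.2 -
      fp p.1 * gm p.2 * K p.1 p.2) (m.prod m) := ipp.sub ipm
  have ib : Integrable (fun p : Ω × Ω => fm p.1 * gp p.2 * K p.1 p.2 -
      fm p.1 * gm p.2 * K p.1 p.2) (m.prod m) := imp.sub imm
  rw [integral_sub ia ib, integral_sub ipp ipm, integral_sub imp imm]
  have b1 := cut_fun_abs m K hK C hC η hcut fp gp mfp (fun x => (Pf x).1) (fun x => (Pf x).2.1)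
    mgp (fun x => (Pg x).1) (fun x => (Pg x).2.1)
  have b2 := cut_fun_abs m K hK C hC η hcut fp gm mfp (fun x => (Pf x).1) (fun x => (Pf x).2.1)
    mgm (fun x => (Pg x).2.2.2.1) (fun x => (Pg x).2.2.2.2.1)
  have b3 := cut_fun_abs m K hK C hC η hcut fm gp mfm (fun x => (Pf x).2.2.2.1)
    (fun x => (Pf x).2.2.2.2.1) mgp (fun x => (Pg x).1) (fun x => (Pg x).2.1)
  have b4 := cut_fun_abs m K hK C hC η hcut fm gm mfm (fun x => (Pf x).2.2.2.1)
    (fun x => (Pf x).2.2.2.2.1) mgm (fun x => (Pg x).2.2.2.1) (fun x => (Pg x).2.2.2.2.1)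
  rw [abs_le] at *
  constructor <;> linarith [b1.1, b1.2, b2.1, b2.2, b3.1, b3.2, b4.1, b4.2]

/-- The `C₄` density is controlled by the cut norm. -/
lemma c4_le {Ω : Type} [MeasurableSpace Ω] (m : Measure Ω) [IsProbabilityMeasure m]
    (K : Ω → Ω → ℝ) (hK : Measurable (Function.uncurry K)) (hC : ∀ x y, |K x y| ≤ 1)
    (η : ℝ) (hcut : CutLe m K η) :
    ∫ p, ∫ r, K r.1 r.2 * K p.1 r.2 * K r.1 p.2 * K p.1 p.2 ∂(m.prod m) ∂(m.prod m)
      ≤ 4 * η := by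
  have h : ∀ p : Ω × Ω, ∫ r, K r.1 r.2 * K p.1 r.2 * K r.1 p.2 * K p.1 p.2 ∂(m.prod m)
      ≤ 4 * η := by
    intro p
    have := cut_fun_signed m K hK 1 hC η hcut (fun x => K x p.2) (fun y => K p.1 y)
      (hK.comp (measurable_id.prodMk measurable_const)) (fun x => hC _ _)
      (hK.comp (measurable_const.prodMk measurable_id)) (fun x => hC _ _)
    have e : ∫ r, K r.1 r.2 * K p.1 r.2 * K r.1 p.2 * K p.1 p.2 ∂(m.prod m) =
        (∫ r, K r.1 p.2 * K p.1 r.2 * K r.1 r.2 ∂(m.prod m)) * K p.1 p.2 := by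
      rw [← integral_mul_const]
      congr 1; ext r; ring
    rw [e]
    refine (le_abs_self _).trans ?_
    rw [abs_mul]
    calc _ ≤ |∫ r, K r.1 p.2 * K p.1 r.2 * K r.1 r.2 ∂(m.prod m)| * 1 := by
          gcongr; exact hC _ _
      _ ≤ 4 * η := by simpa using this
  have hη : 0 ≤ 4 * η := by
    have := (abs_nonneg _).trans (hcut ∅ ∅ .empty .empty)
    linarith
  by_cases hi : Integrable (fun p : Ω × Ω =>
      ∫ r, K r.1 r.2 * K p.1 r.2 * K r.1 p.2 * K p.1 p.2 ∂(m.prod m)) (m.prod m)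
  · calc _ ≤ ∫ p : Ω × Ω, 4 * η ∂(m.prod m) := integral_mono hi (integrable_const _) h
      _ = 4 * η := by simp
  · rw [integral_undef hi]; exact hη

/-- One step of the energy decrement. -/
lemma energy_step {Ω : Type} [MeasurableSpace Ω] (m : Measure Ω) [IsProbabilityMeasure m]
    (W : Ω → Ω → ℝ) (hW : Measurable (Function.uncurry W)) (hs : ∀ x y, W x y = W y x)
    (h01 : ∀ x y, W x y ∈ Set.Icc (0:ℝ) 1) (η : ℝ) (hη : 0 < η) (q : ℕ)
    (f : Ω → Fin q) (hf : Measurable f) (A : Fin q → Fin q → ℝ) (hA : ∀ i j, A i j = A j i)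
    (hA1 : ∀ i j, A i j ∈ Set.Icc (0:ℝ) 1)
    (hbad : ¬ CutLe m (fun x y => W x y - A (f x) (f y)) η) :
    ∃ f' : Ω → Fin (q * 4), Measurable f' ∧ ∃ A' : Fin (q * 4) → Fin (q * 4) → ℝ,
      (∀ i j, A' i j = A' j i) ∧ (∀ i j, A' i j ∈ Set.Icc (0:ℝ) 1) ∧
      ∫ p, (W p.1 p.2 - A' (f' p.1) (f' p.2)) ^ 2 ∂(m.prod m) ≤
        ∫ p, (W p.1 p.2 - A (f p.1) (f p.2)) ^ 2 ∂(m.prod m) - η ^ 2 := by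
  classical
  unfold CutLe at hbad
  push Not at hbad
  obtain ⟨S, T, hS, hT, hST⟩ := hbad
  set Δ : Ω → Ω → ℝ := fun x y => W x y - A (f x) (f y) with hΔ
  have hAm : Measurable (fun p : Ω × Ω => A (f p.1) (f p.2)) := by
    have : Measurable (fun ij : Fin q × Fin q => A ij.1 ij.2) := measurable_of_finite _
    exact this.comp ((hf.comp measurable_fst).prodMk (hf.comp measurable_snd))
  have hΔm : Measurable (Function.uncurry Δ) := hW.sub hAm
  have hΔb : ∀ x y, |Δ x y| ≤ 1 := by
    intro x y
    have a := h01 x y; have b := hA1 (f x) (f y)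
    rw [abs_le]; constructor <;> simp only [hΔ] <;> linarith [a.1, a.2, b.1, b.2]
  set I := ∫ p in S ×ˢ T, Δ p.1 p.2 ∂(m.prod m) with hI
  set c : ℝ := if 0 ≤ I then η else -η with hc
  have hcI : c * I = η * |I| := by
    by_cases h : 0 ≤ I
    · simp [hc, h, abs_of_nonneg h]
    · simp [hc, h, abs_of_neg (not_le.mp h)]
  have hc2 : c ^ 2 = η ^ 2 := by by_cases h : 0 ≤ I <;> simp [hc, h]
  let bit : Set Ω → Ω → ℝ := fun S x => S.indicator (fun _ => (1:ℝ)) x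
  have hbit : ∀ S, MeasurableSet S → Measurable (bit S) := fun S hS =>
    measurable_const.indicator hS
  have hb01 : ∀ S x, 0 ≤ bit S x ∧ bit S x ≤ 1 := fun S x => by
    by_cases h : x ∈ S <;> simp [bit, h]
  let g : Ω → Ω → ℝ := fun x y => (bit S x * bit T y + bit T x * bit S y) / 2
  have hgm : Measurable (Function.uncurry g) :=
    ((((hbit S hS).comp measurable_fst).mul ((hbit T hT).comp measurable_snd)).add
      (((hbit T hT).comp measurable_fst).mul ((hbit S hS).comp measurable_snd))).div_const 2
  have hg01 : ∀ x y, 0 ≤ g x y ∧ g x y ≤ 1 := by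
    intro x y
    have a := hb01 S x; have b := hb01 T x; have a' := hb01 S y; have b' := hb01 T y
    have h1 : bit S x * bit T y ≤ 1 := mul_le_one₀ a.2 b'.1 b'.2
    have h2 : bit T x * bit S y ≤ 1 := mul_le_one₀ b.2 a'.1 a'.2
    have h3 : 0 ≤ bit S x * bit T y := mul_nonneg a.1 b'.1
    have h4 : 0 ≤ bit T x * bit S y := mul_nonneg b.1 a'.1
    constructor <;> simp only [g] <;> linarith
  -- encoding
  let code : Ω → Fin 4 := fun x =>
    if x ∈ S then (if x ∈ T then 3 else 1) else (if x ∈ T then 2 else 0)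
  have hcode : Measurable code :=
    Measurable.ite hS (Measurable.ite hT measurable_const measurable_const)
      (Measurable.ite hT measurable_const measurable_const)
  let dS : Fin 4 → ℝ := fun c => if c = 1 ∨ c = 3 then 1 else 0
  let dT : Fin 4 → ℝ := fun c => if c = 2 ∨ c = 3 then 1 else 0
  have hdS : ∀ x, dS (code x) = bit S x := by
    intro x; by_cases h1 : x ∈ S <;> by_cases h2 : x ∈ T <;> simp [dS, code, bit, h1, h2]
  have hdT : ∀ x, dT (code x) = bit T x := by
    intro x; by_cases h1 : x ∈ S <;> by_cases h2 : x ∈ T <;> simp [dT, code, bit, h1, h2]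
  let e : Fin q × Fin 4 ≃ Fin (q * 4) := finProdFinEquiv
  let f' : Ω → Fin (q * 4) := fun x => e (f x, code x)
  have hf' : Measurable f' := (measurable_of_finite e).comp (hf.prodMk hcode)
  let G : Fin (q*4) → Fin (q*4) → ℝ := fun i j =>
    (dS (e.symm i).2 * dT (e.symm j).2 + dT (e.symm i).2 * dS (e.symm j).2) / 2
  let A' : Fin (q*4) → Fin (q*4) → ℝ := fun i j =>
    max 0 (min 1 (A (e.symm i).1 (e.symm j).1 + c * G i j))
  refine ⟨f', hf', A', ?_, ?_, ?_⟩
  · intro i j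
    have : G i j = G j i := by simp only [G]; ring
    simp only [A', this, hA (e.symm i).1]
  · intro i j
    exact ⟨le_max_left _ _, max_le zero_le_one (min_le_left _ _)⟩
  have hA'v : ∀ x y, A' (f' x) (f' y) = max 0 (min 1 (A (f x) (f y) + c * g x y)) := by
    intro x y
    simp only [A', f', G, g, Equiv.symm_apply_apply, hdS, hdT]
  have hle : ∀ p : Ω × Ω, (W p.1 p.2 - A' (f' p.1) (f' p.2)) ^ 2 ≤
      (Δ p.1 p.2 - c * g p.1 p.2) ^ 2 := by
    intro p
    rw [hA'v]
    have a := h01 p.1 p.2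
    have e1 : Δ p.1 p.2 - c * g p.1 p.2 = W p.1 p.2 - (A (f p.1) (f p.2) + c * g p.1 p.2) := by
      simp only [hΔ]; ring
    rw [e1]
    generalize A (f p.1) (f p.2) + c * g p.1 p.2 = u
    rw [sq_le_sq]
    rcases le_total u 0 with h | h
    · rw [min_eq_right (by linarith), max_eq_left h, abs_of_nonneg (by linarith [a.1]),
        abs_of_nonneg (by linarith [a.1])]; linarith
    · rcases le_total u 1 with h' | h'
      · rw [min_eq_right h', max_eq_right h]
      · rw [min_eq_left h', max_eq_right zero_le_one, abs_of_nonpos (by linarith [a.2]),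
          abs_of_nonpos (by linarith [a.2])]; linarith
  have i1 : Integrable (fun p : Ω × Ω => (Δ p.1 p.2) ^ 2) (m.prod m) := by
    refine ker_integrable _ (hΔm.pow_const 2) (C := 1) fun p => ?_
    rw [abs_pow]; exact pow_le_one₀ (abs_nonneg _) (hΔb _ _)
  have hgb : ∀ x y, |g x y| ≤ 1 := fun x y => by
    rw [abs_of_nonneg (hg01 x y).1]; exact (hg01 x y).2
  have i2 : Integrable (fun p : Ω × Ω => Δ p.1 p.2 * g p.1 p.2) (m.prod m) := by
    refine ker_integrable _ (hΔm.mul hgm) (C := 1) fun p => ?_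
    rw [abs_mul]; exact mul_le_one₀ (hΔb _ _) (abs_nonneg _) (hgb _ _)
  have i3 : Integrable (fun p : Ω × Ω => (g p.1 p.2) ^ 2) (m.prod m) := by
    refine ker_integrable _ (hgm.pow_const 2) (C := 1) fun p => ?_
    rw [abs_pow]; exact pow_le_one₀ (abs_nonneg _) (hgb _ _)
  have hΔg : ∫ p, Δ p.1 p.2 * g p.1 p.2 ∂(m.prod m) = I := by
    have j : ∀ S T, MeasurableSet S → MeasurableSet T →
        Integrable (fun p : Ω × Ω => bit S p.1 * bit T p.2 * Δ p.1 p.2) (m.prod m) := by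
      intro S T hS hT
      refine ker_integrable _ ((((hbit S hS).comp measurable_fst).mul
        ((hbit T hT).comp measurable_snd)).mul hΔm) (C := 1) fun p => ?_
      rw [abs_mul, abs_of_nonneg (mul_nonneg (hb01 S _).1 (hb01 T _).1)]
      exact mul_le_one₀ (mul_le_one₀ (hb01 S _).2 (hb01 T _).1 (hb01 T _).2) (abs_nonneg _)
        (hΔb _ _)
    have k1 : ∫ p, bit S p.1 * bit T p.2 * Δ p.1 p.2 ∂(m.prod m) = I := by
      rw [hI, ← integral_indicator (hS.prod hT)]
      congr 1; ext p
      by_cases h1 : p.1 ∈ S <;> by_cases h2 : p.2 ∈ T <;> simp [bit, h1, h2, Set.indicator]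
    have hΔs : ∀ x y, Δ x y = Δ y x := fun x y => by simp only [hΔ, hs x y, hA (f x)]
    have k2 : ∫ p, bit T p.1 * bit S p.2 * Δ p.1 p.2 ∂(m.prod m) = I := by
      rw [← k1, ← integral_prod_swap]
      congr 1; ext p; simp only [Prod.fst_swap, Prod.snd_swap, hΔs p.2 p.1]; ring
    have : ∀ p : Ω × Ω, Δ p.1 p.2 * g p.1 p.2 = (bit S p.1 * bit T p.2 * Δ p.1 p.2
        + bit T p.1 * bit S p.2 * Δ p.1 p.2) / 2 := by
      intro p; simp only [g]; ring
    simp_rw [this]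
    rw [integral_div, integral_add (j S T hS hT) (j T S hT hS), k1, k2]; ring
  have hgg : ∫ p, (g p.1 p.2) ^ 2 ∂(m.prod m) ≤ 1 := by
    calc _ ≤ ∫ p : Ω × Ω, (1:ℝ) ∂(m.prod m) := by
          refine integral_mono i3 (integrable_const _) fun p => ?_
          exact pow_le_one₀ (hg01 _ _).1 (hg01 _ _).2
      _ = 1 := by simp
  have iA' : Integrable (fun p : Ω × Ω => (W p.1 p.2 - A' (f' p.1) (f' p.2)) ^ 2)
      (m.prod m) := by
    have hm : Measurable (fun p : Ω × Ω => A' (f' p.1) (f' p.2)) := by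
      have : Measurable (fun ij : Fin (q*4) × Fin (q*4) => A' ij.1 ij.2) := measurable_of_finite _
      exact this.comp ((hf'.comp measurable_fst).prodMk (hf'.comp measurable_snd))
    refine ker_integrable _ ((hW.sub hm).pow_const 2) (C := 1) fun p => ?_
    rw [abs_pow]
    refine pow_le_one₀ (abs_nonneg _) ?_
    have a := h01 p.1 p.2
    have b1 : 0 ≤ A' (f' p.1) (f' p.2) := le_max_left _ _
    have b2 : A' (f' p.1) (f' p.2) ≤ 1 := max_le zero_le_one (min_le_left _ _)
    change |W p.1 p.2 - A' (f' p.1) (f' p.2)| ≤ 1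
    rw [abs_le]; constructor <;> linarith [a.1, a.2]
  have iexp : ∀ p : Ω × Ω, (Δ p.1 p.2 - c * g p.1 p.2) ^ 2 =
      (Δ p.1 p.2) ^ 2 - (2 * c * (Δ p.1 p.2 * g p.1 p.2) - c ^ 2 * (g p.1 p.2) ^ 2) := by
    intro p; ring
  calc _ ≤ ∫ p, (Δ p.1 p.2 - c * g p.1 p.2) ^ 2 ∂(m.prod m) := by
        refine integral_mono iA' ?_ hle
        simp_rw [iexp]
        exact i1.sub ((i2.const_mul _).sub (i3.const_mul _))
    _ = ∫ p, (Δ p.1 p.2) ^ 2 ∂(m.prod m) - (2 * c * I -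
          c ^ 2 * ∫ p, (g p.1 p.2) ^ 2 ∂(m.prod m)) := by
        simp_rw [iexp]
        have i4 : Integrable (fun p : Ω × Ω => 2 * c * (Δ p.1 p.2 * g p.1 p.2) -
          c ^ 2 * (g p.1 p.2) ^ 2) (m.prod m) := (i2.const_mul _).sub (i3.const_mul _)
        rw [integral_sub i1 i4,
          integral_sub (i2.const_mul _) (i3.const_mul _), integral_const_mul,
          integral_const_mul, hΔg]
    _ ≤ _ := by
        have : c ^ 2 * ∫ p, (g p.1 p.2) ^ 2 ∂(m.prod m) ≤ η ^ 2 * 1 := by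
          rw [hc2]; gcongr
        nlinarith

/-- Weak regularity lemma. -/
theorem weak_reg (η : ℝ) (hη : 0 < η) : ∃ q : ℕ, 0 < q ∧
    ∀ (Ω : Type) [MeasurableSpace Ω] (m : Measure Ω) [IsProbabilityMeasure m]
    (W : Ω → Ω → ℝ), Measurable (Function.uncurry W) → (∀ x y, W x y = W y x) →
    (∀ x y, W x y ∈ Set.Icc (0:ℝ) 1) →
    ∃ f : Ω → Fin q, Measurable f ∧ ∃ A : Fin q → Fin q → ℝ, (∀ i j, A i j = A j i) ∧
      (∀ i j, A i j ∈ Set.Icc (0:ℝ) 1) ∧ CutLe m (fun x y => W x y - A (f x) (f y)) η := by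
  obtain ⟨J, hJ⟩ := exists_nat_gt (1 / η ^ 2)
  refine ⟨4 ^ J, by positivity, ?_⟩
  intro Ω _ m _ W hW hs h01
  have key : ∀ j : ℕ, ∃ f : Ω → Fin (4 ^ j), Measurable f ∧ ∃ A : Fin (4^j) → Fin (4^j) → ℝ,
      (∀ i j, A i j = A j i) ∧ (∀ i j, A i j ∈ Set.Icc (0:ℝ) 1) ∧
      (CutLe m (fun x y => W x y - A (f x) (f y)) η ∨
        ∫ p, (W p.1 p.2 - A (f p.1) (f p.2)) ^ 2 ∂(m.prod m) ≤ 1 - j * η ^ 2) := by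
    intro j
    induction j with
    | zero =>
      refine ⟨fun _ => ⟨0, by simp⟩, measurable_const, fun _ _ => 0, fun _ _ => rfl,
        fun _ _ => by simp, Or.inr ?_⟩
      calc _ ≤ ∫ p : Ω × Ω, (1:ℝ) ∂(m.prod m) := by
            refine integral_mono (ker_integrable _ ?_ (C := 1) ?_) (integrable_const _) ?_
            · simpa [Function.uncurry] using hW.pow_const 2
            · intro p
              have a := h01 p.1 p.2
              rw [abs_pow, sub_zero, abs_of_nonneg a.1]
              exact pow_le_one₀ a.1 a.2
            · intro p
              have a := h01 p.1 p.2
              simp only [sub_zero]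
              exact pow_le_one₀ a.1 a.2
        _ = 1 - ((0:ℕ):ℝ) * η ^ 2 := by simp
    | succ j ih =>
      obtain ⟨f, hf, A, hA, hA1, h⟩ := ih
      by_cases hg : CutLe m (fun x y => W x y - A (f x) (f y)) η
      · let e : Fin (4 ^ j) × Fin 4 ≃ Fin (4 ^ j * 4) := finProdFinEquiv
        refine ⟨fun x => e (f x, 0), (measurable_of_finite e).comp
          (hf.prodMk measurable_const), fun a b => A (e.symm a).1 (e.symm b).1,
          fun a b => hA _ _, fun a b => hA1 _ _, Or.inl ?_⟩
        simpa using hg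
      · have h' := h.resolve_left hg
        obtain ⟨f', hf', A', hA', hA1', hE⟩ := energy_step m W hW hs h01 η hη _ f hf A hA hA1 hg
        refine ⟨f', hf', A', hA', hA1', Or.inr (hE.trans ?_)⟩
        push_cast
        linarith
  obtain ⟨f, hf, A, hA, hA1, h⟩ := key J
  refine ⟨f, hf, A, hA, hA1, h.resolve_right ?_⟩
  intro h
  have h0 : 0 ≤ ∫ p, (W p.1 p.2 - A (f p.1) (f p.2)) ^ 2 ∂(m.prod m) :=
    integral_nonneg fun p => sq_nonneg _
  have : 1 < J * η ^ 2 := by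
    rwa [div_lt_iff₀ (by positivity)] at hJ
  linarith

/-! ### Part 2: cut norm on the unit interval, measure preserving maps -/

/-- Lebesgue measure on the unit interval. -/
def mu : Measure ℝ := volume.restrict I01

lemma measurableSet_I01 : MeasurableSet I01 := measurableSet_Icc

instance mu_prob : IsProbabilityMeasure mu := by
  constructor
  simp [mu, I01]

lemma mu_restrict (S : Set ℝ) (hS : MeasurableSet S) :
    mu.restrict S = volume.restrict (S ∩ I01) := by
  rw [mu, Measure.restrict_restrict hS]

lemma iter_eq (D : ℝ → ℝ → ℝ) (hD : Measurable (Function.uncurry D)) (C : ℝ)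
    (hC : ∀ x y, |D x y| ≤ C) (S T : Set ℝ) (hS : MeasurableSet S) (hT : MeasurableSet T) :
    ∫ p in S ×ˢ T, D p.1 p.2 ∂(mu.prod mu) = ∫ x in S ∩ I01, ∫ y in T ∩ I01, D x y := by
  rw [← mu_restrict S hS, ← mu_restrict T hT, ← Measure.prod_restrict]
  rw [integral_prod]
  rw [Measure.prod_restrict]
  exact (ker_integrable (mu.prod mu) (D := fun p : ℝ × ℝ => D p.1 p.2) hD
    (fun p => hC p.1 p.2)).integrableOn

lemma cutNorm_nonneg (D : ℝ → ℝ → ℝ) : 0 ≤ cutNorm D := by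
  apply Real.sSup_nonneg
  rintro r ⟨S, T, -, -, -, -, rfl⟩
  exact abs_nonneg _

lemma cutNorm_le {D : ℝ → ℝ → ℝ} (hD : Measurable (Function.uncurry D)) {C : ℝ}
    (hC : ∀ x y, |D x y| ≤ C) {c : ℝ} (h : CutLe mu D c) : cutNorm D ≤ c := by
  apply csSup_le
  · exact ⟨_, ∅, ∅, .empty, .empty, by simp, by simp, rfl⟩
  · rintro r ⟨S, T, hS, hT, hSI, hTI, rfl⟩
    have := h S T hS hT
    rw [iter_eq D hD C hC S T hS hT, Set.inter_eq_left.mpr hSI, Set.inter_eq_left.mpr hTI] at this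
    exact this

lemma cutLe_cutNorm {D : ℝ → ℝ → ℝ} (hD : Measurable (Function.uncurry D)) {C : ℝ}
    (hC : ∀ x y, |D x y| ≤ C) : CutLe mu D (cutNorm D) := by
  intro S T hS hT
  rw [iter_eq D hD C hC S T hS hT]
  apply le_csSup
  · refine ⟨C, ?_⟩
    rintro r ⟨S, T, hS, hT, hSI, hTI, rfl⟩
    have e := iter_eq D hD C hC S T hS hT
    rw [Set.inter_eq_left.mpr hSI, Set.inter_eq_left.mpr hTI] at e
    rw [← e]
    have hC0 : 0 ≤ C := (abs_nonneg _).trans (hC 0 0)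
    have := norm_setIntegral_le_of_norm_le_const (μ := mu.prod mu) (s := S ×ˢ T) (C := C)
      (f := fun p : ℝ × ℝ => D p.1 p.2) (measure_lt_top _ _) (fun p _ => by simpa using hC p.1 p.2)
    refine this.trans ?_
    calc C * (mu.prod mu).real (S ×ˢ T) ≤ C * 1 := by gcongr; exact measureReal_le_one
      _ = C := mul_one C
  · exact ⟨S ∩ I01, T ∩ I01, hS.inter measurableSet_I01, hT.inter measurableSet_I01,
      Set.inter_subset_right, Set.inter_subset_right, rfl⟩

lemma l1Norm_eq {D : ℝ → ℝ → ℝ} (hD : Measurable (Function.uncurry D)) {C : ℝ}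
    (hC : ∀ x y, |D x y| ≤ C) : l1Norm D = ∫ p, |D p.1 p.2| ∂(mu.prod mu) := by
  have h := iter_eq (fun x y => |D x y|) hD.norm C (by simpa using hC) Set.univ Set.univ
    .univ .univ
  simp only [Set.univ_prod_univ, Measure.restrict_univ, Set.univ_inter] at h
  rw [h, l1Norm]

lemma CutLe.mono {Ω : Type} [MeasurableSpace Ω] {m : Measure Ω} {K : Ω → Ω → ℝ} {c d : ℝ}
    (h : CutLe m K c) (hcd : c ≤ d) : CutLe m K d :=
  fun S T hS hT => (h S T hS hT).trans hcd

lemma CutLe.add {Ω : Type} [MeasurableSpace Ω] {m : Measure Ω} [IsProbabilityMeasure m]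
    {K L : Ω → Ω → ℝ} {c d C C' : ℝ}
    (hKm : Measurable (Function.uncurry K)) (hK : ∀ x y, |K x y| ≤ C)
    (hLm : Measurable (Function.uncurry L)) (hL : ∀ x y, |L x y| ≤ C')
    (h : CutLe m K c) (h' : CutLe m L d) : CutLe m (fun x y => K x y + L x y) (c + d) := by
  intro S T hS hT
  rw [integral_add
    (ker_integrable (m.prod m) (D := fun p => K p.1 p.2) hKm (fun p => hK _ _)).integrableOn
    (ker_integrable (m.prod m) (D := fun p => L p.1 p.2) hLm (fun p => hL _ _)).integrableOn]
  exact (abs_add_le _ _).trans (add_le_add (h S T hS hT) (h' S T hS hT))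

lemma CutLe.of_l1 {Ω : Type} [MeasurableSpace Ω] {m : Measure Ω} [IsProbabilityMeasure m]
    {K : Ω → Ω → ℝ} {C : ℝ}
    (hKm : Measurable (Function.uncurry K)) (hK : ∀ x y, |K x y| ≤ C) :
    CutLe m K (∫ p, |K p.1 p.2| ∂(m.prod m)) := by
  intro S T hS hT
  refine (abs_integral_le_integral_abs).trans ?_
  refine setIntegral_le_integral ?_ (Eventually.of_forall fun p => abs_nonneg _)
  exact (ker_integrable (m.prod m) (D := fun p => K p.1 p.2) hKm (fun p => hK _ _)).abs

namespace InvMP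

lemma meas (φ : InvMP) : Measurable φ.toFun := φ.measurePreserving.measurable
lemma measInv (φ : InvMP) : Measurable φ.invFun := φ.measurePreservingInv.measurable
lemma mp (φ : InvMP) : MeasurePreserving φ.toFun mu mu := φ.measurePreserving

/-- The identity. -/
def idm : InvMP where
  toFun := id
  invFun := id
  maps := fun _ h => h
  mapsInv := fun _ h => h
  measurePreserving := MeasurePreserving.id _
  measurePreservingInv := MeasurePreserving.id _
  leftInv := fun _ _ => rfl
  rightInv := fun _ _ => rfl

/-- The inverse map. -/
def symm (φ : InvMP) : InvMP where
  toFun := φ.invFun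
  invFun := φ.toFun
  maps := φ.mapsInv
  mapsInv := φ.maps
  measurePreserving := φ.measurePreservingInv
  measurePreservingInv := φ.measurePreserving
  leftInv := φ.rightInv
  rightInv := φ.leftInv

/-- Composition: first `φ`, then `ψ`. -/
def trans (φ ψ : InvMP) : InvMP where
  toFun := fun x => ψ.toFun (φ.toFun x)
  invFun := fun x => φ.invFun (ψ.invFun x)
  maps := fun x h => ψ.maps _ (φ.maps x h)
  mapsInv := fun x h => φ.mapsInv _ (ψ.mapsInv x h)
  measurePreserving := ψ.measurePreserving.comp φ.measurePreserving
  measurePreservingInv := φ.measurePreservingInv.comp ψ.measurePreservingInv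
  leftInv := fun x h => by rw [ψ.leftInv _ (φ.maps x h), φ.leftInv x h]
  rightInv := fun x h => by rw [φ.rightInv _ (ψ.mapsInv x h), ψ.rightInv x h]

end InvMP

/-- Pullback of a kernel. -/
def pull (W : ℝ → ℝ → ℝ) (φ : InvMP) : ℝ → ℝ → ℝ := fun x y => W (φ.toFun x) (φ.toFun y)

lemma pull_meas {W : ℝ → ℝ → ℝ} (hW : Measurable (Function.uncurry W)) (φ : InvMP) :
    Measurable (Function.uncurry (pull W φ)) :=
  hW.comp ((φ.meas.comp measurable_fst).prodMk (φ.meas.comp measurable_snd))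

lemma IsGraphon.pull {W : ℝ → ℝ → ℝ} (hW : IsGraphon W) (φ : InvMP) : IsGraphon (pull W φ) :=
  ⟨pull_meas hW.1 φ, fun _ _ => hW.2.1 _ _, fun _ _ => hW.2.2 _ _⟩

lemma ae_mem_I01 : ∀ᵐ p ∂(mu.prod mu), p.1 ∈ I01 ∧ p.2 ∈ I01 := by
  have : mu.prod mu = (volume.prod volume).restrict (I01 ×ˢ I01) := by
    rw [mu, Measure.prod_restrict]
  rw [this]
  filter_upwards [ae_restrict_mem (measurableSet_I01.prod measurableSet_I01)] with p hp
  exact hp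

lemma integral_pull {g : ℝ × ℝ → ℝ} (hg : Measurable g) (φ : InvMP) :
    ∫ p, g (φ.toFun p.1, φ.toFun p.2) ∂(mu.prod mu) = ∫ p, g p ∂(mu.prod mu) := by
  have h := φ.mp.prod φ.mp
  conv_rhs => rw [← h.map_eq]
  rw [integral_map h.measurable.aemeasurable hg.aestronglyMeasurable]
  rfl

lemma CutLe.congr {D D' : ℝ → ℝ → ℝ} {c : ℝ} (h : CutLe mu D c)
    (e : ∀ᵐ p ∂(mu.prod mu), D p.1 p.2 = D' p.1 p.2) : CutLe mu D' c := by
  intro S T hS hT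
  rw [← integral_congr_ae (ae_restrict_of_ae e)]
  exact h S T hS hT

lemma CutLe.pull {D : ℝ → ℝ → ℝ} {c : ℝ} (hD : Measurable (Function.uncurry D))
    (h : CutLe mu D c) (φ : InvMP) : CutLe mu (pull D φ) c := by
  intro S T hS hT
  have hS' : MeasurableSet (φ.invFun ⁻¹' S) := φ.measInv hS
  have hT' : MeasurableSet (φ.invFun ⁻¹' T) := φ.measInv hT
  have := h _ _ hS' hT'
  rw [← integral_indicator (hS.prod hT)]
  rw [← integral_indicator (hS'.prod hT')] at this
  have hg : Measurable (((φ.invFun ⁻¹' S) ×ˢ (φ.invFun ⁻¹' T)).indicator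
      (fun p : ℝ × ℝ => D p.1 p.2)) :=
    Measurable.indicator (show Measurable (fun p : ℝ × ℝ => D p.1 p.2) from hD) (hS'.prod hT')
  rw [← integral_pull hg φ] at this
  convert this using 2
  refine integral_congr_ae ?_
  filter_upwards [ae_mem_I01] with p hp
  have e : (φ.toFun p.1, φ.toFun p.2) ∈ (φ.invFun ⁻¹' S) ×ˢ (φ.invFun ⁻¹' T) ↔ p ∈ S ×ˢ T := by
    rw [Set.mem_prod, Set.mem_prod, Set.mem_preimage, Set.mem_preimage, φ.leftInv _ hp.1,
      φ.leftInv _ hp.2]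
  by_cases h1 : p ∈ S ×ˢ T
  · rw [Set.indicator_of_mem h1, Set.indicator_of_mem (e.2 h1)]; rfl
  · rw [Set.indicator_of_notMem h1, Set.indicator_of_notMem (fun h => h1 (e.1 h))]

lemma pull_symm_ae (D : ℝ → ℝ → ℝ) (φ : InvMP) :
    ∀ᵐ p ∂(mu.prod mu), pull (pull D φ) φ.symm p.1 p.2 = D p.1 p.2 := by
  filter_upwards [ae_mem_I01] with p hp
  simp only [_root_.pull, InvMP.symm, φ.rightInv _ hp.1, φ.rightInv _ hp.2]

/-- Difference of two graphons: measurability and bound. -/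
lemma sub_meas {U W : ℝ → ℝ → ℝ} (hU : IsGraphon U) (hW : IsGraphon W) :
    Measurable (Function.uncurry fun x y => U x y - W x y) := hU.1.sub hW.1

lemma sub_bdd {U W : ℝ → ℝ → ℝ} (hU : IsGraphon U) (hW : IsGraphon W) (x y : ℝ) :
    |U x y - W x y| ≤ 1 := by
  have a := hU.2.2 x y; have b := hW.2.2 x y
  rw [abs_le]; constructor <;> linarith [a.1, a.2, b.1, b.2]

/-- `U` and `W` are within cut distance `c` after a rearrangement. -/
def Near (U W : ℝ → ℝ → ℝ) (c : ℝ) : Prop :=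
  ∃ φ : InvMP, CutLe mu (fun x y => U x y - pull W φ x y) c

lemma near_of_deltaCut_lt {U W : ℝ → ℝ → ℝ} (hU : IsGraphon U) (hW : IsGraphon W) {c : ℝ}
    (h : deltaCut U W < c) : Near U W c := by
  haveI : Nonempty InvMP := ⟨InvMP.idm⟩
  obtain ⟨φ, hφ⟩ := exists_lt_of_ciInf_lt h
  exact ⟨φ, (cutLe_cutNorm (sub_meas hU (hW.pull φ)) (sub_bdd hU (hW.pull φ))).mono hφ.le⟩

lemma deltaCut_nonneg (U W : ℝ → ℝ → ℝ) : 0 ≤ deltaCut U W :=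
  Real.iInf_nonneg fun _ => cutNorm_nonneg _

lemma Near.deltaCut_le {U W : ℝ → ℝ → ℝ} (hU : IsGraphon U) (hW : IsGraphon W) {c : ℝ}
    (h : Near U W c) : deltaCut U W ≤ c := by
  obtain ⟨φ, hφ⟩ := h
  refine (ciInf_le ⟨0, ?_⟩ φ).trans (cutNorm_le (sub_meas hU (hW.pull φ))
    (sub_bdd hU (hW.pull φ)) hφ)
  rintro r ⟨ψ, rfl⟩
  exact cutNorm_nonneg _

lemma Near.symm {U W : ℝ → ℝ → ℝ} (hU : IsGraphon U) (hW : IsGraphon W) {c : ℝ}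
    (h : Near U W c) : Near W U c := by
  obtain ⟨φ, hφ⟩ := h
  refine ⟨φ.symm, ?_⟩
  have := ((hφ.pull (sub_meas hU (hW.pull φ)) φ.symm).neg)
  refine this.congr ?_
  filter_upwards [pull_symm_ae W φ] with p hp
  rw [← hp]
  simp only [_root_.pull]; ring

lemma Near.trans {U V W : ℝ → ℝ → ℝ} (hU : IsGraphon U) (hV : IsGraphon V) (hW : IsGraphon W)
    {c d : ℝ} (h : Near U V c) (h' : Near V W d) : Near U W (c + d) := by
  obtain ⟨φ, hφ⟩ := h
  obtain ⟨ψ, hψ⟩ := h'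
  refine ⟨φ.trans ψ, ?_⟩
  have h1 := hψ.pull (sub_meas hV (hW.pull ψ)) φ
  have := hφ.add (sub_meas hU (hV.pull φ)) (sub_bdd hU (hV.pull φ))
    (pull_meas (sub_meas hV (hW.pull ψ)) φ) (C' := 1)
    (fun x y => sub_bdd hV (hW.pull ψ) _ _) h1
  convert this using 3
  simp only [_root_.pull, InvMP.trans]; ring

lemma near_refl (U : ℝ → ℝ → ℝ) : Near U U 0 := by
  refine ⟨InvMP.idm, ?_⟩
  intro S T hS hT
  simp [pull, InvMP.idm]

lemma cube_restrict (k : ℕ) :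
    (volume : Measure (Fin k → ℝ)).restrict (cube k) = Measure.pi fun _ => mu := by
  rw [cube, volume_pi, Measure.restrict_pi_pi]
  rfl

lemma homDensity_pull {k : ℕ} (F : SimpleGraph (Fin k)) {W : ℝ → ℝ → ℝ} (hW : IsGraphon W)
    (φ : InvMP) : homDensity F (pull W φ) = homDensity F W := by
  classical
  unfold homDensity
  rw [cube_restrict]
  have h := measurePreserving_pi (fun _ : Fin k => mu) (fun _ => mu) (fun _ => φ.mp)
  conv_rhs => rw [← h.map_eq]
  rw [integral_map h.measurable.aemeasurable]
  · rfl
  · refine Measurable.aestronglyMeasurable ?_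
    refine Finset.measurable_prod _ fun i _ => Finset.measurable_prod _ fun j _ => ?_
    split_ifs
    · have h2 : Measurable (fun a : Fin k → ℝ => (a i, a j)) :=
        (measurable_pi_apply i).prodMk (measurable_pi_apply j)
      exact hW.1.comp h2
    · exact measurable_const

lemma graphonIso_pull {W : ℝ → ℝ → ℝ} (hW : IsGraphon W) (φ : InvMP) :
    GraphonIso (pull W φ) W := fun _ F => homDensity_pull F hW φ

open scoped Pointwise in
lemma volume_preCantor (n : ℕ) : volume (preCantorSet n) ≤ ENNReal.ofReal ((2 / 3) ^ n) := by
  induction n with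
  | zero => simp
  | succ n ih =>
    rw [preCantorSet_succ]
    have h1 : ((fun x : ℝ => x / 3) '' preCantorSet n) = (1 / 3 : ℝ) • preCantorSet n := by
      rw [← Set.image_smul]
      refine Set.image_congr fun x _ => ?_
      simp only [smul_eq_mul]; ring
    have h2 : ((fun x : ℝ => (2 + x) / 3) '' preCantorSet n)
        = (fun x => x + 2 / 3) '' ((1 / 3 : ℝ) • preCantorSet n) := by
      rw [← Set.image_smul, Set.image_image]
      refine Set.image_congr fun x _ => ?_
      simp only [smul_eq_mul]; ring
    have e1 : volume ((1 / 3 : ℝ) • preCantorSet n)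
        = ENNReal.ofReal (1 / 3) * volume (preCantorSet n) := by
      rw [Measure.addHaar_smul]; simp
    have e2 : volume ((fun x : ℝ => x + 2 / 3) '' ((1 / 3 : ℝ) • preCantorSet n))
        = ENNReal.ofReal (1 / 3) * volume (preCantorSet n) := by
      rw [Set.image_add_right, measure_preimage_add_right, e1]
    refine (measure_union_le _ _).trans ?_
    rw [h1, h2, e1, e2, ← two_mul, ← mul_assoc]
    calc 2 * ENNReal.ofReal (1 / 3) * volume (preCantorSet n)
        ≤ 2 * ENNReal.ofReal (1 / 3) * ENNReal.ofReal ((2 / 3) ^ n) := by gcongr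
      _ = ENNReal.ofReal ((2 / 3) ^ (n + 1)) := by
        rw [show (2 : ℝ≥0∞) = ENNReal.ofReal 2 by simp, ← ENNReal.ofReal_mul (by norm_num),
          ← ENNReal.ofReal_mul (by norm_num)]
        congr 1; ring

lemma mu_cantor : mu cantorSet = 0 := by
  have h0 : volume cantorSet = 0 := by
    have ht : Tendsto (fun n : ℕ => ENNReal.ofReal ((2 / 3 : ℝ) ^ n)) atTop (𝓝 0) := by
      rw [← ENNReal.ofReal_zero]
      exact ENNReal.tendsto_ofReal
        (tendsto_pow_atTop_nhds_zero_of_lt_one (by norm_num) (by norm_num))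
    refine le_antisymm (ge_of_tendsto' ht fun n => ?_) zero_le
    exact (measure_mono (Set.iInter_subset _ n)).trans (volume_preCantor n)
  exact le_antisymm ((Measure.restrict_apply_le _ _).trans h0.le) zero_le

lemma cantor_not_countable : ¬ cantorSet.Countable := by
  intro h
  have h1 : Countable cantorSet := h.to_subtype
  have h2 : Countable (ℕ → Bool) := cantorSetEquivNatToBool.symm.injective.countable
  obtain ⟨f, hf⟩ := h2.exists_injective_nat
  classical
  refine Function.cantor_injective (fun s : Set ℕ => f fun n => decide (n ∈ s)) ?_
  intro s t hst
  ext n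
  have := congrFun (hf hst) n
  simpa using this

lemma equiv_fun {A B : Set ℝ} (hA : MeasurableSet A) (hB : MeasurableSet B) (e : A ≃ᵐ B) :
    ∃ u v : ℝ → ℝ, Measurable u ∧ Measurable v ∧ (∀ x (h : x ∈ A), u x = e ⟨x, h⟩) ∧
      (∀ x (h : x ∈ B), v x = e.symm ⟨x, h⟩) := by
  classical
  refine ⟨fun x => if h : x ∈ A then e ⟨x, h⟩ else 0, fun x => if h : x ∈ B then e.symm ⟨x, h⟩ else 0,
    ?_, ?_, ?_, ?_⟩
  · refine Measurable.dite (s := A) (f := fun x => ((e x : B) : ℝ)) (g := fun _ => 0)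
      (measurable_subtype_coe.comp e.measurable) measurable_const hA
  · refine Measurable.dite (s := B) (f := fun x => ((e.symm x : A) : ℝ)) (g := fun _ => 0)
      (measurable_subtype_coe.comp e.symm.measurable) measurable_const hB
  · intro x h; simp [h]
  · intro x h; simp [h]

lemma exists_invMP {α : ℝ → ℝ} (hα : MeasurePreserving α mu mu) (hmap : ∀ x ∈ I01, α x ∈ I01)
    {X : Set ℝ} (hX : MeasurableSet X) (hXI : X ⊆ I01) (hX0 : mu Xᶜ = 0) (hinj : Set.InjOn α X) :
    ∃ φ : InvMP, φ.toFun =ᵐ[mu] α := by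
  classical
  have hCm : MeasurableSet cantorSet := isClosed_cantorSet.measurableSet
  set X' := X \ (cantorSet ∪ α ⁻¹' cantorSet) with hX'
  have hX'm : MeasurableSet X' := hX.diff (hCm.union (hα.measurable hCm))
  have hX'0 : mu X'ᶜ = 0 := by
    have : X'ᶜ ⊆ Xᶜ ∪ (cantorSet ∪ α ⁻¹' cantorSet) := by
      intro x hx
      by_cases h : x ∈ X
      · right; by_contra h2; exact hx ⟨h, h2⟩
      · left; exact h
    refine measure_mono_null this (measure_union_null hX0 (measure_union_null mu_cantor ?_))
    rw [hα.measure_preimage hCm.nullMeasurableSet]; exact mu_cantor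
  have hX'I : X' ⊆ I01 := fun x hx => hXI hx.1
  have hemb : MeasurableEmbedding (X'.domRestrict α) := by
    have hsb : StandardBorelSpace X' := hX'm.standardBorel
    refine Measurable.measurableEmbedding (hα.measurable.comp measurable_subtype_coe) ?_
    rw [← Set.injOn_iff_injective]
    exact hinj.mono Set.diff_subset
  set Y' := Set.range (X'.domRestrict α) with hY'
  have hY'm : MeasurableSet Y' := hemb.measurableSet_range
  have hY'I : Y' ⊆ I01 := by rintro _ ⟨x, rfl⟩; exact hmap _ (hX'I x.2)
  have hA : MeasurableSet (I01 \ X') := measurableSet_I01.diff hX'm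
  have hB : MeasurableSet (I01 \ Y') := measurableSet_I01.diff hY'm
  have hAc : ¬ Countable ↥(I01 \ X') := by
    intro h
    refine cantor_not_countable ((Set.countable_coe_iff.1 h).mono ?_)
    exact fun x hx => ⟨cantorSet_subset_unitInterval hx, fun h2 => h2.2 (Or.inl hx)⟩
  have hBc : ¬ Countable ↥(I01 \ Y') := by
    intro h
    refine cantor_not_countable ((Set.countable_coe_iff.1 h).mono ?_)
    refine fun x hx => ⟨cantorSet_subset_unitInterval hx, ?_⟩
    rintro ⟨y, rfl⟩
    exact y.2.2 (Or.inr hx)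
  have hsA : StandardBorelSpace ↥(I01 \ X') := hA.standardBorel
  have hsB : StandardBorelSpace ↥(I01 \ Y') := hB.standardBorel
  let e := PolishSpace.measurableEquivOfNotCountable hAc hBc
  obtain ⟨u1, v1, hu1, hv1, hu1', hv1'⟩ := equiv_fun hX'm hY'm hemb.equivRange
  obtain ⟨u2, v2, hu2, hv2, hu2', hv2'⟩ := equiv_fun hA hB e
  have hu1a : ∀ x ∈ X', u1 x = α x := by
    intro x hx; rw [hu1' x hx, hemb.equivRange_apply]; rfl
  have hae : X'.piecewise u1 u2 =ᵐ[mu] α := by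
    have : ∀ᵐ x ∂mu, x ∈ X' := by rw [ae_iff]; exact hX'0
    filter_upwards [this] with x hx
    rw [Set.piecewise_eq_of_mem _ _ _ hx, hu1a x hx]
  have hmeas : Measurable (X'.piecewise u1 u2) := hu1.piecewise hX'm hu2
  have hmeasI : Measurable (Y'.piecewise v1 v2) := hv1.piecewise hY'm hv2
  have hmp : MeasurePreserving (X'.piecewise u1 u2) mu mu :=
    ⟨hmeas, by rw [Measure.map_congr hae, hα.map_eq]⟩
  have hmaps : ∀ x ∈ I01, X'.piecewise u1 u2 x ∈ I01 := by
    intro x hx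
    by_cases h : x ∈ X'
    · rw [Set.piecewise_eq_of_mem _ _ _ h, hu1a x h]; exact hmap x hx
    · rw [Set.piecewise_eq_of_notMem _ _ _ h, hu2' x ⟨hx, h⟩]; exact (e _).2.1
  have hmapsI : ∀ x ∈ I01, Y'.piecewise v1 v2 x ∈ I01 := by
    intro x hx
    by_cases h : x ∈ Y'
    · rw [Set.piecewise_eq_of_mem _ _ _ h, hv1' x h]; exact hX'I (Subtype.coe_prop _)
    · rw [Set.piecewise_eq_of_notMem _ _ _ h, hv2' x ⟨hx, h⟩]; exact (Subtype.coe_prop (e.symm _)).1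
  have hl : ∀ x ∈ I01, Y'.piecewise v1 v2 (X'.piecewise u1 u2 x) = x := by
    intro x hx
    by_cases h : x ∈ X'
    · rw [Set.piecewise_eq_of_mem _ _ _ h, hu1' x h,
        Set.piecewise_eq_of_mem _ _ _ (Subtype.coe_prop _), hv1' _ (Subtype.coe_prop _)]
      simp
    · rw [Set.piecewise_eq_of_notMem _ _ _ h, hu2' x ⟨hx, h⟩,
        Set.piecewise_eq_of_notMem _ _ _ (Subtype.coe_prop (e _)).2, hv2' _ (Subtype.coe_prop (e _))]
      simp
  have hr : ∀ x ∈ I01, X'.piecewise u1 u2 (Y'.piecewise v1 v2 x) = x := by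
    intro x hx
    by_cases h : x ∈ Y'
    · rw [Set.piecewise_eq_of_mem _ _ _ h, hv1' x h,
        Set.piecewise_eq_of_mem _ _ _ (Subtype.coe_prop _), hu1' _ (Subtype.coe_prop _)]
      simp
    · rw [Set.piecewise_eq_of_notMem _ _ _ h, hv2' x ⟨hx, h⟩,
        Set.piecewise_eq_of_notMem _ _ _ (Subtype.coe_prop (e.symm _)).2,
        hu2' _ (Subtype.coe_prop (e.symm _))]
      simp
  have hIae : ∀ᵐ x ∂mu, x ∈ I01 := ae_restrict_mem measurableSet_I01
  have hmpI : MeasurePreserving (Y'.piecewise v1 v2) mu mu := by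
    refine ⟨hmeasI, ?_⟩
    conv_lhs => rw [← hmp.map_eq]
    rw [Measure.map_map hmeasI hmeas]
    have : (Y'.piecewise v1 v2 ∘ X'.piecewise u1 u2) =ᵐ[mu] id := by
      filter_upwards [hIae] with x hx using hl x hx
    rw [Measure.map_congr this, Measure.map_id]
  exact ⟨⟨X'.piecewise u1 u2, Y'.piecewise v1 v2, hmaps, hmapsI, hmp, hmpI, hl, hr⟩, hae⟩

lemma mu_singleton (y : ℝ) : mu {y} = 0 :=
  le_antisymm ((Measure.restrict_apply_le _ _).trans (by simp)) zero_le

instance mu_noAtoms : NullSingletonClass mu := ⟨mu_singleton⟩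

lemma mu_real_Iic (t : ℝ) (h0 : 0 ≤ t) (h1 : t ≤ 1) : mu (Set.Iic t) = ENNReal.ofReal t := by
  rw [mu, Measure.restrict_apply measurableSet_Iic]
  have : Set.Iic t ∩ I01 = Set.Icc 0 t := by
    ext x; simp only [I01, Set.mem_inter_iff, Set.mem_Iic, Set.mem_Icc]
    constructor
    · rintro ⟨a, b, c⟩; exact ⟨b, a⟩
    · rintro ⟨a, b⟩; exact ⟨b, a, b.trans h1⟩
  rw [this, Real.volume_Icc]; simp

lemma cdf_continuous (ν : Measure ℝ) [IsProbabilityMeasure ν] [NullSingletonClass ν] :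
    Continuous (ProbabilityTheory.cdf ν) := by
  rw [continuous_iff_continuousAt]
  intro x
  have hr := (ProbabilityTheory.cdf ν).right_continuous x
  have hm := (ProbabilityTheory.monotone_cdf ν)
  rw [continuousAt_iff_continuous_left'_right']
  refine ⟨?_, hr.mono Set.Ioi_subset_Ici_self⟩
  rw [hm.continuousWithinAt_Iio_iff_leftLim_eq]
  have h := (ProbabilityTheory.cdf ν).measure_singleton x
  rw [ProbabilityTheory.measure_cdf, measure_singleton] at h
  have h2 := ENNReal.ofReal_eq_zero.1 h.symm
  exact le_antisymm (hm.leftLim_le le_rfl) (by linarith)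

lemma map_cdf (ν : Measure ℝ) [IsProbabilityMeasure ν] [NullSingletonClass ν] :
    ν.map (ProbabilityTheory.cdf ν) = mu := by
  set F := ProbabilityTheory.cdf ν with hF
  have hc := cdf_continuous ν
  have hm := ProbabilityTheory.monotone_cdf ν
  have hivt : ∀ t, 0 < t → t < 1 → ∃ y, F y = t := by
    intro t h0 h1
    obtain ⟨a, ha⟩ := ((ProbabilityTheory.tendsto_cdf_atBot ν).eventually_lt_const h0).exists
    obtain ⟨b, hb⟩ := ((ProbabilityTheory.tendsto_cdf_atTop ν).eventually_const_lt h1).exists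
    exact mem_range_of_exists_le_of_exists_ge hc ⟨a, ha.le⟩ ⟨b, hb.le⟩
  have hp : IsProbabilityMeasure (ν.map F) := Measure.isProbabilityMeasure_map hc.aemeasurable
  apply Measure.ext_of_Iic
  intro t
  rw [Measure.map_apply hc.measurable measurableSet_Iic]
  have hlow : ∀ t, 0 < t → t < 1 → ENNReal.ofReal t ≤ ν (F ⁻¹' Set.Iic t) := by
    intro t h0 h1
    obtain ⟨y, rfl⟩ := hivt t h0 h1
    rw [ProbabilityTheory.ofReal_cdf]
    exact measure_mono fun z hz => hm hz
  have hup : ∀ t t', t < t' → 0 < t' → t' < 1 → ν (F ⁻¹' Set.Iic t) ≤ ENNReal.ofReal t' := by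
    intro t t' ht h0 h1
    obtain ⟨y, rfl⟩ := hivt t' h0 h1
    rw [ProbabilityTheory.ofReal_cdf]
    refine measure_mono fun z hz => ?_
    by_contra h
    simp only [Set.mem_Iic, not_le] at h
    have h3 := hm h.le
    have h4 : F z ≤ t := hz
    linarith
  rcases lt_or_ge t 0 with h | h
  · have e1 : F ⁻¹' Set.Iic t = ∅ := by
      ext z; simp only [Set.mem_preimage, Set.mem_Iic, Set.mem_empty_iff_false, iff_false, not_le]
      exact h.trans_le (ProbabilityTheory.cdf_nonneg ν z)
    rw [e1, measure_empty, mu, Measure.restrict_apply measurableSet_Iic]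
    have : Set.Iic t ∩ I01 = ∅ := by
      ext x; simp only [I01, Set.mem_inter_iff, Set.mem_Iic, Set.mem_Icc, Set.mem_empty_iff_false,
        iff_false]
      rintro ⟨a, b, c⟩; linarith
    rw [this, measure_empty]
  rcases lt_or_ge t 1 with h1 | h1
  · rw [mu_real_Iic t h h1.le]
    apply le_antisymm
    · have ht : Tendsto (fun t' => ENNReal.ofReal t') (𝓝[>] t) (𝓝 (ENNReal.ofReal t)) :=
        (ENNReal.continuous_ofReal.tendsto t).mono_left nhdsWithin_le_nhds
      refine ge_of_tendsto ht ?_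
      filter_upwards [Ioo_mem_nhdsGT h1] with t' ht'
      exact hup t t' ht'.1 (h.trans_lt ht'.1) ht'.2
    · rcases h.eq_or_lt with rfl | h0
      · simp
      · exact hlow t h0 h1
  · have e1 : F ⁻¹' Set.Iic t = Set.univ := by
      ext z; simp only [Set.mem_preimage, Set.mem_Iic, Set.mem_univ, iff_true]
      exact (ProbabilityTheory.cdf_le_one ν z).trans h1
    rw [e1, measure_univ]
    refine le_antisymm ?_ prob_le_one
    calc (1 : ℝ≥0∞) = mu (Set.Iic 1) := by rw [mu_real_Iic 1 zero_le_one le_rfl]; simp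
      _ ≤ _ := measure_mono (Set.Iic_subset_Iic.2 h1)

/-- Cumulative law of a labelling. -/
def cum {q : ℕ} {Ω : Type} [MeasurableSpace Ω] (m : Measure Ω) (f : Ω → Fin q) (i : Fin q) : ℝ :=
  m.real {x | f x ≤ i}

lemma sort_map {q : ℕ} (f : ℝ → Fin q) (hf : Measurable f) :
    ∃ φ : InvMP, ∀ᵐ x ∂mu, ∀ i, (f x ≤ i ↔ φ.toFun x ≤ cum mu f i) := by
  have hIae : ∀ᵐ x ∂mu, x ∈ I01 := ae_restrict_mem measurableSet_I01
  set g : ℝ → ℝ := fun x => 2 * ((f x : ℕ) : ℝ) + max 0 (min x 1) with hg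
  have hgm : Measurable g := by
    have : Measurable fun x => ((f x : ℕ) : ℝ) :=
      (measurable_of_countable (fun i : Fin q => ((i : ℕ) : ℝ))).comp hf
    fun_prop
  have hginj : Set.InjOn g I01 := by
    intro x hx y hy hxy
    have e1 : max 0 (min x 1) = x := by rw [min_eq_left hx.2, max_eq_right hx.1]
    have e2 : max 0 (min y 1) = y := by rw [min_eq_left hy.2, max_eq_right hy.1]
    simp only [hg, e1, e2] at hxy
    rcases lt_trichotomy (f x : ℕ) (f y) with h | h | h
    · have : ((f x : ℕ) : ℝ) + 1 ≤ (f y : ℕ) := by exact_mod_cast h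
      linarith [hx.1, hx.2, hy.1, hy.2]
    · rw [h] at hxy; linarith
    · have : ((f y : ℕ) : ℝ) + 1 ≤ (f x : ℕ) := by exact_mod_cast h
      linarith [hx.1, hx.2, hy.1, hy.2]
  set ν := mu.map g with hν
  have hνp : IsProbabilityMeasure ν := Measure.isProbabilityMeasure_map hgm.aemeasurable
  have hνa : NullSingletonClass ν := by
    constructor
    intro y
    rw [hν, Measure.map_apply hgm (measurableSet_singleton y), mu,
      Measure.restrict_apply (hgm (measurableSet_singleton y))]
    refine Set.Subsingleton.measure_zero ?_ _
    rintro a ⟨ha, ha'⟩ b ⟨hb, hb'⟩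
    exact hginj ha' hb' (ha.trans hb.symm)
  set F := ProbabilityTheory.cdf ν with hF
  have hm := ProbabilityTheory.monotone_cdf ν
  have hc := cdf_continuous ν
  set α : ℝ → ℝ := fun x => F (g x) with hα
  have hαm : Measurable α := hc.measurable.comp hgm
  have hαmp : MeasurePreserving α mu mu := by
    refine ⟨hαm, ?_⟩
    exact (Measure.map_map (μ := mu) hc.measurable hgm).symm.trans (map_cdf ν)
  set D := {c | ∃ x y, x < y ∧ F x = c ∧ F y = c} with hD
  have hDc : D.Countable := hm.countable_setOfPred_two_preimages
  have hX0 : mu (I01 \ α ⁻¹' D)ᶜ = 0 := by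
    refine measure_mono_null (t := I01ᶜ ∪ α ⁻¹' D) ?_ (measure_union_null ?_ ?_)
    · intro x hx
      by_cases h : x ∈ I01
      · right; by_contra h2; exact hx ⟨h, h2⟩
      · left; exact h
    · exact hIae
    · rw [hαmp.measure_preimage hDc.measurableSet.nullMeasurableSet]
      exact hDc.measure_zero mu
  obtain ⟨φ, hφ⟩ := exists_invMP hαmp
    (fun x _ => ⟨ProbabilityTheory.cdf_nonneg ν _, ProbabilityTheory.cdf_le_one ν _⟩)
    (X := I01 \ α ⁻¹' D) (measurableSet_I01.diff (hαm hDc.measurableSet))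
    (fun x hx => hx.1) hX0 (by
      intro x hx y hy hxy
      by_contra hne
      have hgne : g x ≠ g y := fun h => hne (hginj hx.1 hy.1 h)
      rcases lt_or_gt_of_ne hgne with h | h
      · exact hx.2 ⟨g x, g y, h, rfl, hxy.symm⟩
      · exact hx.2 ⟨g y, g x, h, hxy.symm, rfl⟩)
  refine ⟨φ, ?_⟩
  have hFi : ∀ i : Fin q, F (2 * ((i : ℕ) : ℝ) + 1) = cum mu f i := by
    intro i
    rw [hF, ProbabilityTheory.cdf_eq_real, cum, measureReal_def, measureReal_def, hν,
      Measure.map_apply hgm measurableSet_Iic]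
    congr 1
    apply measure_congr
    filter_upwards [hIae] with x hx
    apply propext
    change g x ≤ _ ↔ f x ≤ i
    have e1 : max 0 (min x 1) = x := by rw [min_eq_left hx.2, max_eq_right hx.1]
    simp only [hg, e1]
    constructor
    · intro h
      by_contra h2
      have : ((i : ℕ) : ℝ) + 1 ≤ (f x : ℕ) := by exact_mod_cast not_le.1 h2
      linarith [hx.1, hx.2]
    · intro h
      have : ((f x : ℕ) : ℝ) ≤ (i : ℕ) := by exact_mod_cast h
      linarith [hx.1, hx.2]
  have hne : ∀ᵐ x ∂mu, ∀ i : Fin q, α x ≠ cum mu f i := by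
    rw [ae_all_iff]
    intro i
    rw [ae_iff]
    have : {a | ¬ α a ≠ cum mu f i} = α ⁻¹' {cum mu f i} := by ext; simp
    rw [this, hαmp.measure_preimage (measurableSet_singleton _).nullMeasurableSet]
    exact mu_singleton _
  filter_upwards [hφ, hIae, hne] with x h1 hx h2 i
  rw [h1]
  have e1 : max 0 (min x 1) = x := by rw [min_eq_left hx.2, max_eq_right hx.1]
  constructor
  · intro h
    rw [← hFi i]
    apply hm
    simp only [hg, e1]
    have : ((f x : ℕ) : ℝ) ≤ (i : ℕ) := by exact_mod_cast h
    linarith [hx.1, hx.2]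
  · intro h
    by_contra h3
    refine h2 i (le_antisymm h ?_)
    rw [← hFi i]
    apply hm
    simp only [hg, e1]
    have : ((i : ℕ) : ℝ) + 1 ≤ (f x : ℕ) := by exact_mod_cast not_le.1 h3
    linarith [hx.1, hx.2]

lemma mu_real_uIoc (a b : ℝ) : mu.real (Set.uIoc a b) ≤ |a - b| := by
  have h : mu (Set.uIoc a b) ≤ volume (Set.uIoc a b) := Measure.restrict_apply_le _ _
  rw [Real.volume_uIoc] at h
  rw [measureReal_def, abs_sub_comm]
  exact ENNReal.toReal_le_of_le_ofReal (abs_nonneg _) h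

lemma match_map {q : ℕ} (f f' : ℝ → Fin q) (hf : Measurable f) (hf' : Measurable f') :
    ∃ ψ : InvMP, mu.real {x | f' (ψ.toFun x) ≠ f x} ≤ ∑ i, |cum mu f i - cum mu f' i| := by
  obtain ⟨φ, hφ⟩ := sort_map f hf
  obtain ⟨φ', hφ'⟩ := sort_map f' hf'
  have hIae : ∀ᵐ x ∂mu, x ∈ I01 := ae_restrict_mem measurableSet_I01
  refine ⟨φ.trans φ'.symm, ?_⟩
  have h2 := (φ.trans φ'.symm).mp.quasiMeasurePreserving.ae hφ'
  have hsub : ∀ᵐ x ∂mu, x ∈ {x | f' ((φ.trans φ'.symm).toFun x) ≠ f x} →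
      x ∈ ⋃ i, φ.toFun ⁻¹' Set.uIoc (cum mu f i) (cum mu f' i) := by
    filter_upwards [hφ, h2, hIae] with x h1 h2 hx hne
    have e : φ'.toFun ((φ.trans φ'.symm).toFun x) = φ.toFun x := by
      simp only [InvMP.trans, InvMP.symm]
      exact φ'.rightInv _ (φ.maps x hx)
    rw [e] at h2
    simp only [Set.mem_iUnion, Set.mem_preimage]
    by_contra hcon
    push Not at hcon
    apply hne
    have key : ∀ i, (f' ((φ.trans φ'.symm).toFun x) ≤ i ↔ f x ≤ i) := by
      intro i
      rw [h1 i, h2 i]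
      have := hcon i
      rw [Set.mem_uIoc] at this
      push Not at this
      constructor
      · intro h; by_contra h'
        exact absurd h (not_le.2 (this.1 (not_le.1 h')))
      · intro h; by_contra h'
        exact absurd h (not_le.2 (this.2 (not_le.1 h')))
    exact le_antisymm ((key _).2 le_rfl) ((key _).1 le_rfl)
  calc mu.real {x | f' ((φ.trans φ'.symm).toFun x) ≠ f x}
      ≤ mu.real (⋃ i, φ.toFun ⁻¹' Set.uIoc (cum mu f i) (cum mu f' i)) := by
        exact ENNReal.toReal_mono (measure_ne_top _ _) (measure_mono_ae hsub)
    _ ≤ ∑ i, mu.real (φ.toFun ⁻¹' Set.uIoc (cum mu f i) (cum mu f' i)) :=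
        measureReal_iUnion_fintype_le _
    _ ≤ _ := by
        refine Finset.sum_le_sum fun i _ => ?_
        rw [φ.mp.measureReal_preimage measurableSet_uIoc.nullMeasurableSet]
        exact mu_real_uIoc _ _

lemma step_meas {Ω : Type} [MeasurableSpace Ω] {q : ℕ} (A : Fin q → Fin q → ℝ) {f : Ω → Fin q}
    (hf : Measurable f) : Measurable (Function.uncurry fun x y => A (f x) (f y)) :=
  (measurable_of_countable (fun p : Fin q × Fin q => A p.1 p.2)).comp
    ((hf.comp measurable_fst).prodMk (hf.comp measurable_snd))

lemma abs_sub_le_one_of_mem {a b : ℝ} (ha : a ∈ Set.Icc (0 : ℝ) 1) (hb : b ∈ Set.Icc (0 : ℝ) 1) :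
    |a - b| ≤ 1 := by
  rw [abs_le]; constructor <;> linarith [ha.1, ha.2, hb.1, hb.2]

lemma near_of_steps {W W' : ℝ → ℝ → ℝ} (hW : IsGraphon W) (hW' : IsGraphon W') {q : ℕ}
    {A A' : Fin q → Fin q → ℝ} (hA : ∀ i j, A i j ∈ Set.Icc (0 : ℝ) 1)
    (hA' : ∀ i j, A' i j ∈ Set.Icc (0 : ℝ) 1) {a : ℝ} (haa : ∀ i j, |A i j - A' i j| ≤ a)
    {f f' : ℝ → Fin q} (hf : Measurable f) (hf' : Measurable f') {c c' s : ℝ}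
    (hc : CutLe mu (fun x y => W x y - A (f x) (f y)) c)
    (hc' : CutLe mu (fun x y => W' x y - A' (f' x) (f' y)) c')
    (hs : ∑ i, |cum mu f i - cum mu f' i| ≤ s) : Near W W' (c + c' + a + 2 * s) := by
  obtain ⟨ψ, hψ⟩ := match_map f f' hf hf'
  refine ⟨ψ, ?_⟩
  have hq : Measurable fun x => f' (ψ.toFun x) := hf'.comp ψ.meas
  have m1 : Measurable (Function.uncurry fun x y => W x y - A (f x) (f y)) :=
    hW.1.sub (step_meas A hf)
  have m2 : Measurable (Function.uncurry fun x y => W' x y - A' (f' x) (f' y)) :=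
    hW'.1.sub (step_meas A' hf')
  have m3 : Measurable (Function.uncurry fun x y =>
      A (f x) (f y) - A' (f' (ψ.toFun x)) (f' (ψ.toFun y))) :=
    (step_meas A hf).sub (step_meas A' hq)
  have b3 : ∀ x y, |A (f x) (f y) - A' (f' (ψ.toFun x)) (f' (ψ.toFun y))| ≤ 1 :=
    fun x y => abs_sub_le_one_of_mem (hA _ _) (hA' _ _)
  set M : Set ℝ := {x | f' (ψ.toFun x) ≠ f x} with hM
  have hMm : MeasurableSet M := (measurableSet_eq_fun hq hf).compl
  have ha0 : 0 ≤ a := by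
    have := (abs_nonneg _).trans (haa (f 0) (f 0)); exact this
  have e3 : ∫ p, |A (f p.1) (f p.2) - A' (f' (ψ.toFun p.1)) (f' (ψ.toFun p.2))| ∂(mu.prod mu)
      ≤ a + 2 * s := by
    have hb : ∀ p : ℝ × ℝ, |A (f p.1) (f p.2) - A' (f' (ψ.toFun p.1)) (f' (ψ.toFun p.2))|
        ≤ a + (M.indicator (fun _ => (1 : ℝ)) p.1 + M.indicator (fun _ => (1 : ℝ)) p.2) := by
      intro p
      have n1 : 0 ≤ M.indicator (fun _ => (1 : ℝ)) p.1 := Set.indicator_nonneg (by simp) _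
      have n2 : 0 ≤ M.indicator (fun _ => (1 : ℝ)) p.2 := Set.indicator_nonneg (by simp) _
      by_cases h1 : p.1 ∈ M
      · rw [Set.indicator_of_mem h1]; linarith [b3 p.1 p.2]
      by_cases h2 : p.2 ∈ M
      · rw [Set.indicator_of_mem h2]; linarith [b3 p.1 p.2]
      have h1' : f' (ψ.toFun p.1) = f p.1 := by simpa [hM] using h1
      have h2' : f' (ψ.toFun p.2) = f p.2 := by simpa [hM] using h2
      rw [h1', h2']; linarith [haa (f p.1) (f p.2)]
    have i1 : Integrable (fun p : ℝ × ℝ => M.indicator (fun _ => (1 : ℝ)) p.1) (mu.prod mu) :=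
      ((integrable_const (1 : ℝ)).indicator hMm).comp_fst mu
    have i2 : Integrable (fun p : ℝ × ℝ => M.indicator (fun _ => (1 : ℝ)) p.2) (mu.prod mu) :=
      ((integrable_const (1 : ℝ)).indicator hMm).comp_snd mu
    have i3 : Integrable (fun p : ℝ × ℝ => M.indicator (fun _ => (1 : ℝ)) p.1
        + M.indicator (fun _ => (1 : ℝ)) p.2) (mu.prod mu) := i1.add i2
    have hi : Integrable (fun p : ℝ × ℝ =>
        |A (f p.1) (f p.2) - A' (f' (ψ.toFun p.1)) (f' (ψ.toFun p.2))|) (mu.prod mu) :=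
      (ker_integrable (mu.prod mu) (D := Function.uncurry fun x y =>
        A (f x) (f y) - A' (f' (ψ.toFun x)) (f' (ψ.toFun y))) m3 (fun p => b3 p.1 p.2)).abs
    have := integral_mono hi ((integrable_const a).add i3) hb
    refine this.trans ?_
    have e := integral_add (integrable_const (μ := mu.prod mu) a) i3
    have e' := integral_add i1 i2
    have f1 : ∫ p : ℝ × ℝ, M.indicator (fun _ => (1 : ℝ)) p.1 ∂(mu.prod mu) = mu.real M := by
      rw [integral_fun_fst (f := M.indicator (fun _ => (1 : ℝ)))]
      simp [integral_indicator hMm]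
    have f2 : ∫ p : ℝ × ℝ, M.indicator (fun _ => (1 : ℝ)) p.2 ∂(mu.prod mu) = mu.real M := by
      rw [integral_fun_snd (f := M.indicator (fun _ => (1 : ℝ)))]
      simp [integral_indicator hMm]
    refine (le_of_eq e).trans ?_
    rw [e', f1, f2]
    simp only [integral_const, probReal_univ, smul_eq_mul, one_mul]
    linarith
  have c3 := (CutLe.of_l1 (m := mu) m3 b3).mono e3
  have c2 := ((hc'.pull m2 ψ).neg)
  have b1 : ∀ x y, |W x y - A (f x) (f y)| ≤ 1 :=
    fun x y => abs_sub_le_one_of_mem (hW.2.2 _ _) (hA _ _)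
  have b2 : ∀ x y, |W' x y - A' (f' x) (f' y)| ≤ 1 :=
    fun x y => abs_sub_le_one_of_mem (hW'.2.2 _ _) (hA' _ _)
  have c12 := CutLe.add (m := mu) m1 b1 m3 b3 hc c3
  have c123 := CutLe.add (m := mu) (C := 2) (C' := 1)
    (K := fun x y => (W x y - A (f x) (f y))
      + (A (f x) (f y) - A' (f' (ψ.toFun x)) (f' (ψ.toFun y))))
    (L := fun x y => - pull (fun x y => W' x y - A' (f' x) (f' y)) ψ x y) (m1.add m3)
    (fun x y => (abs_add_le _ _).trans (by linarith [b1 x y, b3 x y])) (pull_meas m2 ψ).neg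
    (fun x y => by
      have := b2 (ψ.toFun x) (ψ.toFun y)
      simpa only [pull, abs_neg] using this) c12 c2
  refine (c123.mono (by linarith)).congr (Eventually.of_forall fun p => ?_)
  simp only [pull]; ring

/-- Weak limit (along an ultrafilter) of graphons. -/
lemma weak_limit (w : ℕ → ℝ → ℝ → ℝ) (hw : ∀ n, IsGraphon (w n)) :
    ∃ V : ℝ × ℝ → ℝ, Measurable V ∧ Integrable V (mu.prod mu) ∧
      ∀ S : Set (ℝ × ℝ), MeasurableSet S →
        Tendsto (fun n => ∫ p in S, w n p.1 p.2 ∂(mu.prod mu)) (hyperfilter ℕ)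
          (𝓝 (∫ p in S, V p ∂(mu.prod mu))) := by
  have hmem : ∀ n, MemLp (Function.uncurry (w n)) 2 (mu.prod mu) := fun n =>
    MemLp.of_bound (hw n).1.aestronglyMeasurable 1 (Eventually.of_forall fun p => by
      have := (hw n).2.2 p.1 p.2
      change |w n p.1 p.2| ≤ 1
      rw [abs_le]; exact ⟨by linarith [this.1], this.2⟩)
  let f : ℕ → Lp ℝ 2 (mu.prod mu) := fun n => (hmem n).toLp
  have hfn : ∀ n, ‖f n‖ ≤ 1 := by
    intro n
    have := Lp.norm_le_of_ae_bound (f := f n) (C := 1) zero_le_one (by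
      filter_upwards [(hmem n).coeFn_toLp] with p hp
      rw [hp]
      have := (hw n).2.2 p.1 p.2
      change |w n p.1 p.2| ≤ 1
      rw [abs_le]; exact ⟨by linarith [this.1], this.2⟩)
    refine this.trans ?_
    simp [measureUnivNNReal]
  let g : ℕ → WeakDual ℝ (Lp ℝ 2 (mu.prod mu)) := fun n =>
    StrongDual.toWeakDual (InnerProductSpace.toDual ℝ _ (f n))
  have hcpt := WeakDual.isCompact_closedBall (𝕜 := ℝ) (E := Lp ℝ 2 (mu.prod mu)) 0 1
  obtain ⟨Φ, -, hΦ⟩ := (isCompact_iff_ultrafilter_le_nhds.1 hcpt) ((hyperfilter ℕ).map g) (by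
    rw [Ultrafilter.coe_map, le_principal_iff, Filter.mem_map]
    refine Filter.univ_mem' fun n => ?_
    change dist _ _ ≤ _
    rw [dist_zero_right]
    change ‖InnerProductSpace.toDual ℝ _ (f n)‖ ≤ 1
    rw [LinearIsometryEquiv.norm_map]
    exact hfn n)
  have hT : Tendsto g (hyperfilter ℕ) (𝓝 Φ) := hΦ
  let V0 : Lp ℝ 2 (mu.prod mu) := (InnerProductSpace.toDual ℝ _).symm (WeakDual.toStrongDual Φ)
  refine ⟨V0, (Lp.stronglyMeasurable V0).measurable, (Lp.memLp V0).integrable (by norm_num), ?_⟩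
  intro S hS
  have hS' : (mu.prod mu) S ≠ ∞ := measure_ne_top _ _
  have h1 := ((WeakDual.eval_continuous (indicatorConstLp 2 hS hS' (1 : ℝ))).tendsto Φ).comp hT
  have e2 : ∀ v : Lp ℝ 2 (mu.prod mu), (InnerProductSpace.toDual ℝ _ v)
      (indicatorConstLp 2 hS hS' (1 : ℝ)) = ∫ p in S, v p ∂(mu.prod mu) := by
    intro v
    rw [InnerProductSpace.toDual_apply_apply, real_inner_comm, L2.inner_indicatorConstLp_one]
  have e3 : Φ (indicatorConstLp 2 hS hS' (1 : ℝ)) = ∫ p in S, V0 p ∂(mu.prod mu) := by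
    rw [← e2 V0]
    simp only [V0, LinearIsometryEquiv.apply_symm_apply]
    rfl
  rw [e3] at h1
  refine h1.congr fun n => ?_
  have : (g n) (indicatorConstLp 2 hS hS' (1 : ℝ)) = ∫ p in S, f n p ∂(mu.prod mu) := e2 (f n)
  refine this.trans ?_
  refine integral_congr_ae (ae_restrict_of_ae ?_)
  filter_upwards [(hmem n).coeFn_toLp] with p hp
  exact hp

lemma graphon_integrable {W : ℝ → ℝ → ℝ} (hW : IsGraphon W) :
    Integrable (fun p : ℝ × ℝ => W p.1 p.2) (mu.prod mu) :=
  ker_integrable (mu.prod mu) (D := fun p : ℝ × ℝ => W p.1 p.2) hW.1 (C := 1) (fun p => by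
    have := hW.2.2 p.1 p.2
    rw [abs_le]; exact ⟨by linarith [this.1], this.2⟩)

lemma cut_limit (w : ℕ → ℝ → ℝ → ℝ) (hw : ∀ n, IsGraphon (w n)) (b : ℕ → ℝ)
    (hb : ∀ n m, n ≤ m → CutLe mu (fun x y => w n x y - w m x y) (b n)) :
    ∃ V, IsGraphon V ∧ ∀ n, CutLe mu (fun x y => w n x y - V x y) (b n) := by
  obtain ⟨V, hVm, hVi, hV⟩ := weak_limit w hw
  have h0 : (fun _ => (0 : ℝ)) ≤ᵐ[mu.prod mu] V := by
    refine ae_le_of_forall_setIntegral_le (integrable_const _) hVi fun S hS _ => ?_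
    refine ge_of_tendsto' (hV S hS) fun n => ?_
    rw [integral_zero]
    exact integral_nonneg fun p => ((hw n).2.2 _ _).1
  have h1 : V ≤ᵐ[mu.prod mu] (fun _ => (1 : ℝ)) := by
    refine ae_le_of_forall_setIntegral_le hVi (integrable_const _) fun S hS _ => ?_
    refine le_of_tendsto' (hV S hS) fun n => ?_
    exact integral_mono (graphon_integrable (hw n)).integrableOn (integrable_const _)
      fun p => ((hw n).2.2 _ _).2
  have hsw : MeasurePreserving Prod.swap (mu.prod mu) (mu.prod mu) :=
    Measure.measurePreserving_swap
  have hsym : V =ᵐ[mu.prod mu] (fun p => V p.swap) := by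
    have hVi' : Integrable (fun p : ℝ × ℝ => V p.swap) (mu.prod mu) :=
      (hsw.integrable_comp hVm.aestronglyMeasurable).2 hVi
    refine Integrable.ae_eq_of_forall_setIntegral_eq _ _ hVi hVi' fun S hS _ => ?_
    have hS' : MeasurableSet (Prod.swap ⁻¹' S : Set (ℝ × ℝ)) := measurable_swap hS
    have key : ∀ u : ℝ × ℝ → ℝ, ∫ p in S, u p.swap ∂(mu.prod mu)
        = ∫ p in Prod.swap ⁻¹' S, u p ∂(mu.prod mu) := by
      intro u
      have := hsw.setIntegral_preimage_emb MeasurableEquiv.prodComm.measurableEmbedding u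
        (Prod.swap ⁻¹' S)
      rw [← this]
      rfl
    rw [key V]
    refine tendsto_nhds_unique (hV S hS) ((hV _ hS').congr fun n => ?_)
    rw [← key (fun p => w n p.1 p.2)]
    refine integral_congr_ae (Eventually.of_forall fun p => ?_)
    exact (hw n).2.1 _ _
  let V1 : ℝ → ℝ → ℝ := fun x y => max 0 (min ((V (x, y) + V (y, x)) / 2) 1)
  have hV1 : ∀ᵐ p ∂(mu.prod mu), V p = V1 p.1 p.2 := by
    filter_upwards [h0, h1, hsym] with p a b c
    change V p = max 0 (min ((V p + V p.swap) / 2) 1)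
    rw [← c, add_self_div_two, min_eq_left b, max_eq_right a]
  have hV1g : IsGraphon V1 := by
    refine ⟨?_, fun x y => ?_, fun x y => ⟨le_max_left _ _, max_le zero_le_one (min_le_right _ _)⟩⟩
    · have : Measurable fun p : ℝ × ℝ => max 0 (min ((V p + V p.swap) / 2) 1) := by
        have h2 : Measurable fun p : ℝ × ℝ => V p.swap := hVm.comp measurable_swap
        fun_prop
      exact this
    · simp only [V1, add_comm]
  refine ⟨V1, hV1g, fun n S T hS hT => ?_⟩
  have hi := fun n => graphon_integrable (hw n)
  have e1 : ∫ p in S ×ˢ T, (w n p.1 p.2 - V1 p.1 p.2) ∂(mu.prod mu)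
      = ∫ p in S ×ˢ T, w n p.1 p.2 ∂(mu.prod mu) - ∫ p in S ×ˢ T, V p ∂(mu.prod mu) := by
    rw [integral_sub (hi n).integrableOn (graphon_integrable hV1g).integrableOn,
      integral_congr_ae (ae_restrict_of_ae hV1)]
  rw [e1]
  have ht := ((hV (S ×ˢ T) (hS.prod hT)).const_sub (∫ p in S ×ˢ T, w n p.1 p.2 ∂(mu.prod mu))).abs
  refine le_of_tendsto ht ?_
  filter_upwards [Nat.hyperfilter_le_atTop (eventually_ge_atTop n)] with m hm
  have := hb n m hm S T hS hT
  rwa [integral_sub (hi n).integrableOn (hi m).integrableOn] at this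

/-- The space of graphons. -/
structure GSpace where
  val : ℝ → ℝ → ℝ
  prop : IsGraphon val

lemma deltaCut_symm_le {U W : ℝ → ℝ → ℝ} (hU : IsGraphon U) (hW : IsGraphon W) :
    deltaCut U W ≤ deltaCut W U := by
  refine le_of_forall_pos_le_add fun ε hε => ?_
  exact (Near.symm hW hU (near_of_deltaCut_lt hW hU (lt_add_of_pos_right _ hε))).deltaCut_le hU hW

instance : PseudoMetricSpace GSpace where
  dist U W := deltaCut U.1 W.1
  dist_self U := le_antisymm ((near_refl U.1).deltaCut_le U.2 U.2) (deltaCut_nonneg _ _)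
  dist_comm U W := le_antisymm (deltaCut_symm_le U.2 W.2) (deltaCut_symm_le W.2 U.2)
  dist_triangle U V W := by
    refine le_of_forall_pos_le_add fun ε hε => ?_
    have h1 := near_of_deltaCut_lt U.2 V.2 (lt_add_of_pos_right (deltaCut U.1 V.1) (half_pos hε))
    have h2 := near_of_deltaCut_lt V.2 W.2 (lt_add_of_pos_right (deltaCut V.1 W.1) (half_pos hε))
    have h3 := (Near.trans U.2 V.2 W.2 h1 h2).deltaCut_le U.2 W.2
    linarith

lemma gspace_dist (U W : GSpace) : dist U W = deltaCut U.1 W.1 := rfl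

lemma floor_close {x y : ℝ} (hx : 0 ≤ x) (hy : 0 ≤ y) {N : ℕ} (hN : 0 < N)
    (h : ⌊N * x⌋₊ = ⌊N * y⌋₊) : |x - y| ≤ 1 / N := by
  have hN' : (0 : ℝ) < N := by exact_mod_cast hN
  have a1 := Nat.floor_le (mul_nonneg hN'.le hx)
  have a2 := Nat.lt_floor_add_one (N * x)
  have b1 := Nat.floor_le (mul_nonneg hN'.le hy)
  have b2 := Nat.lt_floor_add_one (N * y)
  rw [h] at a1 a2
  rw [le_div_iff₀ hN', ← abs_of_pos hN', ← abs_mul, abs_le]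
  constructor <;> nlinarith

lemma floor_lt {x : ℝ} (hx : x ≤ 1) (N : ℕ) : ⌊N * x⌋₊ < N + 1 := by
  rw [Nat.lt_succ_iff]
  refine Nat.floor_le_of_le ?_
  exact mul_le_of_le_one_right (Nat.cast_nonneg N) hx

lemma cum_nonneg {q : ℕ} {Ω : Type} [MeasurableSpace Ω] (m : Measure Ω) (f : Ω → Fin q)
    (i : Fin q) : 0 ≤ cum m f i := measureReal_nonneg

lemma cum_le_one {q : ℕ} {Ω : Type} [MeasurableSpace Ω] (m : Measure Ω) [IsProbabilityMeasure m]
    (f : Ω → Fin q) (i : Fin q) : cum m f i ≤ 1 := measureReal_le_one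

lemma gspace_tb : TotallyBounded (Set.univ : Set GSpace) := by
  refine Metric.totallyBounded_of_finite_discretization fun ε hε => ?_
  obtain ⟨q, hq, hreg⟩ := weak_reg (ε / 8) (by positivity)
  choose f hfm A hAs hA01 hcut using fun W : GSpace =>
    hreg ℝ mu W.1 W.2.1 W.2.2.1 W.2.2.2
  obtain ⟨N, hN⟩ := exists_nat_gt ((1 + 2 * q) / (ε / 4))
  have hN0 : 0 < N := by
    have h : (0 : ℝ) < N := lt_of_le_of_lt (by positivity) hN
    exact_mod_cast h
  have hN0' : (0 : ℝ) < N := by exact_mod_cast hN0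
  refine ⟨(Fin q → Fin q → Fin (N + 1)) × (Fin q → Fin (N + 1)), inferInstance,
    fun W => (fun i j => ⟨_, floor_lt (hA01 W.1 i j).2 N⟩,
      fun i => ⟨_, floor_lt (cum_le_one mu (f W.1) i) N⟩), ?_⟩
  intro U W h
  simp only [Prod.mk.injEq] at h
  have hn := near_of_steps (U.1.2) (W.1.2) (hA01 U.1) (hA01 W.1) (a := 1 / N)
    (fun i j => floor_close (hA01 _ _ _).1 (hA01 _ _ _).1 hN0
      (Fin.mk.inj_iff.1 (congrFun (congrFun h.1 i) j)))
    (hfm U.1) (hfm W.1) (hcut U.1) (hcut W.1) (s := q * (1 / N)) (by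
      have : ∀ i ∈ (Finset.univ : Finset (Fin q)),
          |cum mu (f U.1) i - cum mu (f W.1) i| ≤ 1 / N := fun i _ =>
        floor_close (cum_nonneg _ _ _) (cum_nonneg _ _ _) hN0
          (Fin.mk.inj_iff.1 (congrFun h.2 i))
      refine (Finset.sum_le_sum this).trans ?_
      simp)
  refine (hn.deltaCut_le U.1.2 W.1.2).trans_lt ?_
  rw [div_lt_iff₀ (by positivity)] at hN
  have : 1 / (N : ℝ) + 2 * (q * (1 / N)) < ε / 4 := by
    have e : 1 / (N : ℝ) + 2 * (q * (1 / N)) = (1 + 2 * q) / N := by ring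
    rw [e, div_lt_iff₀ hN0']; linarith
  linarith

lemma gspace_complete : CompleteSpace GSpace := by
  refine Metric.complete_of_convergent_controlled_sequences (fun n => (1 / 2) ^ n)
    (fun n => by positivity) fun u hu => ?_
  have hn : ∀ n, Near (u n).1 (u (n + 1)).1 ((1 / 2) ^ n) := fun n =>
    near_of_deltaCut_lt (u n).2 (u (n + 1)).2 (hu n n (n + 1) le_rfl (Nat.le_succ n))
  choose φ hφ using hn
  let Ψ : ℕ → InvMP := fun n => Nat.rec InvMP.idm (fun n ψ => ψ.trans (φ n)) n
  have hΨ : ∀ n, Ψ (n + 1) = (Ψ n).trans (φ n) := fun n => rfl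
  let w : ℕ → ℝ → ℝ → ℝ := fun n => pull (u n).1 (Ψ n)
  have hw : ∀ n, IsGraphon (w n) := fun n => (u n).2.pull _
  have hstep : ∀ n, CutLe mu (fun x y => w n x y - w (n + 1) x y) ((1 / 2) ^ n) := by
    intro n
    have := (hφ n).pull (sub_meas (u n).2 ((u (n + 1)).2.pull (φ n))) (Ψ n)
    exact this
  have hmany : ∀ n j, CutLe mu (fun x y => w n x y - w (n + j) x y)
      (2 * (1 / 2) ^ n - 2 * (1 / 2) ^ (n + j)) := by
    intro n j
    induction j with
    | zero => intro S T hS hT; simp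
    | succ j ih =>
      have := CutLe.add (m := mu) (sub_meas (hw n) (hw (n + j))) (sub_bdd (hw n) (hw (n + j)))
        (sub_meas (hw (n + j)) (hw (n + j + 1))) (sub_bdd (hw (n + j)) (hw (n + j + 1))) ih
        (hstep (n + j))
      refine (this.mono (le_of_eq ?_)).congr (Eventually.of_forall fun p => ?_)
      · rw [← add_assoc, pow_succ (1 / 2 : ℝ) (n + j)]; ring
      · simp only [← add_assoc]; ring
  obtain ⟨V, hV, hVc⟩ := cut_limit w hw (fun n => 2 * (1 / 2) ^ n) (by
    intro n m hnm
    obtain ⟨j, rfl⟩ := Nat.exists_eq_add_of_le hnm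
    refine (hmany n j).mono ?_
    have : (0 : ℝ) ≤ 2 * (1 / 2) ^ (n + j) := by positivity
    linarith)
  refine ⟨⟨V, hV⟩, ?_⟩
  rw [tendsto_iff_dist_tendsto_zero]
  have ht : Tendsto (fun n : ℕ => 2 * (1 / 2 : ℝ) ^ n) atTop (𝓝 0) := by
    have := (tendsto_pow_atTop_nhds_zero_of_lt_one (r := (1 / 2 : ℝ)) (by norm_num)
      (by norm_num)).const_mul 2
    simpa using this
  refine squeeze_zero (fun n => dist_nonneg) (fun n => ?_) ht
  have n1 : Near V (u n).1 (2 * (1 / 2) ^ n) := by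
    refine ⟨Ψ n, ?_⟩
    refine (hVc n).neg.congr (Eventually.of_forall fun p => ?_)
    simp only [w]; ring
  exact (Near.symm hV (u n).2 n1).deltaCut_le (u n).2 hV

lemma graphon_compact (W : ℕ → ℝ → ℝ → ℝ) (hW : ∀ n, IsGraphon (W n)) :
    ∃ V, IsGraphon V ∧ ∃ σ : ℕ → ℕ, StrictMono σ ∧
      Tendsto (fun n => deltaCut (W (σ n)) V) atTop (𝓝 0) := by
  have hc := gspace_complete
  have hcpt : IsCompact (Set.univ : Set GSpace) :=
    isCompact_iff_totallyBounded_isComplete.2 ⟨gspace_tb, isComplete_univ⟩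
  obtain ⟨V, -, σ, hσ, hT⟩ := hcpt.tendsto_subseq (x := fun n => (⟨W n, hW n⟩ : GSpace))
    (fun n => Set.mem_univ _)
  refine ⟨V.1, V.2, σ, hσ, ?_⟩
  exact tendsto_iff_dist_tendsto_zero.1 hT

lemma cut_zero (D : ℕ → ℝ → ℝ → ℝ) (hD : ∀ n, Measurable (Function.uncurry (D n)))
    (hb : ∀ n x y, |D n x y| ≤ 1) (c : ℕ → ℝ) (hc : Tendsto c atTop (𝓝 0))
    (hcut : ∀ n, CutLe mu (D n) (c n)) (E : Set (ℝ × ℝ)) (hE : MeasurableSet E) :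
    Tendsto (fun n => ∫ p in E, D n p.1 p.2 ∂(mu.prod mu)) atTop (𝓝 0) := by
  have hi : ∀ n, Integrable (fun p : ℝ × ℝ => D n p.1 p.2) (mu.prod mu) := fun n =>
    ker_integrable (mu.prod mu) (D := fun p : ℝ × ℝ => D n p.1 p.2) (hD n) (fun p => hb n p.1 p.2)
  have hrect : ∀ S T : Set ℝ, MeasurableSet S → MeasurableSet T →
      Tendsto (fun n => ∫ p in S ×ˢ T, D n p.1 p.2 ∂(mu.prod mu)) atTop (𝓝 0) := by
    intro S T hS hT
    exact squeeze_zero_norm (fun n => hcut n S T hS hT) hc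
  induction E, hE using MeasurableSpace.induction_on_inter generateFrom_prod.symm isPiSystem_prod with
  | empty => simp
  | basic t ht =>
    obtain ⟨S, hS, T, hT, rfl⟩ := ht
    exact hrect S T hS hT
  | compl t ht ih =>
    have h1 := (hrect Set.univ Set.univ .univ .univ).sub ih
    rw [sub_zero] at h1
    refine h1.congr fun n => ?_
    rw [Set.univ_prod_univ, setIntegral_univ, ← integral_add_compl ht (hi n)]
    ring
  | iUnion f hd hm ih =>
    have h1 : ∀ n, ∫ p in ⋃ i, f i, D n p.1 p.2 ∂(mu.prod mu)
        = ∑' i, ∫ p in f i, D n p.1 p.2 ∂(mu.prod mu) := fun n =>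
      integral_iUnion hm hd (hi n).integrableOn
    simp_rw [h1]
    have hs : Summable fun i => (mu.prod mu).real (f i) := by
      refine ENNReal.summable_toReal ?_
      rw [← measure_iUnion hd hm]
      exact measure_ne_top _ _
    have := tendsto_tsum_of_dominated_convergence (𝓕 := atTop)
      (f := fun n i => ∫ p in f i, D n p.1 p.2 ∂(mu.prod mu)) (g := fun _ => 0) hs ih
      (Eventually.of_forall fun n i => by
        have := norm_setIntegral_le_of_norm_le_const (μ := mu.prod mu) (s := f i)
          (f := fun p : ℝ × ℝ => D n p.1 p.2) (C := 1) (measure_lt_top _ _)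
          (fun p _ => hb n p.1 p.2)
        simpa using this)
    simpa using this

lemma flex_lemma {R : Set (ℝ → ℝ → ℝ)} (hR : ∀ W ∈ R, IsGraphon W) (hflex : FlexibleFamily R)
    (hpull : ∀ W ∈ R, ∀ φ, pull W φ ∈ R) {V : ℝ → ℝ → ℝ} (hV : V ∈ R) (W : ℕ → ℝ → ℝ → ℝ)
    (hW : ∀ n, IsGraphon (W n)) (hlim : Tendsto (fun n => deltaCut (W n) V) atTop (𝓝 0))
    (ε : ℝ) (hε : 0 < ε) : ∀ᶠ n in atTop, d1SetE (W n) R < ENNReal.ofReal ε := by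
  classical
  have hVg := hR V hV
  have hc : Tendsto (fun n : ℕ => deltaCut (W n) V + 1 / ((n : ℝ) + 1)) atTop (𝓝 0) := by
    simpa using hlim.add tendsto_one_div_add_atTop_nhds_zero_nat
  have hn : ∀ n : ℕ, Near V (W n) (deltaCut (W n) V + 1 / ((n : ℝ) + 1)) := fun n =>
    Near.symm (hW n) hVg (near_of_deltaCut_lt (hW n) hVg (lt_add_of_pos_right _ (by positivity)))
  choose ψ hψ using hn
  have hVm : Measurable fun p : ℝ × ℝ => V p.1 p.2 := hVg.1
  let E0 : Set (ℝ × ℝ) := {p | V p.1 p.2 = 0}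
  let E1 : Set (ℝ × ℝ) := {p | V p.1 p.2 = 1}
  have hE0 : MeasurableSet E0 := hVm (measurableSet_singleton 0)
  have hE1 : MeasurableSet E1 := hVm (measurableSet_singleton 1)
  have t0 := cut_zero (fun n x y => V x y - pull (W n) (ψ n) x y)
    (fun n => sub_meas hVg ((hW n).pull _)) (fun n => sub_bdd hVg ((hW n).pull _)) _ hc hψ E0 hE0
  have t1 := cut_zero (fun n x y => V x y - pull (W n) (ψ n) x y)
    (fun n => sub_meas hVg ((hW n).pull _)) (fun n => sub_bdd hVg ((hW n).pull _)) _ hc hψ E1 hE1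
  have t := t1.sub t0
  rw [sub_zero] at t
  filter_upwards [t.eventually_lt_const hε] with n hn
  let U : ℝ → ℝ → ℝ := fun x y => if V x y = 0 ∨ V x y = 1 then V x y else pull (W n) (ψ n) x y
  have hWp := (hW n).pull (ψ n)
  have hUg : IsGraphon U := by
    refine ⟨?_, fun x y => ?_, fun x y => ?_⟩
    · exact Measurable.ite (p := fun p : ℝ × ℝ => V p.1 p.2 = 0 ∨ V p.1 p.2 = 1)
        (hE0.union hE1) hVm hWp.1
    · simp only [U, hVg.2.1 x y, hWp.2.1 x y]
    · simp only [U]; split_ifs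
      · exact hVg.2.2 x y
      · exact hWp.2.2 x y
  have hUR : U ∈ R := hflex V hV U ⟨hUg, fun x y h => by simp only [U, if_pos h]⟩
  refine (iInf₂_le (pull U (ψ n).symm) (hpull U hUR _)).trans_lt ?_
  rw [ENNReal.ofReal_lt_ofReal_iff hε]
  refine lt_of_eq_of_lt ?_ hn
  have hUp := hUg.pull (ψ n).symm
  rw [l1Norm_eq (sub_meas (hW n) hUp) (sub_bdd (hW n) hUp)]
  have hm : Measurable fun p : ℝ × ℝ => |W n p.1 p.2 - pull U (ψ n).symm p.1 p.2| :=
    (sub_meas (hW n) hUp).norm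
  rw [← integral_pull hm (ψ n)]
  rw [← integral_indicator hE0, ← integral_indicator hE1]
  have hi : Integrable (fun p : ℝ × ℝ => V p.1 p.2 - pull (W n) (ψ n) p.1 p.2) (mu.prod mu) :=
    ker_integrable (mu.prod mu) (D := fun p : ℝ × ℝ => V p.1 p.2 - pull (W n) (ψ n) p.1 p.2)
      (sub_meas hVg hWp) (fun p => sub_bdd hVg hWp p.1 p.2)
  rw [← integral_sub (hi.indicator hE1) (hi.indicator hE0)]
  refine integral_congr_ae ?_
  filter_upwards [ae_mem_I01] with p hp
  have e1 : pull U (ψ n).symm ((ψ n).toFun p.1) ((ψ n).toFun p.2) = U p.1 p.2 := by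
    simp only [pull, InvMP.symm, (ψ n).leftInv _ hp.1, (ψ n).leftInv _ hp.2]
  have e2 : W n ((ψ n).toFun p.1) ((ψ n).toFun p.2) = pull (W n) (ψ n) p.1 p.2 := rfl
  simp only [e1, e2]
  have b := hWp.2.2 p.1 p.2
  by_cases h0 : V p.1 p.2 = 0
  · have m0 : p ∈ E0 := h0
    have m1 : p ∉ E1 := fun h => by
      have h' : V p.1 p.2 = 1 := h
      rw [h0] at h'; exact zero_ne_one h'
    have eU : U p.1 p.2 = 0 := by simp only [U, h0]; simp
    rw [Set.indicator_of_mem m0, Set.indicator_of_notMem m1, eU, h0, abs_of_nonneg (by linarith [b.1])]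
    ring
  by_cases h1 : V p.1 p.2 = 1
  · have m1 : p ∈ E1 := h1
    have m0 : p ∉ E0 := h0
    have eU : U p.1 p.2 = 1 := by simp only [U, h1]; simp
    rw [Set.indicator_of_mem m1, Set.indicator_of_notMem m0, eU, h1,
      abs_of_nonpos (by linarith [b.2])]
    ring
  · have m0 : p ∉ E0 := h0
    have m1 : p ∉ E1 := h1
    have eU : U p.1 p.2 = pull (W n) (ψ n) p.1 p.2 := by
      simp only [U, h0, h1]; simp
    rw [Set.indicator_of_notMem m1, Set.indicator_of_notMem m0, eU]
    simp

open Classical in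
/-- Adjacency indicator. -/
def aI {k : ℕ} (F : SimpleGraph (Fin k)) (a b : Fin k) : ℝ := if F.Adj a b then 1 else 0

lemma aI_mem {k : ℕ} (F : SimpleGraph (Fin k)) (a b : Fin k) : aI F a b ∈ Set.Icc (0 : ℝ) 1 := by
  unfold aI; split_ifs <;> simp

lemma aI_symm {k : ℕ} (F : SimpleGraph (Fin k)) (a b : Fin k) : aI F a b = aI F b a := by
  unfold aI
  by_cases h : F.Adj a b
  · rw [if_pos h, if_pos h.symm]
  · rw [if_neg h, if_neg fun h' => h h'.symm]

/-- The four-cycle sum of a matrix. -/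
def c4 {k : ℕ} (D : Fin k → Fin k → ℝ) : ℝ := ∑ a, ∑ a', (∑ b, D a b * D a' b) ^ 2

/-- `W` is approximated by the step data `A` with cumulative weights `P`. -/
def Approx (W : ℝ → ℝ → ℝ) {q : ℕ} (A : Fin q → Fin q → ℝ) (P : Fin q → ℝ) (η : ℝ) : Prop :=
  ∃ f : ℝ → Fin q, Measurable f ∧ CutLe mu (fun x y => W x y - A (f x) (f y)) η ∧
    ∑ i, |cum mu f i - P i| ≤ η

open Classical in
/-- Fraction of vertices with label at most `i`. -/
def gcum {k q : ℕ} (l : Fin k → Fin q) (i : Fin q) : ℝ :=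
  (∑ a, if l a ≤ i then (1 : ℝ) else 0) / k

/-- The graph analogue of `Approx`. -/
def GApprox {k : ℕ} (F : SimpleGraph (Fin k)) {q : ℕ} (A : Fin q → Fin q → ℝ) (P : Fin q → ℝ)
    (η : ℝ) : Prop :=
  ∃ l : Fin k → Fin q, c4 (fun a b => aI F a b - A (l a) (l b)) ≤ η ^ 4 * k ^ 4 ∧
    ∑ i, |gcum l i - P i| ≤ η

lemma near_of_approx {W W' : ℝ → ℝ → ℝ} (hW : IsGraphon W) (hW' : IsGraphon W') {q : ℕ}
    {A : Fin q → Fin q → ℝ} (hA : ∀ i j, A i j ∈ Set.Icc (0 : ℝ) 1) {P : Fin q → ℝ} {η : ℝ}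
    (h : Approx W A P η) (h' : Approx W' A P η) : Near W W' (6 * η) := by
  obtain ⟨f, hf, hc, hs⟩ := h
  obtain ⟨f', hf', hc', hs'⟩ := h'
  have := near_of_steps hW hW' hA hA (a := 0) (by simp) hf hf' hc hc' (s := 2 * η) (by
    calc ∑ i, |cum mu f i - cum mu f' i|
        ≤ ∑ i, (|cum mu f i - P i| + |cum mu f' i - P i|) := by
          refine Finset.sum_le_sum fun i _ => ?_
          rw [abs_sub_comm (cum mu f' i)]
          exact abs_sub_le _ _ _
      _ ≤ 2 * η := by rw [Finset.sum_add_distrib]; linarith)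
  obtain ⟨φ, hφ⟩ := this
  exact ⟨φ, hφ.mono (by linarith)⟩

lemma GApprox.iso {k : ℕ} {F F' : SimpleGraph (Fin k)} (e : F ≃g F') {q : ℕ}
    {A : Fin q → Fin q → ℝ} {P : Fin q → ℝ} {η : ℝ} (h : GApprox F A P η) : GApprox F' A P η := by
  obtain ⟨l, h1, h2⟩ := h
  refine ⟨fun a => l (e.symm a), ?_, ?_⟩
  · refine le_of_eq_of_le ?_ h1
    unfold c4
    rw [← Equiv.sum_comp e.toEquiv]
    refine Finset.sum_congr rfl fun a _ => ?_
    rw [← Equiv.sum_comp e.toEquiv]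
    refine Finset.sum_congr rfl fun a' _ => ?_
    rw [← Equiv.sum_comp e.toEquiv]
    congr 1
    refine Finset.sum_congr rfl fun b _ => ?_
    have hE : ∀ a, e.symm (e.toEquiv a) = a := fun a => e.symm_apply_apply a
    have hadj : ∀ a b, aI F' (e.toEquiv a) (e.toEquiv b) = aI F a b := by
      intro a b; unfold aI
      have : F'.Adj (e.toEquiv a) (e.toEquiv b) ↔ F.Adj a b := e.map_adj_iff
      by_cases h : F.Adj a b
      · rw [if_pos h, if_pos (this.2 h)]
      · rw [if_neg h, if_neg fun h' => h (this.1 h')]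
    simp only [hE, hadj]
  · refine le_of_eq_of_le ?_ h2
    refine Finset.sum_congr rfl fun i _ => ?_
    congr 2
    unfold gcum
    congr 1
    rw [← Equiv.sum_comp e.toEquiv]
    refine Finset.sum_congr rfl fun a _ => ?_
    have hE : e.symm (e.toEquiv a) = a := e.symm_apply_apply a
    simp only [hE]

lemma c4_bound {k : ℕ} (D : Fin k → Fin k → ℝ) (s t : Fin k → ℝ) (hs : ∀ a, |s a| ≤ 1)
    (ht : ∀ a, |t a| ≤ 1) : (∑ a, ∑ b, s a * t b * D a b) ^ 4 ≤ k ^ 4 * c4 D := by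
  have sq1 : ∀ x : ℝ, |x| ≤ 1 → x ^ 2 ≤ 1 := fun x hx => by
    rw [← sq_abs]; exact pow_le_one₀ (abs_nonneg _) hx
  set u : Fin k → ℝ := fun b => ∑ a, s a * D a b with hu
  have e1 : ∑ a, ∑ b, s a * t b * D a b = ∑ b, t b * u b := by
    rw [Finset.sum_comm]
    refine Finset.sum_congr rfl fun b _ => ?_
    rw [hu, Finset.mul_sum]
    refine Finset.sum_congr rfl fun a _ => by ring
  have h1 : (∑ b, t b * u b) ^ 2 ≤ k * ∑ b, u b ^ 2 := by
    refine (Finset.sum_mul_sq_le_sq_mul_sq _ _ _).trans ?_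
    refine mul_le_mul_of_nonneg_right ?_ (Finset.sum_nonneg fun b _ => sq_nonneg _)
    refine (Finset.sum_le_sum fun b _ => sq1 _ (ht b)).trans ?_
    simp
  have e2 : ∑ b, u b ^ 2 = ∑ p : Fin k × Fin k, (s p.1 * s p.2) * ∑ b, D p.1 b * D p.2 b := by
    rw [Fintype.sum_prod_type]
    simp_rw [Finset.mul_sum]
    simp_rw [hu, sq, Finset.sum_mul_sum]
    rw [Finset.sum_comm]
    refine Finset.sum_congr rfl fun a _ => ?_
    rw [Finset.sum_comm]
    refine Finset.sum_congr rfl fun b _ => ?_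
    refine Finset.sum_congr rfl fun c _ => by ring
  have h2 : (∑ b, u b ^ 2) ^ 2 ≤ k ^ 2 * c4 D := by
    rw [e2]
    refine (Finset.sum_mul_sq_le_sq_mul_sq _ _ _).trans ?_
    have e3 : ∑ p : Fin k × Fin k, (∑ b, D p.1 b * D p.2 b) ^ 2 = c4 D := by
      rw [Fintype.sum_prod_type]; rfl
    rw [e3]
    refine mul_le_mul_of_nonneg_right ?_
      (Finset.sum_nonneg fun b _ => Finset.sum_nonneg fun b _ => sq_nonneg _)
    have : ∀ p ∈ (Finset.univ : Finset (Fin k × Fin k)), (s p.1 * s p.2) ^ 2 ≤ 1 := fun p _ => by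
      refine sq1 _ ?_
      rw [abs_mul]; exact mul_le_one₀ (hs _) (abs_nonneg _) (hs _)
    refine (Finset.sum_le_sum this).trans ?_
    simp [sq]
  rw [e1]
  calc (∑ b, t b * u b) ^ 4 = ((∑ b, t b * u b) ^ 2) ^ 2 := by ring
    _ ≤ (k * ∑ b, u b ^ 2) ^ 2 := pow_le_pow_left₀ (sq_nonneg _) h1 2
    _ = k ^ 2 * (∑ b, u b ^ 2) ^ 2 := by ring
    _ ≤ k ^ 2 * (k ^ 2 * c4 D) := by gcongr
    _ = _ := by ring

/-- The index of the interval containing `x`. -/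
def idx (k : ℕ) (hk : 0 < k) (x : ℝ) : Fin k := ⟨min (⌈k * x⌉₊ - 1) (k - 1), by omega⟩

lemma idx_meas (k : ℕ) (hk : 0 < k) : Measurable (idx k hk) := by
  have h1 : Measurable fun x : ℝ => ⌈k * x⌉₊ := Nat.measurable_ceil.comp (measurable_const_mul _)
  exact (measurable_of_countable (fun n : ℕ => (⟨min (n - 1) (k - 1), by omega⟩ : Fin k))).comp h1

lemma idx_eq {k : ℕ} (hk : 0 < k) (i : Fin k) {x : ℝ}
    (hx : x ∈ Set.Ioc (((i : ℕ) : ℝ) / k) ((((i : ℕ) : ℝ) + 1) / k)) : idx k hk x = i := by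
  have hk' : (0 : ℝ) < k := by exact_mod_cast hk
  have h1 : ⌈k * x⌉₊ = (i : ℕ) + 1 := by
    rw [Nat.ceil_eq_iff (by omega)]
    have a := (div_lt_iff₀ hk').1 hx.1
    have b := (le_div_iff₀ hk').1 hx.2
    push_cast
    constructor
    · linarith
    · linarith
  apply Fin.ext
  simp only [idx, h1]
  have := i.2
  omega

lemma mem_idx {k : ℕ} (hk : 0 < k) {x : ℝ} (h0 : 0 < x) (h1 : x ≤ 1) :
    x ∈ Set.Ioc (((idx k hk x : ℕ) : ℝ) / k) ((((idx k hk x : ℕ) : ℝ) + 1) / k) := by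
  have hk' : (0 : ℝ) < k := by exact_mod_cast hk
  have hle : ⌈k * x⌉₊ ≤ k := Nat.ceil_le.2 (mul_le_of_le_one_right hk'.le h1)
  have hpos : 0 < ⌈k * x⌉₊ := Nat.ceil_pos.2 (by positivity)
  have e : (idx k hk x : ℕ) = ⌈k * x⌉₊ - 1 := by simp only [idx]; omega
  have e' : ((idx k hk x : ℕ) : ℝ) + 1 = (⌈k * x⌉₊ : ℝ) := by
    rw [e]; exact_mod_cast Nat.sub_add_cancel hpos
  constructor
  · rw [div_lt_iff₀ hk']
    have := Nat.ceil_lt_add_one (mul_nonneg hk'.le h0.le)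
    linarith
  · rw [e', le_div_iff₀ hk']
    have := Nat.le_ceil (k * x)
    linarith

lemma ae_Ioc : ∀ᵐ x ∂mu, 0 < x ∧ x ≤ 1 := by
  have hIae : ∀ᵐ x ∂mu, x ∈ I01 := ae_restrict_mem measurableSet_I01
  have h0 : ∀ᵐ x ∂mu, x ≠ 0 := by
    rw [ae_iff]; simpa using mu_singleton 0
  filter_upwards [hIae, h0] with x hx h
  exact ⟨lt_of_le_of_ne hx.1 h.symm, hx.2⟩

lemma mu_idx {k : ℕ} (hk : 0 < k) (i : Fin k) : mu.real (idx k hk ⁻¹' {i}) = 1 / k := by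
  have hk' : (0 : ℝ) < k := by exact_mod_cast hk
  have h1 : mu (idx k hk ⁻¹' {i})
      = mu (Set.Ioc (((i : ℕ) : ℝ) / k) ((((i : ℕ) : ℝ) + 1) / k)) := by
    apply measure_congr
    filter_upwards [ae_Ioc] with x hx
    apply propext
    constructor
    · intro h
      have h' : idx k hk x = i := h
      rw [← h']; exact mem_idx hk hx.1 hx.2
    · intro h; exact idx_eq hk i h
  rw [measureReal_def, h1, mu, Measure.restrict_apply measurableSet_Ioc, Set.inter_eq_left.2]
  · rw [Real.volume_Ioc, ENNReal.toReal_ofReal]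
    · ring
    · rw [sub_nonneg]; gcongr; linarith
  · intro x hx
    refine ⟨(lt_of_le_of_lt (by positivity) hx.1).le, hx.2.trans ?_⟩
    rw [div_le_one hk']
    exact_mod_cast i.2

lemma graphonOf_eq {k : ℕ} (hk : 0 < k) (F : SimpleGraph (Fin k)) {x y : ℝ} (hx0 : 0 < x)
    (hx1 : x ≤ 1) (hy0 : 0 < y) (hy1 : y ≤ 1) :
    graphonOf F x y = aI F (idx k hk x) (idx k hk y) := by
  classical
  unfold graphonOf aI
  congr 1
  apply propext
  constructor
  · rintro ⟨i, j, h, hi, hj⟩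
    rwa [idx_eq hk i hi, idx_eq hk j hj]
  · intro h
    exact ⟨_, _, h, mem_idx hk hx0 hx1, mem_idx hk hy0 hy1⟩

lemma graphonOf_isGraphon {k : ℕ} (F : SimpleGraph (Fin k)) : IsGraphon (graphonOf F) := by
  classical
  refine ⟨?_, fun x y => ?_, fun x y => ?_⟩
  · have : Measurable (fun p : ℝ × ℝ => graphonOf F p.1 p.2) := by
      unfold graphonOf
      refine Measurable.ite ?_ measurable_const measurable_const
      have : {p : ℝ × ℝ | ∃ i j : Fin k, F.Adj i j ∧
          p.1 ∈ Set.Ioc (((i : ℕ) : ℝ) / k) ((((i : ℕ) : ℝ) + 1) / k) ∧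
          p.2 ∈ Set.Ioc (((j : ℕ) : ℝ) / k) ((((j : ℕ) : ℝ) + 1) / k)} =
          ⋃ i : Fin k, ⋃ j : Fin k, ⋃ _ : F.Adj i j,
            Set.Ioc (((i : ℕ) : ℝ) / k) ((((i : ℕ) : ℝ) + 1) / k) ×ˢ
            Set.Ioc (((j : ℕ) : ℝ) / k) ((((j : ℕ) : ℝ) + 1) / k) := by
        ext p; simp only [Set.mem_ofPred_eq, Set.mem_iUnion, Set.mem_prod, exists_prop]
      rw [this]
      exact MeasurableSet.iUnion fun i => MeasurableSet.iUnion fun j => MeasurableSet.iUnion fun _ =>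
        measurableSet_Ioc.prod measurableSet_Ioc
    exact this
  · unfold graphonOf
    congr 1
    apply propext
    constructor
    · rintro ⟨i, j, h, hi, hj⟩; exact ⟨j, i, h.symm, hj, hi⟩
    · rintro ⟨i, j, h, hi, hj⟩; exact ⟨j, i, h.symm, hj, hi⟩
  · unfold graphonOf; split_ifs <;> simp

lemma GApprox.approx {k : ℕ} (hk : 0 < k) {F : SimpleGraph (Fin k)} {q : ℕ}
    {A : Fin q → Fin q → ℝ} (hA : ∀ i j, A i j ∈ Set.Icc (0 : ℝ) 1) {P : Fin q → ℝ} {η : ℝ}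
    (hη : 0 ≤ η) (h : GApprox F A P η) : Approx (graphonOf F) A P η := by
  classical
  have hk' : (0 : ℝ) < k := by exact_mod_cast hk
  obtain ⟨l, h1, h2⟩ := h
  have him := idx_meas k hk
  refine ⟨fun x => l (idx k hk x), (measurable_of_countable l).comp him, ?_, ?_⟩
  · set D : Fin k → Fin k → ℝ := fun a b => aI F a b - A (l a) (l b) with hD
    have hc : CutLe mu (fun x y => D (idx k hk x) (idx k hk y)) η := by
      intro S T hS hT
      have hm : ∀ a, MeasurableSet (idx k hk ⁻¹' {a}) := fun a => him (measurableSet_singleton a)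
      have e1 : ∀ p : ℝ × ℝ, D (idx k hk p.1) (idx k hk p.2)
          = ∑ a, ∑ b, ((idx k hk ⁻¹' {a}) ×ˢ (idx k hk ⁻¹' {b})).indicator (fun _ => D a b) p := by
        intro p
        rw [Finset.sum_eq_single (idx k hk p.1), Finset.sum_eq_single (idx k hk p.2)]
        · rw [Set.indicator_of_mem]; exact ⟨rfl, rfl⟩
        · intro b _ hb
          rw [Set.indicator_of_notMem]
          rintro ⟨-, h⟩; exact hb h.symm
        · simp
        · intro a _ ha
          refine Finset.sum_eq_zero fun b _ => ?_
          rw [Set.indicator_of_notMem]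
          rintro ⟨h, -⟩; exact ha h.symm
        · simp
      have e2 : ∫ p in S ×ˢ T, D (idx k hk p.1) (idx k hk p.2) ∂(mu.prod mu)
          = ∑ a, ∑ b, mu.real (S ∩ idx k hk ⁻¹' {a}) * mu.real (T ∩ idx k hk ⁻¹' {b}) * D a b := by
        simp_rw [e1]
        have hintg : ∀ a b, Integrable
            (((idx k hk ⁻¹' {a}) ×ˢ (idx k hk ⁻¹' {b})).indicator (fun _ : ℝ × ℝ => D a b))
            ((mu.prod mu).restrict (S ×ˢ T)) := fun a b =>
          (integrable_const _).indicator ((hm a).prod (hm b))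
        rw [integral_finsetSum _ fun a _ => integrable_finsetSum _ fun b _ => hintg a b]
        refine Finset.sum_congr rfl fun a _ => ?_
        rw [integral_finsetSum _ fun b _ => hintg a b]
        refine Finset.sum_congr rfl fun b _ => ?_
        rw [integral_indicator ((hm a).prod (hm b)), Measure.restrict_restrict ((hm a).prod (hm b)),
          setIntegral_const, Set.prod_inter_prod, measureReal_prod_prod, smul_eq_mul,
          Set.inter_comm S, Set.inter_comm T]
      rw [e2]
      set s : Fin k → ℝ := fun a => k * mu.real (S ∩ idx k hk ⁻¹' {a}) with hs
      set t : Fin k → ℝ := fun a => k * mu.real (T ∩ idx k hk ⁻¹' {a}) with ht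
      have hle : ∀ (S : Set ℝ) a, |k * mu.real (S ∩ idx k hk ⁻¹' {a})| ≤ 1 := by
        intro S a
        rw [abs_of_nonneg (by positivity)]
        have : mu.real (S ∩ idx k hk ⁻¹' {a}) ≤ 1 / k := by
          rw [← mu_idx hk a]; exact measureReal_mono Set.inter_subset_right
        rw [le_div_iff₀ hk'] at this; linarith
      have hb := c4_bound D s t (hle S) (hle T)
      have e3 : ∑ a, ∑ b, s a * t b * D a b = k ^ 2 *
          ∑ a, ∑ b, mu.real (S ∩ idx k hk ⁻¹' {a}) * mu.real (T ∩ idx k hk ⁻¹' {b}) * D a b := by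
        rw [Finset.mul_sum]; refine Finset.sum_congr rfl fun a _ => ?_
        rw [Finset.mul_sum]; refine Finset.sum_congr rfl fun b _ => ?_
        rw [hs, ht]; ring
      rw [e3] at hb
      set X := ∑ a, ∑ b, mu.real (S ∩ idx k hk ⁻¹' {a}) * mu.real (T ∩ idx k hk ⁻¹' {b}) * D a b
      have h4 : |X| ^ 4 ≤ η ^ 4 := by
        rw [Even.pow_abs (by decide)]
        have h8 : (0 : ℝ) < (k : ℝ) ^ 8 := by positivity
        have : (k : ℝ) ^ 8 * X ^ 4 ≤ k ^ 8 * η ^ 4 := by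
          calc (k : ℝ) ^ 8 * X ^ 4 = (k ^ 2 * X) ^ 4 := by ring
            _ ≤ k ^ 4 * c4 D := hb
            _ ≤ k ^ 4 * (η ^ 4 * k ^ 4) := by gcongr
            _ = _ := by ring
        exact le_of_mul_le_mul_left this h8
      exact le_of_pow_le_pow_left₀ (by norm_num) hη h4
    refine hc.congr ?_
    have hx : ∀ᵐ p ∂(mu.prod mu), 0 < p.1 ∧ p.1 ≤ 1 := Measure.quasiMeasurePreserving_fst.ae ae_Ioc
    have hy : ∀ᵐ p ∂(mu.prod mu), 0 < p.2 ∧ p.2 ≤ 1 := Measure.quasiMeasurePreserving_snd.ae ae_Ioc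
    filter_upwards [hx, hy] with p h1 h2
    rw [graphonOf_eq hk F h1.1 h1.2 h2.1 h2.2]
  · refine le_of_eq_of_le ?_ h2
    refine Finset.sum_congr rfl fun i _ => ?_
    congr 2
    unfold cum gcum
    have e : {x | l (idx k hk x) ≤ i} = ⋃ a ∈ Finset.univ.filter (fun a => l a ≤ i),
        idx k hk ⁻¹' {a} := by
      ext x; simp
    rw [e, measureReal_biUnion_finset]
    · simp_rw [mu_idx]
      rw [Finset.sum_const, Finset.sum_boole, nsmul_eq_mul]; ring
    · intro a _ b _ hab
      refine Set.disjoint_left.2 fun x hx hx' => hab ?_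
      exact (show idx k hk x = a from hx).symm.trans hx'
    · intro a _; exact him (measurableSet_singleton a)

open Classical in
/-- Upper bound for the indicator that four indices are not distinct. -/
def nd4 {k : ℕ} (a a' b b' : Fin k) : ℝ :=
  (if a = a' then 1 else 0) + (if a = b then 1 else 0) + (if a = b' then 1 else 0)
    + (if a' = b then 1 else 0) + (if a' = b' then 1 else 0) + (if b = b' then 1 else 0)

/-- Four indices are distinct. -/
def D4 {k : ℕ} (a a' b b' : Fin k) : Prop :=
  a ≠ a' ∧ a ≠ b ∧ a ≠ b' ∧ a' ≠ b ∧ a' ≠ b' ∧ b ≠ b'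

lemma nd4_nonneg {k : ℕ} (a a' b b' : Fin k) : 0 ≤ nd4 a a' b b' := by
  unfold nd4
  have : ∀ (p : Prop) [Decidable p], (0 : ℝ) ≤ if p then 1 else 0 := fun p _ => by
    split_ifs <;> simp
  have h1 := this (a = a')
  positivity

lemma one_le_nd4 {k : ℕ} {a a' b b' : Fin k} (h : ¬ D4 a a' b b') : 1 ≤ nd4 a a' b b' := by
  unfold nd4
  have : ∀ (p : Prop) [Decidable p], (0 : ℝ) ≤ if p then 1 else 0 := fun p _ => by
    split_ifs <;> simp
  have h1 := this (a = a')
  have h2 := this (a = b)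
  have h3 := this (a = b')
  have h4 := this (a' = b)
  have h5 := this (a' = b')
  have h6 := this (b = b')
  by_contra hc
  apply h
  refine ⟨fun e => ?_, fun e => ?_, fun e => ?_, fun e => ?_, fun e => ?_, fun e => ?_⟩ <;>
  · apply hc
    rw [if_pos e] at *
    linarith

lemma sum_nd4 (k : ℕ) : ∑ a : Fin k, ∑ a', ∑ b, ∑ b', nd4 a a' b b' = 6 * (k : ℝ) ^ 3 := by
  unfold nd4
  simp only [Finset.sum_add_distrib, Finset.sum_ite_eq, Finset.mem_univ, if_true,
    Finset.sum_const, Finset.card_univ, Fintype.card_fin, nsmul_eq_mul, mul_one]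
  have : ∀ a a' : Fin k, (∑ b : Fin k, (k : ℝ) * if a = a' then (1:ℝ) else 0)
    = k * (k * if a = a' then (1:ℝ) else 0) := by intro a a'; simp
  simp only [← Finset.mul_sum, Finset.sum_ite_eq, Finset.mem_univ, if_true, mul_one,
    Finset.sum_const, Finset.card_univ, Fintype.card_fin, nsmul_eq_mul]
  ring

open Classical in
/-- The centred label indicator. -/
def yy {q : ℕ} (P : Fin q → ℝ) (i j : Fin q) : ℝ := (if j ≤ i then 1 else 0) - P i

lemma gcum_sub {k q : ℕ} (hk : 0 < k) (l : Fin k → Fin q) (P : Fin q → ℝ) (i : Fin q) :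
    (gcum l i - P i) ^ 2 = (∑ a, ∑ b, yy P i (l a) * yy P i (l b)) / k ^ 2 := by
  have hk' : (k : ℝ) ≠ 0 := by positivity
  have : gcum l i - P i = (∑ a, yy P i (l a)) / k := by
    unfold gcum yy
    rw [Finset.sum_sub_distrib, sub_div]
    simp only [Finset.sum_const, Finset.card_univ, Fintype.card_fin, nsmul_eq_mul]
    rw [mul_div_cancel_left₀ _ hk']
  rw [this, div_pow, sq (∑ a, _), Finset.sum_mul_sum]

lemma c4_expand {k : ℕ} (D : Fin k → Fin k → ℝ) :
    c4 D = ∑ a, ∑ a', ∑ b, ∑ b', D a b * D a' b * D a b' * D a' b' := by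
  unfold c4
  refine Finset.sum_congr rfl fun a _ => Finset.sum_congr rfl fun a' _ => ?_
  rw [sq, Finset.sum_mul_sum]
  refine Finset.sum_congr rfl fun b _ => Finset.sum_congr rfl fun b' _ => by ring

lemma bad_bound {k q : ℕ} (hk : 0 < k) (F : SimpleGraph (Fin k)) (A : Fin q → Fin q → ℝ)
    (P : Fin q → ℝ) {η : ℝ} (hη : 0 < η) (l : Fin k → Fin q) (h : ¬ GApprox F A P η) :
    1 ≤ (∑ a, ∑ a', ∑ b, ∑ b', (aI F a b - A (l a) (l b)) * (aI F a' b - A (l a') (l b)) *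
        (aI F a b' - A (l a) (l b')) * (aI F a' b' - A (l a') (l b'))) / (η ^ 4 * k ^ 4)
      + q / η ^ 2 * ∑ i, (∑ a, ∑ b, yy P i (l a) * yy P i (l b)) / k ^ 2 := by
  have hk' : (0 : ℝ) < k := by exact_mod_cast hk
  rw [← c4_expand (fun a b => aI F a b - A (l a) (l b))]
  simp_rw [← gcum_sub hk]
  by_contra hc
  push Not at hc
  have n1 : 0 ≤ c4 (fun a b => aI F a b - A (l a) (l b)) :=
    Finset.sum_nonneg fun _ _ => Finset.sum_nonneg fun _ _ => sq_nonneg _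
  have n2 : 0 ≤ ∑ i, (gcum l i - P i) ^ 2 := Finset.sum_nonneg fun _ _ => sq_nonneg _
  have n1' : 0 ≤ c4 (fun a b => aI F a b - A (l a) (l b)) / (η ^ 4 * k ^ 4) := by positivity
  have n2' : 0 ≤ q / η ^ 2 * ∑ i, (gcum l i - P i) ^ 2 := by positivity
  apply h
  refine ⟨l, ?_, ?_⟩
  · have : c4 (fun a b => aI F a b - A (l a) (l b)) / (η ^ 4 * k ^ 4) ≤ 1 := by linarith
    rwa [div_le_one (by positivity)] at this
  · have h1 : q / η ^ 2 * ∑ i, (gcum l i - P i) ^ 2 ≤ 1 := by linarith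
    rw [div_mul_eq_mul_div, div_le_one (by positivity)] at h1
    refine le_of_pow_le_pow_left₀ two_ne_zero hη.le ?_
    refine le_trans ?_ h1
    have := sq_sum_le_card_mul_sum_sq (s := Finset.univ) (f := fun i => |gcum l i - P i|)
    simpa using this

lemma num_bound {k q : ℕ} (hk : 0 < k) {η c : ℝ} (hη : 0 < η)
    (Z : Fin k → Fin k → Fin k → Fin k → ℝ) (hZ : ∀ a a' b b', Z a a' b b' ≤ c + nd4 a a' b b')
    (Y : Fin q → Fin k → Fin k → ℝ) (hY : ∀ i a b, Y i a b ≤ if a = b then 1 else 0) :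
    (∑ a, ∑ a', ∑ b, ∑ b', Z a a' b b') / (η ^ 4 * k ^ 4)
      + q / η ^ 2 * ∑ i, (∑ a, ∑ b, Y i a b) / k ^ 2
      ≤ c / η ^ 4 + (6 / η ^ 4 + q ^ 2 / η ^ 2) / k := by
  have hk' : (0 : ℝ) < k := by exact_mod_cast hk
  have h1 : (∑ a, ∑ a', ∑ b, ∑ b', Z a a' b b') ≤ c * k ^ 4 + 6 * k ^ 3 := by
    calc (∑ a, ∑ a', ∑ b, ∑ b', Z a a' b b') ≤ ∑ a, ∑ a', ∑ b, ∑ b', (c + nd4 a a' b b') :=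
          Finset.sum_le_sum fun a _ => Finset.sum_le_sum fun a' _ => Finset.sum_le_sum fun b _ =>
            Finset.sum_le_sum fun b' _ => hZ _ _ _ _
      _ = _ := by
        simp only [Finset.sum_add_distrib, sum_nd4]
        simp only [Finset.sum_const, Finset.card_univ, Fintype.card_fin, nsmul_eq_mul]
        ring
  have h2 : ∀ i, (∑ a, ∑ b, Y i a b) ≤ k := by
    intro i
    refine (Finset.sum_le_sum fun a _ => Finset.sum_le_sum fun b _ => hY i a b).trans ?_
    simp
  have h3 : ∑ i, (∑ a, ∑ b, Y i a b) / k ^ 2 ≤ q * (1 / k) := by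
    have : ∀ i ∈ (Finset.univ : Finset (Fin q)), (∑ a, ∑ b, Y i a b) / (k : ℝ) ^ 2 ≤ 1 / k := by
      intro i _
      rw [div_le_div_iff₀ (by positivity) hk']
      have := h2 i
      nlinarith
    refine (Finset.sum_le_sum this).trans ?_
    simp
  calc _ ≤ (c * k ^ 4 + 6 * k ^ 3) / (η ^ 4 * k ^ 4) + q / η ^ 2 * (q * (1 / k)) := by
        gcongr
    _ = _ := by field_simp; ring

open Classical in
/-- Weight of a graph under independent edge probabilities. -/
def wt {k : ℕ} (w : Fin k → Fin k → ℝ) (F : SimpleGraph (Fin k)) : ℝ :=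
  ∏ i : Fin k, ∏ j : Fin k, if i < j then (if F.Adj i j then w i j else 1 - w i j) else 1

lemma wt_nonneg {k : ℕ} {w : Fin k → Fin k → ℝ} (hw : ∀ a b, w a b ∈ Set.Icc (0 : ℝ) 1)
    (F : SimpleGraph (Fin k)) : 0 ≤ wt w F := by
  refine Finset.prod_nonneg fun i _ => Finset.prod_nonneg fun j _ => ?_
  have := hw i j
  split_ifs <;> first | exact zero_le_one | linarith [this.1, this.2]

/-- Ordered pairs. -/
def TP (k : ℕ) : Finset (Fin k × Fin k) := Finset.univ.filter fun p => p.1 < p.2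

open Classical in
lemma sum_graph {k : ℕ} (g1 g0 : Fin k × Fin k → ℝ) :
    ∑ F : SimpleGraph (Fin k), ∏ p ∈ TP k, (if F.Adj p.1 p.2 then g1 p else g0 p)
      = ∏ p ∈ TP k, (g1 p + g0 p) := by
  rw [Finset.prod_add]
  have hT : ∀ p, p ∈ TP k ↔ p.1 < p.2 := fun p => by simp [TP]
  refine Finset.sum_bij' (i := fun F _ => (TP k).filter fun p => F.Adj p.1 p.2)
    (j := fun t _ => SimpleGraph.fromRel fun a b => (a, b) ∈ t) ?_ ?_ ?_ ?_ ?_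
  · intro F _; simp
  · intro t _; simp
  · intro F _
    ext a b
    simp only [SimpleGraph.fromRel_adj, Finset.mem_filter, hT]
    constructor
    · rintro ⟨-, h | h⟩
      · exact h.2
      · exact h.2.symm
    · intro h
      refine ⟨h.ne, ?_⟩
      rcases lt_or_gt_of_ne h.ne with h' | h'
      · exact Or.inl ⟨h', h⟩
      · exact Or.inr ⟨h', h.symm⟩
  · intro t ht
    rw [Finset.mem_powerset] at ht
    ext ⟨a, b⟩
    simp only [SimpleGraph.fromRel_adj, Finset.mem_filter, hT]
    constructor
    · rintro ⟨hab, -, h | h⟩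
      · exact h
      · exact absurd ((hT _).1 (ht h)) (not_lt.2 (le_of_lt hab))
    · intro h
      have := (hT _).1 (ht h)
      exact ⟨this, this.ne, Or.inl h⟩
  · intro F _
    rw [Finset.prod_ite]
    congr 1
    refine Finset.prod_congr ?_ fun _ _ => rfl
    ext p
    simp only [Finset.mem_filter, Finset.mem_sdiff]
    tauto

open Classical in
lemma wt_eq {k : ℕ} (w : Fin k → Fin k → ℝ) (F : SimpleGraph (Fin k)) :
    wt w F = ∏ p ∈ TP k, (if F.Adj p.1 p.2 then w p.1 p.2 else 1 - w p.1 p.2) := by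
  unfold wt TP
  rw [Finset.prod_filter, Fintype.prod_prod_type]

lemma wt_sum {k : ℕ} (w : Fin k → Fin k → ℝ) : ∑ F : SimpleGraph (Fin k), wt w F = 1 := by
  classical
  simp_rw [wt_eq]
  rw [sum_graph (fun p => w p.1 p.2) (fun p => 1 - w p.1 p.2)]
  exact Finset.prod_eq_one fun p _ => by ring

lemma wt_prod {k : ℕ} (w : Fin k → Fin k → ℝ) (B : Fin k → Fin k → ℝ)
    (E : Finset (Fin k × Fin k)) (hE : E ⊆ TP k) :
    ∑ F : SimpleGraph (Fin k), wt w F * ∏ p ∈ E, (aI F p.1 p.2 - B p.1 p.2)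
      = ∏ p ∈ E, (w p.1 p.2 - B p.1 p.2) := by
  classical
  have e1 : ∀ X : Fin k × Fin k → ℝ, ∏ p ∈ E, X p = ∏ p ∈ TP k, if p ∈ E then X p else 1 := by
    intro X
    rw [Finset.prod_ite_mem, Finset.inter_eq_right.2 hE]
  simp_rw [e1, wt_eq, ← Finset.prod_mul_distrib]
  have := sum_graph (k := k) (fun p => w p.1 p.2 * if p ∈ E then 1 - B p.1 p.2 else 1)
    (fun p => (1 - w p.1 p.2) * if p ∈ E then 0 - B p.1 p.2 else 1)
  rw [show (∏ p ∈ TP k, if p ∈ E then w p.1 p.2 - B p.1 p.2 else 1) = ∏ p ∈ TP k,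
    ((w p.1 p.2 * if p ∈ E then 1 - B p.1 p.2 else 1) +
      ((1 - w p.1 p.2) * if p ∈ E then 0 - B p.1 p.2 else 1)) from
      Finset.prod_congr rfl fun p _ => by split_ifs <;> ring]
  rw [← this]
  refine Finset.sum_congr rfl fun F _ => Finset.prod_congr rfl fun p _ => ?_
  unfold aI
  split_ifs <;> ring

/-- Normalized pair. -/
def nrm {k : ℕ} (p : Fin k × Fin k) : Fin k × Fin k := (min p.1 p.2, max p.1 p.2)

lemma wt_prod4 {k : ℕ} (w : Fin k → Fin k → ℝ) (hw : ∀ a b, w a b = w b a)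
    (B : Fin k → Fin k → ℝ) (hB : ∀ a b, B a b = B b a) {a a' b b' : Fin k} (h : D4 a a' b b') :
    ∑ F : SimpleGraph (Fin k), wt w F * ((aI F a b - B a b) * (aI F a' b - B a' b) *
        (aI F a b' - B a b') * (aI F a' b' - B a' b'))
      = (w a b - B a b) * (w a' b - B a' b) * (w a b' - B a b') * (w a' b' - B a' b') := by
  classical
  obtain ⟨h1, h2, h3, h4, h5, h6⟩ := h
  set L : Finset (Fin k × Fin k) := {(a, b), (a', b), (a, b'), (a', b')} with hL
  have hprod : ∀ X : Fin k → Fin k → ℝ, (∀ a b, X a b = X b a) →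
      X a b * X a' b * X a b' * X a' b' = ∏ p ∈ L.image nrm, X p.1 p.2 := by
    intro X hX
    have hn : ∀ p : Fin k × Fin k, X (nrm p).1 (nrm p).2 = X p.1 p.2 := by
      intro p
      rcases le_total p.1 p.2 with hp | hp
      · simp [nrm, min_eq_left hp, max_eq_right hp]
      · simp only [nrm, min_eq_right hp, max_eq_left hp]; exact hX _ _
    rw [Finset.prod_image]
    · simp_rw [hn]
      rw [hL, Finset.prod_insert, Finset.prod_insert, Finset.prod_insert, Finset.prod_singleton]
      · ring
      · simp [h1]
      · simp [h1.symm, h6]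
      · simp [h1, h6]
    · intro p hp r hr hpr
      have hnc : ∀ p r : Fin k × Fin k, nrm p = nrm r → p = r ∨ p = (r.2, r.1) := by
        rintro ⟨p1, p2⟩ ⟨r1, r2⟩ h
        simp only [nrm, Prod.mk.injEq] at h
        obtain ⟨e1, e2⟩ := h
        rcases le_total p1 p2 with hp | hp <;> rcases le_total r1 r2 with hr | hr
        · rw [min_eq_left hp, min_eq_left hr] at e1
          rw [max_eq_right hp, max_eq_right hr] at e2
          left; rw [e1, e2]
        · rw [min_eq_left hp, min_eq_right hr] at e1
          rw [max_eq_right hp, max_eq_left hr] at e2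
          right; rw [e1, e2]
        · rw [min_eq_right hp, min_eq_left hr] at e1
          rw [max_eq_left hp, max_eq_right hr] at e2
          right; rw [e1, e2]
        · rw [min_eq_right hp, min_eq_right hr] at e1
          rw [max_eq_left hp, max_eq_left hr] at e2
          left; rw [e1, e2]
      rcases hnc p r hpr with h | h
      · exact h
      · exfalso
        have hp1 : p.1 = a ∨ p.1 = a' := by
          simp only [hL, Finset.coe_insert, Finset.coe_singleton, Set.mem_insert_iff,
            Set.mem_singleton_iff] at hp
          rcases hp with rfl | rfl | rfl | rfl <;> simp
        have hr2 : r.2 = b ∨ r.2 = b' := by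
          simp only [hL, Finset.coe_insert, Finset.coe_singleton, Set.mem_insert_iff,
            Set.mem_singleton_iff] at hr
          rcases hr with rfl | rfl | rfl | rfl <;> simp
        have e : p.1 = r.2 := by rw [h]
        rcases hp1 with hp1 | hp1 <;> rcases hr2 with hr2 | hr2 <;> rw [hp1, hr2] at e
        · exact h2 e
        · exact h3 e
        · exact h4 e
        · exact h5 e
  have hsub : L.image nrm ⊆ TP k := by
    intro p hp
    obtain ⟨r, hr, rfl⟩ := Finset.mem_image.1 hp
    have hne : r.1 ≠ r.2 := by
      simp only [hL, Finset.mem_insert, Finset.mem_singleton] at hr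
      rcases hr with rfl | rfl | rfl | rfl
      · exact h2
      · exact h4
      · exact h3
      · exact h5
    simp only [TP, Finset.mem_filter, Finset.mem_univ, true_and, nrm]
    exact min_lt_max.2 hne
  have := wt_prod w B (L.image nrm) hsub
  rw [← hprod (fun a b => w a b - B a b) (fun a b => by rw [hw, hB])] at this
  rw [← this]
  refine Finset.sum_congr rfl fun F _ => ?_
  rw [← hprod (fun a b => aI F a b - B a b) (fun a b => by rw [aI_symm, hB])]

lemma eval2 {k : ℕ} {a b : Fin k} (h : a ≠ b) :
    Measure.map (fun x : Fin k → ℝ => (x a, x b)) (Measure.pi fun _ => mu) = mu.prod mu := by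
  have hi := ProbabilityTheory.iIndepFun_pi (μ := fun _ : Fin k => mu) (X := fun _ (u : ℝ) => u)
    (fun _ => aemeasurable_id)
  have h1 := (ProbabilityTheory.indepFun_iff_map_prod_eq_prod_map_map
    (measurable_pi_apply a).aemeasurable (measurable_pi_apply b).aemeasurable).1 (hi.indepFun h)
  rw [h1]
  congr 1
  · exact (measurePreserving_eval (fun _ : Fin k => mu) a).map_eq
  · exact (measurePreserving_eval (fun _ : Fin k => mu) b).map_eq

lemma eval4 {k : ℕ} {a a' b b' : Fin k} (h : D4 a a' b b') :
    Measure.map (fun x : Fin k → ℝ => ((x a', x b'), (x a, x b))) (Measure.pi fun _ => mu)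
      = (mu.prod mu).prod (mu.prod mu) := by
  obtain ⟨h1, h2, h3, h4, h5, h6⟩ := h
  have hi := ProbabilityTheory.iIndepFun_pi (μ := fun _ : Fin k => mu) (X := fun _ (u : ℝ) => u)
    (fun _ => aemeasurable_id)
  have hm : ∀ a b : Fin k, Measurable (fun x : Fin k → ℝ => (x a, x b)) := fun a b =>
    (measurable_pi_apply a).prodMk (measurable_pi_apply b)
  have h := (ProbabilityTheory.indepFun_iff_map_prod_eq_prod_map_map
    (hm a' b').aemeasurable (hm a b).aemeasurable).1
    (hi.indepFun_prodMk_prodMk (fun i => measurable_pi_apply i) a' b' a b h1.symm h4 h3.symm h6.symm)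
  rw [h, eval2 h5, eval2 h2]

lemma abs_mul4 {a b c d : ℝ} (ha : |a| ≤ 1) (hb : |b| ≤ 1) (hc : |c| ≤ 1) (hd : |d| ≤ 1) :
    |a * b * c * d| ≤ 1 := by
  rw [abs_mul, abs_mul, abs_mul]
  exact mul_le_one₀ (mul_le_one₀ (mul_le_one₀ ha (abs_nonneg _) hb) (abs_nonneg _) hc)
    (abs_nonneg _) hd

lemma prod4_meas {Ω : Type} [MeasurableSpace Ω] {K : Ω → Ω → ℝ}
    (hK : Measurable (Function.uncurry K)) : Measurable fun z : (Ω × Ω) × (Ω × Ω) =>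
      K z.2.1 z.2.2 * K z.1.1 z.2.2 * K z.2.1 z.1.2 * K z.1.1 z.1.2 := by
  have h : ∀ f g : (Ω × Ω) × (Ω × Ω) → Ω, Measurable f → Measurable g →
      Measurable fun z => K (f z) (g z) := fun f g hf hg => hK.comp (hf.prodMk hg)
  refine ((Measurable.mul ?_ ?_).mul ?_).mul ?_ <;> apply h <;> fun_prop

lemma int4 {k : ℕ} {a a' b b' : Fin k} (h : D4 a a' b b') (K : ℝ → ℝ → ℝ)
    (hK : Measurable (Function.uncurry K)) (hC : ∀ x y, |K x y| ≤ 1) {η : ℝ}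
    (hcut : CutLe mu K η) :
    ∫ x : Fin k → ℝ, K (x a) (x b) * K (x a') (x b) * K (x a) (x b') * K (x a') (x b')
      ∂(Measure.pi fun _ => mu) ≤ 4 * η := by
  have hm : ∀ a b : Fin k, Measurable (fun x : Fin k → ℝ => (x a, x b)) := fun a b =>
    (measurable_pi_apply a).prodMk (measurable_pi_apply b)
  have e : ∫ x : Fin k → ℝ, K (x a) (x b) * K (x a') (x b) * K (x a) (x b') * K (x a') (x b')
      ∂(Measure.pi fun _ => mu) = ∫ z, K z.2.1 z.2.2 * K z.1.1 z.2.2 * K z.2.1 z.1.2 * K z.1.1 z.1.2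
        ∂((mu.prod mu).prod (mu.prod mu)) := by
    rw [← eval4 h, integral_map ((hm a' b').prodMk (hm a b)).aemeasurable
      (prod4_meas hK).aestronglyMeasurable]
  rw [e, integral_prod]
  · exact c4_le mu K hK hC η hcut
  · refine Integrable.of_bound (prod4_meas hK).aestronglyMeasurable 1 (ae_of_all _ fun z => ?_)
    rw [Real.norm_eq_abs]
    exact abs_mul4 (hC _ _) (hC _ _) (hC _ _) (hC _ _)

lemma yy_abs {q : ℕ} {P : Fin q → ℝ} (hP : ∀ i, P i ∈ Set.Icc (0 : ℝ) 1) (i j : Fin q) :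
    |yy P i j| ≤ 1 := by
  unfold yy
  refine abs_sub_le_one_of_mem ?_ (hP i)
  split_ifs <;> simp

lemma yy_mul_le {q : ℕ} {P : Fin q → ℝ} (hP : ∀ i, P i ∈ Set.Icc (0 : ℝ) 1) (i j j' : Fin q) :
    yy P i j * yy P i j' ≤ 1 := by
  refine (le_abs_self _).trans ?_
  rw [abs_mul]; exact mul_le_one₀ (yy_abs hP _ _) (abs_nonneg _) (yy_abs hP _ _)

lemma yy_mean {Ω : Type} [MeasurableSpace Ω] (m : Measure Ω) [IsProbabilityMeasure m] {q : ℕ}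
    {f : Ω → Fin q} (hf : Measurable f) (i : Fin q) : ∫ x, yy (cum m f) i (f x) ∂m = 0 := by
  classical
  have hS : MeasurableSet {x | f x ≤ i} := hf (Set.toFinite {j | j ≤ i}).measurableSet
  have e : ∀ x, yy (cum m f) i (f x) = ({x | f x ≤ i}).indicator (fun _ => (1 : ℝ)) x - cum m f i := by
    intro x
    unfold yy
    congr 1
    by_cases h : f x ≤ i
    · rw [if_pos h, Set.indicator_of_mem]; exact h
    · rw [if_neg h, Set.indicator_of_notMem]; exact h
  simp_rw [e]
  rw [integral_sub ((integrable_const _).indicator hS) (integrable_const _), integral_indicator hS]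
  simp [cum]

lemma indDensity_eq {k : ℕ} (F : SimpleGraph (Fin k)) (W : ℝ → ℝ → ℝ) :
    indDensity F W = ∫ x, wt (fun a b => W (x a) (x b)) F ∂(Measure.pi fun _ : Fin k => mu) := by
  unfold indDensity wt
  rw [cube_restrict]

lemma wt_le_one {k : ℕ} {w : Fin k → Fin k → ℝ} (hw : ∀ a b, w a b ∈ Set.Icc (0 : ℝ) 1)
    (F : SimpleGraph (Fin k)) : wt w F ≤ 1 := by
  rw [← wt_sum w]
  exact Finset.single_le_sum (f := wt w) (fun F _ => wt_nonneg hw F) (Finset.mem_univ F)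

lemma wt_meas {k : ℕ} {W : ℝ → ℝ → ℝ} (hW : IsGraphon W) (F : SimpleGraph (Fin k)) :
    Measurable fun x : Fin k → ℝ => wt (fun a b => W (x a) (x b)) F := by
  unfold wt
  refine Finset.measurable_prod _ fun i _ => Finset.measurable_prod _ fun j _ => ?_
  have h2 : Measurable (fun a : Fin k → ℝ => (a i, a j)) :=
    (measurable_pi_apply i).prodMk (measurable_pi_apply j)
  have h3 : Measurable (fun a : Fin k → ℝ => W (a i) (a j)) := hW.1.comp h2
  split_ifs
  · exact h3
  · exact measurable_const.sub h3
  · exact measurable_const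

lemma wt_int {k : ℕ} {W : ℝ → ℝ → ℝ} (hW : IsGraphon W) (F : SimpleGraph (Fin k)) :
    Integrable (fun x : Fin k → ℝ => wt (fun a b => W (x a) (x b)) F)
      (Measure.pi fun _ : Fin k => mu) := by
  refine Integrable.of_bound (wt_meas hW F).aestronglyMeasurable 1 (ae_of_all _ fun x => ?_)
  rw [Real.norm_eq_abs, abs_of_nonneg (wt_nonneg (fun a b => hW.2.2 _ _) F)]
  exact wt_le_one (fun a b => hW.2.2 _ _) F

lemma indDensity_nonneg {k : ℕ} (F : SimpleGraph (Fin k)) {W : ℝ → ℝ → ℝ} (hW : IsGraphon W) :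
    0 ≤ indDensity F W := by
  rw [indDensity_eq]
  exact integral_nonneg fun x => wt_nonneg (fun a b => hW.2.2 _ _) F

lemma indDensity_sum (k : ℕ) {W : ℝ → ℝ → ℝ} (hW : IsGraphon W) :
    ∑ F : SimpleGraph (Fin k), indDensity F W = 1 := by
  simp_rw [indDensity_eq]
  rw [← integral_finsetSum _ fun F _ => wt_int hW F]
  simp_rw [wt_sum]
  simp

set_option maxHeartbeats 1600000 in
open Classical in
lemma sample_bad {k q : ℕ} (hk : 0 < k) {W : ℝ → ℝ → ℝ} (hW : IsGraphon W) {f : ℝ → Fin q}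
    (hf : Measurable f) {A : Fin q → Fin q → ℝ} (hAs : ∀ i j, A i j = A j i)
    (hA : ∀ i j, A i j ∈ Set.Icc (0 : ℝ) 1) {η η' : ℝ} (hη : 0 < η) (hη' : 0 ≤ η')
    (hcut : CutLe mu (fun x y => W x y - A (f x) (f y)) η') :
    (∑ F : SimpleGraph (Fin k), if GApprox F A (cum mu f) η then 0 else indDensity F W)
      ≤ 4 * η' / η ^ 4 + (6 / η ^ 4 + q ^ 2 / η ^ 2) / k := by
  set P := cum mu f with hP
  have hP01 : ∀ i, P i ∈ Set.Icc (0 : ℝ) 1 := fun i => ⟨cum_nonneg _ _ _, cum_le_one _ _ _⟩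
  set ν : Measure (Fin k → ℝ) := Measure.pi fun _ => mu with hν
  set K : ℝ → ℝ → ℝ := fun x y => W x y - A (f x) (f y) with hK
  have hKm : Measurable (Function.uncurry K) := hW.1.sub (step_meas A hf)
  have hK1 : ∀ x y, |K x y| ≤ 1 := fun x y => abs_sub_le_one_of_mem (hW.2.2 _ _) (hA _ _)
  -- the averaged four-cycle terms
  set Z : (Fin k → ℝ) → Fin k → Fin k → Fin k → Fin k → ℝ := fun x a a' b b' =>
    if D4 a a' b b' then K (x a) (x b) * K (x a') (x b) * K (x a) (x b') * K (x a') (x b') else 1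
    with hZ
  set Y : (Fin k → ℝ) → Fin q → Fin k → Fin k → ℝ := fun x i a b =>
    yy P i (f (x a)) * yy P i (f (x b)) with hY
  have hKc : ∀ a b : Fin k, Measurable fun x : Fin k → ℝ => K (x a) (x b) := fun a b =>
    show Measurable (Function.uncurry K ∘ fun x : Fin k → ℝ => (x a, x b)) from
      hKm.comp ((measurable_pi_apply a).prodMk (measurable_pi_apply b))
  have hZi : ∀ a a' b b', Integrable (fun x => Z x a a' b b') ν := by
    intro a a' b b'
    simp only [hZ]
    split_ifs
    · refine Integrable.of_bound ((((hKc _ _).mul (hKc _ _)).mul (hKc _ _)).mul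
        (hKc _ _)).aestronglyMeasurable 1 (ae_of_all _ fun x => ?_)
      rw [Real.norm_eq_abs]
      exact abs_mul4 (hK1 _ _) (hK1 _ _) (hK1 _ _) (hK1 _ _)
    · exact integrable_const _
  have hyc : ∀ i a, Measurable fun x : Fin k → ℝ => yy P i (f (x a)) := fun i a =>
    (measurable_of_countable (yy P i)).comp (hf.comp (measurable_pi_apply a))
  have hYi : ∀ i a b, Integrable (fun x => Y x i a b) ν := by
    intro i a b
    refine Integrable.of_bound ((hyc i a).mul (hyc i b)).aestronglyMeasurable 1
      (ae_of_all _ fun x => ?_)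
    rw [Real.norm_eq_abs, abs_mul]
    exact mul_le_one₀ (yy_abs hP01 _ _) (abs_nonneg _) (yy_abs hP01 _ _)
  have hpt : ∀ x : Fin k → ℝ,
      (∑ F : SimpleGraph (Fin k), if GApprox F A P η then 0 else wt (fun a b => W (x a) (x b)) F)
      ≤ (∑ a, ∑ a', ∑ b, ∑ b', Z x a a' b b') / (η ^ 4 * k ^ 4)
        + q / η ^ 2 * ∑ i, (∑ a, ∑ b, Y x i a b) / k ^ 2 := by
    intro x
    set w : Fin k → Fin k → ℝ := fun a b => W (x a) (x b) with hw
    have hw01 : ∀ a b, w a b ∈ Set.Icc (0 : ℝ) 1 := fun a b => hW.2.2 _ _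
    set l : Fin k → Fin q := fun a => f (x a) with hl
    set X : SimpleGraph (Fin k) → Fin k → Fin k → ℝ := fun F a b => aI F a b - A (l a) (l b) with hX
    have hX1 : ∀ F a b, |X F a b| ≤ 1 := fun F a b => abs_sub_le_one_of_mem (aI_mem _ _ _) (hA _ _)
    set S := ∑ i, (∑ a, ∑ b, Y x i a b) / (k : ℝ) ^ 2 with hS
    have hnn : ∀ F : SimpleGraph (Fin k),
        0 ≤ (∑ a, ∑ a', ∑ b, ∑ b', X F a b * X F a' b * X F a b' * X F a' b') := fun F => by
      rw [← c4_expand]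
      exact Finset.sum_nonneg fun _ _ => Finset.sum_nonneg fun _ _ => sq_nonneg _
    have hS0 : 0 ≤ S := by
      refine Finset.sum_nonneg fun i _ => ?_
      have := gcum_sub hk l P i
      rw [← this]; exact sq_nonneg _
    calc (∑ F : SimpleGraph (Fin k), if GApprox F A P η then 0 else wt w F)
        ≤ ∑ F : SimpleGraph (Fin k), wt w F * ((∑ a, ∑ a', ∑ b, ∑ b',
          X F a b * X F a' b * X F a b' * X F a' b') / (η ^ 4 * k ^ 4) + q / η ^ 2 * S) := by
          refine Finset.sum_le_sum fun F _ => ?_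
          have hw0 := wt_nonneg hw01 F
          split_ifs with hg
          · have h5 : 0 ≤ q / η ^ 2 * S := mul_nonneg (by positivity) hS0
            exact mul_nonneg hw0 (add_nonneg (div_nonneg (hnn F) (by positivity)) h5)
          · have := bad_bound hk F A P hη l hg
            exact le_mul_of_one_le_right hw0 this
      _ = (∑ a, ∑ a', ∑ b, ∑ b', ∑ F : SimpleGraph (Fin k),
            wt w F * (X F a b * X F a' b * X F a b' * X F a' b')) / (η ^ 4 * k ^ 4)
            + q / η ^ 2 * S := by
          simp_rw [mul_add, Finset.sum_add_distrib, ← Finset.sum_mul, wt_sum, one_mul]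
          congr 1
          simp_rw [← mul_div_assoc, ← Finset.sum_div]
          congr 1
          simp_rw [Finset.mul_sum]
          rw [Finset.sum_comm]; refine Finset.sum_congr rfl fun a _ => ?_
          rw [Finset.sum_comm]; refine Finset.sum_congr rfl fun a' _ => ?_
          rw [Finset.sum_comm]; refine Finset.sum_congr rfl fun b _ => ?_
          rw [Finset.sum_comm]
      _ ≤ _ := by
          gcongr with a _ a' _ b _ b' _
          simp only [hZ]
          split_ifs with hd
          · exact (wt_prod4 w (fun a b => hW.2.1 _ _) (fun a b => A (l a) (l b))
              (fun a b => hAs _ _) hd).le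
          · rw [← wt_sum w]
            refine Finset.sum_le_sum fun F _ => ?_
            refine mul_le_of_le_one_right (wt_nonneg hw01 F) ?_
            exact (le_abs_self _).trans (abs_mul4 (hX1 _ _ _) (hX1 _ _ _) (hX1 _ _ _) (hX1 _ _ _))
  have hnb := num_bound (q := q) hk hη (c := 4 * η') (fun a a' b b' => ∫ x, Z x a a' b b' ∂ν) (by
      intro a a' b b'
      simp only [hZ]
      split_ifs with hd
      · have := int4 hd K hKm hK1 hcut
        have h0 := nd4_nonneg a a' b b'
        linarith
      · have := one_le_nd4 hd
        simp only [integral_const, probReal_univ, smul_eq_mul, mul_one]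
        linarith) (fun i a b => ∫ x, Y x i a b ∂ν) (by
      intro i a b
      split_ifs with hab
      · calc ∫ x, Y x i a b ∂ν ≤ ∫ x, 1 ∂ν :=
            integral_mono (hYi i a b) (integrable_const _) fun x => yy_mul_le hP01 _ _ _
          _ = 1 := by simp
      · have hm : Measurable fun p : ℝ × ℝ => yy P i (f p.1) * yy P i (f p.2) :=
          (((measurable_of_countable (yy P i)).comp hf).comp measurable_fst).mul
            (((measurable_of_countable (yy P i)).comp hf).comp measurable_snd)
        have e : ∫ x, Y x i a b ∂ν = ∫ p, yy P i (f p.1) * yy P i (f p.2) ∂(mu.prod mu) := by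
          rw [← eval2 hab, integral_map ((measurable_pi_apply a).prodMk
            (measurable_pi_apply b)).aemeasurable hm.aestronglyMeasurable]
        rw [e, integral_prod_mul (fun u => yy P i (f u)) (fun u => yy P i (f u)), hP,
          yy_mean mu hf, zero_mul])
  refine le_trans ?_ hnb
  have e1 : (∑ F : SimpleGraph (Fin k), if GApprox F A P η then 0 else indDensity F W)
      = ∫ x, (∑ F : SimpleGraph (Fin k),
        if GApprox F A P η then 0 else wt (fun a b => W (x a) (x b)) F) ∂ν := by
    rw [integral_finsetSum]
    · refine Finset.sum_congr rfl fun F _ => ?_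
      split_ifs
      · simp
      · exact indDensity_eq F W
    · intro F _
      split_ifs
      · exact integrable_const _
      · exact wt_int hW F
  have i1 : Integrable (fun x => ∑ a, ∑ a', ∑ b, ∑ b', Z x a a' b b') ν :=
    integrable_finsetSum _ fun a _ => integrable_finsetSum _ fun a' _ =>
      integrable_finsetSum _ fun b _ => integrable_finsetSum _ fun b' _ => hZi a a' b b'
  have i2 : ∀ i, Integrable (fun x => (∑ a, ∑ b, Y x i a b) / (k : ℝ) ^ 2) ν := fun i =>
    (integrable_finsetSum _ fun a _ => integrable_finsetSum _ fun b _ => hYi i a b).div_const _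
  have i3 : Integrable (fun x => ∑ i, (∑ a, ∑ b, Y x i a b) / (k : ℝ) ^ 2) ν :=
    integrable_finsetSum _ fun i _ => i2 i
  have e2 : ∫ x, ((∑ a, ∑ a', ∑ b, ∑ b', Z x a a' b b') / (η ^ 4 * k ^ 4)
        + q / η ^ 2 * ∑ i, (∑ a, ∑ b, Y x i a b) / k ^ 2) ∂ν
      = (∑ a, ∑ a', ∑ b, ∑ b', ∫ x, Z x a a' b b' ∂ν) / (η ^ 4 * k ^ 4)
        + q / η ^ 2 * ∑ i, (∑ a, ∑ b, ∫ x, Y x i a b ∂ν) / k ^ 2 := by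
    rw [integral_add (i1.div_const _) (i3.const_mul _), integral_div, integral_const_mul,
      integral_finsetSum _ fun i _ => i2 i]
    congr 1
    · congr 1
      rw [integral_finsetSum _ fun a _ => integrable_finsetSum _ fun a' _ =>
        integrable_finsetSum _ fun b _ => integrable_finsetSum _ fun b' _ => hZi a a' b b']
      refine Finset.sum_congr rfl fun a _ => ?_
      rw [integral_finsetSum _ fun a' _ =>
        integrable_finsetSum _ fun b _ => integrable_finsetSum _ fun b' _ => hZi a a' b b']
      refine Finset.sum_congr rfl fun a' _ => ?_
      rw [integral_finsetSum _ fun b _ => integrable_finsetSum _ fun b' _ => hZi a a' b b']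
      refine Finset.sum_congr rfl fun b _ => ?_
      rw [integral_finsetSum _ fun b' _ => hZi a a' b b']
    · congr 1
      refine Finset.sum_congr rfl fun i _ => ?_
      rw [integral_div]
      congr 1
      rw [integral_finsetSum _ fun a _ => integrable_finsetSum _ fun b _ => hYi i a b]
      refine Finset.sum_congr rfl fun a _ => ?_
      rw [integral_finsetSum _ fun b _ => hYi i a b]
  rw [e1, ← e2]
  refine integral_mono ?_ ((i1.div_const _).add (i3.const_mul _)) hpt
  refine integrable_finsetSum _ fun F _ => ?_
  split_ifs
  · exact integrable_const _
  · exact wt_int hW F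

open Classical in
theorem sample_graphon (η : ℝ) (hη : 0 < η) : ∃ N : ℕ, 0 < N ∧ ∀ W, IsGraphon W →
    ∃ (q : ℕ) (A : Fin q → Fin q → ℝ) (P : Fin q → ℝ), (∀ i j, A i j ∈ Set.Icc (0 : ℝ) 1) ∧
      Approx W A P η ∧ ∀ k, N ≤ k →
        3 / 4 ≤ ∑ F : SimpleGraph (Fin k), if GApprox F A P η then indDensity F W else 0 := by
  set η' := min η (η ^ 4 / 32) with hη'
  have h0 : 0 < η' := lt_min hη (by positivity)
  obtain ⟨q, hq, hreg⟩ := weak_reg η' h0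
  obtain ⟨N, hN⟩ := exists_nat_gt (8 * (6 / η ^ 4 + q ^ 2 / η ^ 2))
  refine ⟨N + 1, Nat.succ_pos _, fun W hW => ?_⟩
  obtain ⟨f, hf, A, hAs, hA, hcut⟩ := hreg ℝ mu W hW.1 hW.2.1 hW.2.2
  refine ⟨q, A, cum mu f, hA, ⟨f, hf, hcut.mono (min_le_left _ _), ?_⟩, fun k hk => ?_⟩
  · simp [hη.le]
  · have hk0 : 0 < k := by omega
    have hk' : (0 : ℝ) < k := by exact_mod_cast hk0
    have hkN : (N : ℝ) ≤ k := by exact_mod_cast (by omega : N ≤ k)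
    have hb := sample_bad hk0 hW hf hAs hA hη h0.le hcut
    have b1 : 4 * η' / η ^ 4 ≤ 1 / 8 := by
      rw [div_le_iff₀ (by positivity)]
      have := min_le_right η (η ^ 4 / 32)
      rw [← hη'] at this
      linarith
    have b2 : (6 / η ^ 4 + q ^ 2 / η ^ 2) / k ≤ 1 / 8 := by
      rw [div_le_iff₀ hk']; linarith
    have hs := indDensity_sum k hW
    have e : (∑ F : SimpleGraph (Fin k), if GApprox F A (cum mu f) η then indDensity F W else 0)
        + (∑ F : SimpleGraph (Fin k), if GApprox F A (cum mu f) η then 0 else indDensity F W) = 1 := by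
      rw [← Finset.sum_add_distrib, ← hs]
      refine Finset.sum_congr rfl fun F _ => ?_
      split_ifs <;> simp
    linarith

lemma perm_avg {n : ℕ} {T : Type} [DecidableEq T] (act : Equiv.Perm (Fin n) → T → T) (s : Finset T)
    (hmem : ∀ π, ∀ t ∈ s, act π t ∈ s) (hinj : ∀ π, Function.Injective (act π))
    (hmul : ∀ π τ t, act (π * τ) t = act π (act τ t)) (t0 : T)
    (htr : ∀ t ∈ s, ∃ τ, act τ t0 = t) (φ : T → ℝ) :
    (∑ π, φ (act π t0)) * s.card = (Fintype.card (Equiv.Perm (Fin n)) : ℝ) * ∑ t ∈ s, φ t := by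
  have h1 : ∀ t ∈ s, ∑ π, φ (act π t) = ∑ π, φ (act π t0) := by
    intro t ht
    obtain ⟨τ, rfl⟩ := htr t ht
    simp_rw [← hmul]
    exact Equiv.sum_comp (Equiv.mulRight τ) (fun π => φ (act π t0))
  have h2 : ∀ π, ∑ t ∈ s, φ (act π t) = ∑ t ∈ s, φ t := by
    intro π
    have e : s.image (act π) = s := by
      refine Finset.eq_of_subset_of_card_le ?_ ?_
      · intro t ht
        obtain ⟨u, hu, rfl⟩ := Finset.mem_image.1 ht
        exact hmem π u hu
      · rw [Finset.card_image_of_injective _ (hinj π)]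
    conv_rhs => rw [← e]
    rw [Finset.sum_image fun a _ b _ h => hinj π h]
  calc (∑ π, φ (act π t0)) * s.card = ∑ t ∈ s, ∑ π, φ (act π t) := by
        rw [Finset.sum_congr rfl h1, Finset.sum_const, nsmul_eq_mul, mul_comm]
    _ = ∑ π, ∑ t ∈ s, φ (act π t) := Finset.sum_comm
    _ = _ := by
        rw [Finset.sum_congr rfl fun π _ => h2 π, Finset.sum_const, nsmul_eq_mul, Finset.card_univ]

lemma exists_perm {n m : ℕ} (x y : Fin m → Fin n) (hx : Function.Injective x)
    (hy : Function.Injective y) : ∃ π : Equiv.Perm (Fin n), ∀ i, π (x i) = y i := by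
  have := Equiv.Perm.isMultiplyPretransitive (Fin n) m
  obtain ⟨π, hπ⟩ := MulAction.exists_smul_eq (Equiv.Perm (Fin n))
    (⟨x, hx⟩ : Fin m ↪ Fin n) (⟨y, hy⟩ : Fin m ↪ Fin n)
  exact ⟨π, fun i => DFunLike.congr_fun hπ i⟩

/-- The uniform probability measure on `Fin n`. -/
def unif (n : ℕ) : Measure (Fin n) := (n : ℝ≥0∞)⁻¹ • Measure.count

lemma unif_prob {n : ℕ} (hn : 0 < n) : IsProbabilityMeasure (unif n) := by
  constructor
  simp only [unif, Measure.smul_apply, Measure.count_univ, smul_eq_mul]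
  rw [ENat.card_eq_coe_fintype_card, Fintype.card_fin]
  exact ENNReal.inv_mul_cancel (by exact_mod_cast hn.ne') (by simp)

lemma unif_int {n : ℕ} (φ : Fin n → ℝ) : ∫ x, φ x ∂(unif n) = (∑ x, φ x) / n := by
  rw [unif, integral_smul_measure, integral_fintype Integrable.of_finite]
  simp [div_eq_inv_mul, measureReal_def]

lemma unif_int2 {n : ℕ} (hn : 0 < n) (φ : Fin n × Fin n → ℝ) :
    ∫ x, φ x ∂((unif n).prod (unif n)) = (∑ a, ∑ b, φ (a, b)) / n ^ 2 := by
  have := unif_prob hn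
  rw [integral_prod _ Integrable.of_finite]
  simp_rw [unif_int]
  rw [← Finset.sum_div, div_div, sq]

lemma unif_c4 {n : ℕ} (hn : 0 < n) (K : Fin n → Fin n → ℝ) (hK : ∀ x y, |K x y| ≤ 1) {η : ℝ}
    (hcut : CutLe (unif n) K η) :
    ∑ a, ∑ a', ∑ b, ∑ b', K a b * K a' b * K a b' * K a' b' ≤ 4 * η * n ^ 4 := by
  have := unif_prob hn
  have hn' : (0 : ℝ) < n := by exact_mod_cast hn
  have h := c4_le (unif n) K (measurable_of_countable _) hK η hcut
  simp_rw [unif_int2 hn] at h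
  simp_rw [← Finset.sum_div] at h
  rw [div_div, div_le_iff₀ (by positivity)] at h
  refine le_trans (le_of_eq ?_) (h.trans (le_of_eq (by ring)))
  rw [Finset.sum_comm]
  refine Finset.sum_congr rfl fun a' _ => ?_
  -- the sums run over `a, b, b'` and `b', a, b`
  calc ∑ a, ∑ b, ∑ b', K a b * K a' b * K a b' * K a' b'
      = ∑ a, ∑ b', ∑ b, K a b * K a' b * K a b' * K a' b' :=
        Finset.sum_congr rfl fun a _ => Finset.sum_comm
    _ = _ := Finset.sum_comm

lemma unif_gcum {n q : ℕ} (f : Fin n → Fin q) (i : Fin q) : cum (unif n) f i = gcum f i := by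
  classical
  have h : (unif n).real {x | f x ≤ i} = ∫ x, ({x | f x ≤ i}).indicator (fun _ => (1 : ℝ)) x ∂(unif n) := by
    rw [integral_indicator (Set.toFinite _).measurableSet]
    simp
  unfold cum gcum
  rw [h, unif_int]
  congr 1
  refine Finset.sum_congr rfl fun x _ => ?_
  by_cases hx : f x ≤ i
  · rw [if_pos hx, Set.indicator_of_mem]; exact hx
  · rw [if_neg hx, Set.indicator_of_notMem]; exact hx

open Classical in
lemma card_D4 (n : ℕ) : (n : ℝ) ^ 4 - 6 * n ^ 3 ≤
    ∑ a : Fin n, ∑ a', ∑ b, ∑ b', if D4 a a' b b' then (1 : ℝ) else 0 := by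
  have h : ∀ a a' b b' : Fin n, 1 - nd4 a a' b b' ≤ if D4 a a' b b' then (1 : ℝ) else 0 := by
    intro a a' b b'
    split_ifs with hd
    · have := nd4_nonneg a a' b b'; linarith
    · have := one_le_nd4 hd; linarith
  have h2 : ∑ a : Fin n, ∑ a', ∑ b, ∑ b', (1 - nd4 a a' b b') ≤
      ∑ a : Fin n, ∑ a', ∑ b, ∑ b', if D4 a a' b b' then (1 : ℝ) else 0 :=
    Finset.sum_le_sum fun a _ => Finset.sum_le_sum fun a' _ => Finset.sum_le_sum fun b _ =>
            Finset.sum_le_sum fun b' _ => h _ _ _ _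
  refine le_trans (le_of_eq ?_) h2
  simp only [Finset.sum_sub_distrib, sum_nd4]
  simp only [Finset.sum_const, Finset.card_univ, Fintype.card_fin, nsmul_eq_mul]
  ring

lemma D4_inj {n : ℕ} {a a' b b' : Fin n} (h : D4 a a' b b') :
    Function.Injective ![a, a', b, b'] := by
  obtain ⟨h1, h2, h3, h4, h5, h6⟩ := h
  intro i j hij
  fin_cases i <;> fin_cases j <;> simp_all

lemma D4_map {n m : ℕ} {a a' b b' : Fin n} (h : D4 a a' b b') {x : Fin n → Fin m}
    (hx : Function.Injective x) : D4 (x a) (x a') (x b) (x b') := by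
  obtain ⟨h1, h2, h3, h4, h5, h6⟩ := h
  exact ⟨hx.ne h1, hx.ne h2, hx.ne h3, hx.ne h4, hx.ne h5, hx.ne h6⟩

open Classical in
lemma perm4 {n : ℕ} {a a' b b' : Fin n} (h : D4 a a' b b') (φ : Fin n → Fin n → Fin n → Fin n → ℝ) :
    (∑ π : Equiv.Perm (Fin n), φ (π a) (π a') (π b) (π b')) *
        (∑ a : Fin n, ∑ a', ∑ b, ∑ b', if D4 a a' b b' then (1 : ℝ) else 0)
      = (Fintype.card (Equiv.Perm (Fin n)) : ℝ) *
        (∑ a : Fin n, ∑ a', ∑ b, ∑ b', if D4 a a' b b' then φ a a' b b' else 0) := by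
  set s : Finset (Fin n × Fin n × Fin n × Fin n) :=
    Finset.univ.filter fun t => D4 t.1 t.2.1 t.2.2.1 t.2.2.2 with hs
  have e : ∀ ψ : Fin n → Fin n → Fin n → Fin n → ℝ,
      (∑ a : Fin n, ∑ a', ∑ b, ∑ b', if D4 a a' b b' then ψ a a' b b' else 0)
        = ∑ t ∈ s, ψ t.1 t.2.1 t.2.2.1 t.2.2.2 := by
    intro ψ
    rw [hs, Finset.sum_filter]
    simp only [Fintype.sum_prod_type]
  rw [e φ, e (fun _ _ _ _ => 1)]
  have := perm_avg (n := n) (fun π (t : Fin n × Fin n × Fin n × Fin n) =>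
    (π t.1, π t.2.1, π t.2.2.1, π t.2.2.2)) s ?_ ?_ (fun _ _ _ => rfl) (a, a', b, b') ?_
    (fun t => φ t.1 t.2.1 t.2.2.1 t.2.2.2)
  · simpa using this
  · intro π t ht
    simp only [hs, Finset.mem_filter, Finset.mem_univ, true_and] at ht ⊢
    exact D4_map ht π.injective
  · rintro π ⟨t1, t2, t3, t4⟩ ⟨u1, u2, u3, u4⟩ htu
    simpa using htu
  · rintro ⟨t1, t2, t3, t4⟩ ht
    simp only [hs, Finset.mem_filter, Finset.mem_univ, true_and] at ht
    obtain ⟨τ, hτ⟩ := exists_perm _ _ (D4_inj h) (D4_inj ht)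
    refine ⟨τ, ?_⟩
    have h0 := hτ 0
    have h1 := hτ 1
    have h2 := hτ 2
    have h3 := hτ 3
    simp at h0 h1 h2 h3
    simp [h0, h1, h2, h3]

lemma perm2 {n : ℕ} {a b : Fin n} (h : a ≠ b) (φ : Fin n → Fin n → ℝ) :
    (∑ π : Equiv.Perm (Fin n), φ (π a) (π b)) * (Finset.offDiag (Finset.univ : Finset (Fin n))).card
      = (Fintype.card (Equiv.Perm (Fin n)) : ℝ) *
        ∑ t ∈ Finset.offDiag (Finset.univ : Finset (Fin n)), φ t.1 t.2 := by
  have := perm_avg (n := n) (fun π (t : Fin n × Fin n) => (π t.1, π t.2))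
    (Finset.offDiag (Finset.univ : Finset (Fin n))) ?_ ?_ (fun _ _ _ => rfl) (a, b) ?_
    (fun t => φ t.1 t.2)
  · exact this
  · intro π t ht
    simpa using ht
  · rintro π ⟨t1, t2⟩ ⟨u1, u2⟩ htu
    simpa using htu
  · rintro ⟨t1, t2⟩ ht
    have ht' : t1 ≠ t2 := by simpa using ht
    have hi : ∀ {a b : Fin n}, a ≠ b → Function.Injective ![a, b] := by
      intro a b h i j hij
      fin_cases i <;> fin_cases j <;> simp_all
    obtain ⟨τ, hτ⟩ := exists_perm _ _ (hi h) (hi ht')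
    refine ⟨τ, ?_⟩
    have h0 := hτ 0
    have h1 := hτ 1
    simp at h0 h1
    simp [h0, h1]

lemma permk {n k : ℕ} {S0 : Finset (Fin n)} (h0 : S0.card = k) (φ : Finset (Fin n) → ℝ) :
    (∑ π : Equiv.Perm (Fin n), φ (S0.map π.toEmbedding)) * (n.choose k : ℝ)
      = (Fintype.card (Equiv.Perm (Fin n)) : ℝ) *
        ∑ S ∈ Finset.powersetCard k Finset.univ, φ S := by
  have := perm_avg (n := n) (fun π (S : Finset (Fin n)) => S.map π.toEmbedding)
    (Finset.powersetCard k Finset.univ) ?_ ?_ ?_ S0 ?_ φ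
  · rw [Finset.card_powersetCard] at this
    simpa using this
  · intro π t ht
    simpa using ht
  · intro π t u htu
    exact Finset.map_injective _ htu
  · intro π τ S
    rw [Finset.map_map]; rfl
  · intro S hS
    have hS' : S.card = k := (Finset.mem_powersetCard.1 hS).2
    obtain ⟨τ, hτ⟩ := exists_perm _ _ (S0.orderEmbOfFin h0).injective (S.orderEmbOfFin hS').injective
    refine ⟨τ, ?_⟩
    refine Finset.eq_of_subset_of_card_le ?_ (by rw [Finset.card_map, h0, hS'])
    intro x hx
    obtain ⟨y, hy, rfl⟩ := Finset.mem_map.1 hx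
    have : y ∈ Set.range (S0.orderEmbOfFin h0) := by rw [Finset.range_orderEmbOfFin]; exact hy
    obtain ⟨i, rfl⟩ := this
    have := hτ i
    simp only [Equiv.coe_toEmbedding]
    rw [this]
    exact Finset.orderEmbOfFin_mem S hS' i

lemma comap_iso {n k : ℕ} (G : SimpleGraph (Fin n)) {S : Finset (Fin n)} (hS : S.card = k)
    (f g : Fin k ↪ Fin n) (hf : ∀ i, f i ∈ S) (hg : ∀ i, g i ∈ S) :
    Nonempty (G.comap f ≃g G.comap g) := by
  have him : Finset.univ.map g = S := by
    refine Finset.eq_of_subset_of_card_le ?_ (by simp [hS])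
    intro x hx
    obtain ⟨y, -, rfl⟩ := Finset.mem_map.1 hx
    exact hg y
  have hex : ∀ i, ∃ j, g j = f i := by
    intro i
    have := hf i
    rw [← him] at this
    obtain ⟨y, -, hy⟩ := Finset.mem_map.1 this
    exact ⟨y, hy⟩
  choose e he using hex
  have hinj : Function.Injective e := by
    intro i j hij
    apply f.injective
    rw [← he i, ← he j, hij]
  refine ⟨⟨Equiv.ofBijective e (Finite.injective_iff_bijective.1 hinj), ?_⟩⟩
  intro a b
  simp [SimpleGraph.comap_adj, he]

open Classical in
lemma gsample_bad {n k q : ℕ} (hk : 0 < k) (hkn : k ≤ n) (hn : 12 ≤ n) (G : SimpleGraph (Fin n))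
    {f : Fin n → Fin q} {A : Fin q → Fin q → ℝ}
    (hA : ∀ i j, A i j ∈ Set.Icc (0 : ℝ) 1) {η η' : ℝ} (hη : 0 < η) (hη' : 0 ≤ η')
    (hcut : CutLe (unif n) (fun x y => aI G x y - A (f x) (f y)) η') :
    (∑ π : Equiv.Perm (Fin n),
      if GApprox (G.comap fun a : Fin k => π (Fin.castLE hkn a)) A (gcum f) η then (0 : ℝ) else 1)
      ≤ (Fintype.card (Equiv.Perm (Fin n)) : ℝ) *
        (2 * (4 * η' + 6 / n) / η ^ 4 + (6 / η ^ 4 + q ^ 2 / η ^ 2) / k) := by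
  have hn0 : 0 < n := by omega
  have hn' : (0 : ℝ) < n := by exact_mod_cast hn0
  have hn12 : (12 : ℝ) ≤ n := by exact_mod_cast hn
  have hprob := unif_prob hn0
  set P := gcum f with hP
  have hPc : P = cum (unif n) f := by ext i; rw [unif_gcum]
  have hP01 : ∀ i, P i ∈ Set.Icc (0 : ℝ) 1 := fun i => by
    rw [hPc]; exact ⟨cum_nonneg _ _ _, cum_le_one _ _ _⟩
  set M : ℝ := (Fintype.card (Equiv.Perm (Fin n)) : ℝ) with hM
  have hM0 : 0 < M := by rw [hM]; exact_mod_cast Fintype.card_pos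
  set K : Fin n → Fin n → ℝ := fun x y => aI G x y - A (f x) (f y) with hK
  have hK1 : ∀ x y, |K x y| ≤ 1 := fun x y => abs_sub_le_one_of_mem (aI_mem _ _ _) (hA _ _)
  set x : Equiv.Perm (Fin n) → Fin k → Fin n := fun π a => π (Fin.castLE hkn a) with hx
  have hxi : ∀ π, Function.Injective (x π) := fun π => π.injective.comp (Fin.castLE_injective hkn)
  set Z : Fin n → Fin n → Fin n → Fin n → ℝ := fun a a' b b' =>
    K a b * K a' b * K a b' * K a' b' with hZ
  have hZ1 : ∀ a a' b b', |Z a a' b b'| ≤ 1 := fun a a' b b' =>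
    abs_mul4 (hK1 _ _) (hK1 _ _) (hK1 _ _) (hK1 _ _)
  have hpt : ∀ π : Equiv.Perm (Fin n),
      (if GApprox (G.comap (x π)) A P η then (0 : ℝ) else 1)
      ≤ (∑ a, ∑ a', ∑ b, ∑ b', Z (x π a) (x π a') (x π b) (x π b')) / (η ^ 4 * k ^ 4)
        + q / η ^ 2 * ∑ i, (∑ a, ∑ b, yy P i (f (x π a)) * yy P i (f (x π b))) / k ^ 2 := by
    intro π
    have hadj : ∀ a b : Fin k, aI (G.comap (x π)) a b = aI G (x π a) (x π b) := fun a b => rfl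
    split_ifs with hg
    · have h1 := c4_expand (fun a b : Fin k => K (x π a) (x π b))
      have h2 : 0 ≤ c4 (fun a b : Fin k => K (x π a) (x π b)) :=
        Finset.sum_nonneg fun _ _ => Finset.sum_nonneg fun _ _ => sq_nonneg _
      rw [h1] at h2
      have h3 : 0 ≤ ∑ i, (∑ a, ∑ b, yy P i (f (x π a)) * yy P i (f (x π b))) / (k : ℝ) ^ 2 := by
        refine Finset.sum_nonneg fun i _ => ?_
        have := gcum_sub hk (fun a => f (x π a)) P i
        rw [← this]; exact sq_nonneg _
      exact add_nonneg (div_nonneg h2 (by positivity)) (mul_nonneg (by positivity) h3)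
    · exact bad_bound hk (G.comap (x π)) A P hη (fun a => f (x π a)) hg
  have hnb := num_bound (q := q) hk hη (c := 2 * (4 * η' + 6 / n))
    (fun a a' b b' => (∑ π, Z (x π a) (x π a') (x π b) (x π b')) / M) (by
      intro a a' b b'
      rw [div_le_iff₀ hM0]
      by_cases hd : D4 a a' b b'
      · have hp := perm4 (D4_map hd (Fin.castLE_injective hkn)) Z
        set N := ∑ a : Fin n, ∑ a', ∑ b, ∑ b', if D4 a a' b b' then (1 : ℝ) else 0 with hN
        have hNl : (n : ℝ) ^ 4 / 2 ≤ N := by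
          refine le_trans ?_ (card_D4 n)
          have : 0 ≤ (n : ℝ) ^ 3 * (n - 12) := mul_nonneg (by positivity) (by linarith)
          nlinarith
        have hN0 : 0 < N := lt_of_lt_of_le (by positivity) hNl
        have hsum : (∑ a : Fin n, ∑ a', ∑ b, ∑ b', if D4 a a' b b' then Z a a' b b' else 0)
            ≤ 4 * η' * n ^ 4 + 6 * n ^ 3 := by
          calc (∑ a : Fin n, ∑ a', ∑ b, ∑ b', if D4 a a' b b' then Z a a' b b' else 0)
              ≤ ∑ a : Fin n, ∑ a', ∑ b, ∑ b', (Z a a' b b' + nd4 a a' b b') := by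
                refine Finset.sum_le_sum fun a _ => Finset.sum_le_sum fun a' _ =>
                  Finset.sum_le_sum fun b _ => Finset.sum_le_sum fun b' _ => ?_
                split_ifs with h
                · have := nd4_nonneg a a' b b'; linarith
                · have h1 := one_le_nd4 h
                  have h2 := (abs_le.1 (hZ1 a a' b b')).1
                  linarith
            _ = (∑ a : Fin n, ∑ a', ∑ b, ∑ b', Z a a' b b') + 6 * n ^ 3 := by
                simp only [Finset.sum_add_distrib, sum_nd4]
            _ ≤ _ := by
                have := unif_c4 hn0 K hK1 hcut
                exact add_le_add_left this _
        have h0 := nd4_nonneg a a' b b'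
        set X := ∑ π, Z (x π a) (x π a') (x π b) (x π b') with hX
        have hXN : X * N ≤ M * (4 * η' * n ^ 4 + 6 * n ^ 3) := by
          have hp' : X * N = M * (∑ a : Fin n, ∑ a', ∑ b, ∑ b',
            if D4 a a' b b' then Z a a' b b' else 0) := hp
          rw [hp']; exact mul_le_mul_of_nonneg_left hsum hM0.le
        have hle : X ≤ 2 * (4 * η' + 6 / n) * M := by
          by_contra hc
          push Not at hc
          have hpos : 0 ≤ 2 * (4 * η' + 6 / n) * M := by positivity
          have h1 : 2 * (4 * η' + 6 / n) * M * ((n : ℝ) ^ 4 / 2) ≤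
              2 * (4 * η' + 6 / n) * M * N := mul_le_mul_of_nonneg_left hNl hpos
          have h2 : 2 * (4 * η' + 6 / n) * M * N < X * N := mul_lt_mul_of_pos_right hc hN0
          have h3 : 2 * (4 * η' + 6 / n) * M * ((n : ℝ) ^ 4 / 2)
              = M * (4 * η' * n ^ 4 + 6 * n ^ 3) := by field_simp
          linarith
        have h9 : 0 ≤ nd4 a a' b b' * M := mul_nonneg h0 hM0.le
        rw [add_mul]; linarith
      · have h1 := one_le_nd4 hd
        have h2 : ∑ π, Z (x π a) (x π a') (x π b) (x π b') ≤ M := by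
          calc ∑ π, Z (x π a) (x π a') (x π b) (x π b') ≤ ∑ π : Equiv.Perm (Fin n), (1 : ℝ) :=
                Finset.sum_le_sum fun π _ => (le_abs_self _).trans (hZ1 _ _ _ _)
            _ = M := by simp [hM]
        have h3 : 0 ≤ 2 * (4 * η' + 6 / n) * M := by positivity
        nlinarith)
    (fun i a b => (∑ π, yy P i (f (x π a)) * yy P i (f (x π b))) / M) (by
      intro i a b
      rw [div_le_iff₀ hM0]
      split_ifs with hab
      · calc ∑ π, yy P i (f (x π a)) * yy P i (f (x π b)) ≤ ∑ π : Equiv.Perm (Fin n), (1 : ℝ) :=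
              Finset.sum_le_sum fun π _ => yy_mul_le hP01 _ _ _
          _ = 1 * M := by simp [hM]
      · have hab' : Fin.castLE hkn a ≠ Fin.castLE hkn b := fun h => hab (Fin.castLE_injective hkn h)
        have hp := perm2 hab' (fun u v => yy P i (f u) * yy P i (f v))
        have hcard : (0 : ℝ) < (Finset.offDiag (Finset.univ : Finset (Fin n))).card := by
          have : (Fin.castLE hkn a, Fin.castLE hkn b) ∈
            Finset.offDiag (Finset.univ : Finset (Fin n)) := by simpa using hab'
          exact_mod_cast Finset.card_pos.2 ⟨_, this⟩
        have hs : ∑ t ∈ Finset.offDiag (Finset.univ : Finset (Fin n)),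
            yy P i (f t.1) * yy P i (f t.2) ≤ 0 := by
          have hz : ∑ u, yy P i (f u) = 0 := by
            have := yy_mean (unif n) (measurable_of_countable f) i
            rw [unif_int, ← hPc, div_eq_zero_iff] at this
            rcases this with h | h
            · exact h
            · exact absurd h hn'.ne'
          have hall : ∑ t ∈ (Finset.univ : Finset (Fin n)) ×ˢ Finset.univ,
              yy P i (f t.1) * yy P i (f t.2) = 0 := by
            rw [Finset.sum_product]
            change ∑ u, ∑ v, yy P i (f u) * yy P i (f v) = 0
            rw [← Finset.sum_mul_sum, hz, zero_mul]
          rw [← Finset.diag_union_offDiag, Finset.sum_union (Finset.disjoint_diag_offDiag _),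
            Finset.sum_diag] at hall
          have : 0 ≤ ∑ u, yy P i (f u) * yy P i (f u) :=
            Finset.sum_nonneg fun u _ => mul_self_nonneg _
          linarith
        rw [zero_mul]
        by_contra hc
        push Not at hc
        have h1 := mul_pos hc hcard
        have h2 : (∑ π, yy P i (f (x π a)) * yy P i (f (x π b))) *
          ((Finset.offDiag (Finset.univ : Finset (Fin n))).card : ℝ) = M * _ := hp
        have h3 := mul_nonpos_of_nonneg_of_nonpos hM0.le hs
        linarith)
  have hsum : (∑ π : Equiv.Perm (Fin n), if GApprox (G.comap (x π)) A P η then (0 : ℝ) else 1)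
      ≤ M * ((∑ a, ∑ a', ∑ b, ∑ b', (∑ π, Z (x π a) (x π a') (x π b) (x π b')) / M)
          / (η ^ 4 * k ^ 4)
        + q / η ^ 2 * ∑ i, (∑ a, ∑ b, (∑ π, yy P i (f (x π a)) * yy P i (f (x π b))) / M)
          / k ^ 2) := by
    refine (Finset.sum_le_sum fun π _ => hpt π).trans (le_of_eq ?_)
    rw [Finset.sum_add_distrib, mul_add]
    congr 1
    · rw [← Finset.sum_div, ← mul_div_assoc]
      congr 1
      simp_rw [← Finset.sum_div]
      rw [mul_div_cancel₀ _ hM0.ne']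
      rw [Finset.sum_comm]; refine Finset.sum_congr rfl fun a _ => ?_
      rw [Finset.sum_comm]; refine Finset.sum_congr rfl fun a' _ => ?_
      rw [Finset.sum_comm]; refine Finset.sum_congr rfl fun b _ => ?_
      rw [Finset.sum_comm]
    · rw [← Finset.mul_sum, mul_left_comm]
      congr 1
      simp_rw [← Finset.sum_div]
      rw [div_right_comm, mul_div_cancel₀ _ hM0.ne']
      congr 1
      rw [Finset.sum_comm]; refine Finset.sum_congr rfl fun i _ => ?_
      rw [Finset.sum_comm]; refine Finset.sum_congr rfl fun a _ => ?_
      rw [Finset.sum_comm]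
  exact hsum.trans (mul_le_mul_of_nonneg_left hnb hM0.le)

/-- All copies of the induced subgraph on `S` are approximated. -/
def SGood {n q : ℕ} (G : SimpleGraph (Fin n)) (k : ℕ) (A : Fin q → Fin q → ℝ) (P : Fin q → ℝ)
    (η : ℝ) (S : Finset (Fin n)) : Prop :=
  ∀ f : Fin k ↪ Fin n, (∀ i, f i ∈ S) → GApprox (G.comap f) A P η

open Classical in
theorem sample_graph (η : ℝ) (hη : 0 < η) : ∃ N : ℕ, 0 < N ∧ ∀ n, N ≤ n →
    ∀ G : SimpleGraph (Fin n),
    ∃ (q : ℕ) (A : Fin q → Fin q → ℝ) (P : Fin q → ℝ), (∀ i j, A i j ∈ Set.Icc (0 : ℝ) 1) ∧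
      GApprox G A P η ∧ ∀ k, N ≤ k → k ≤ n →
        3 * n.choose k ≤
          4 * ((Finset.powersetCard k Finset.univ).filter (SGood G k A P η)).card := by
  set η' := η ^ 4 / 256 with hη'
  have h0 : 0 < η' := by positivity
  obtain ⟨q, hq, hreg⟩ := weak_reg η' h0
  obtain ⟨N, hN⟩ := exists_nat_gt (16 * (6 / η ^ 4 + q ^ 2 / η ^ 2) + 12 * 16 / η ^ 4)
  refine ⟨N + 12, by omega, fun n hn G => ?_⟩
  have hn0 : 0 < n := by omega
  have hn' : (0 : ℝ) < n := by exact_mod_cast hn0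
  have hprob := unif_prob hn0
  obtain ⟨f, hf, A, hAs, hA, hcut⟩ := hreg (Fin n) (unif n) (aI G) (measurable_of_countable _)
    (aI_symm G) (aI_mem G)
  refine ⟨q, A, gcum f, hA, ⟨f, ?_, ?_⟩, fun k hk hkn => ?_⟩
  · rw [c4_expand]
    refine (unif_c4 hn0 _ (fun x y => abs_sub_le_one_of_mem (aI_mem _ _ _) (hA _ _)) hcut).trans ?_
    refine mul_le_mul_of_nonneg_right ?_ (by positivity)
    have : 0 < η ^ 4 := by positivity
    linarith
  · simp [hη.le]
  · have hk0 : 0 < k := by omega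
    have hk' : (0 : ℝ) < k := by exact_mod_cast hk0
    have hkN : (N : ℝ) ≤ k := by exact_mod_cast (by omega : N ≤ k)
    have hnN : (N : ℝ) ≤ n := by exact_mod_cast (by omega : N ≤ n)
    have hb := gsample_bad hk0 hkn (by omega) G hA hη h0.le hcut
    set M : ℝ := (Fintype.card (Equiv.Perm (Fin n)) : ℝ) with hM
    have hM0 : 0 < M := by rw [hM]; exact_mod_cast Fintype.card_pos
    have p4 : 0 < η ^ 4 := by positivity
    have q1 : 0 ≤ 6 / η ^ 4 + (q : ℝ) ^ 2 / η ^ 2 := by positivity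
    have q2 : 0 ≤ 12 * 16 / η ^ 4 := by positivity
    have b1 : 2 * (4 * η' + 6 / n) / η ^ 4 ≤ 1 / 8 := by
      rw [div_le_iff₀ p4]
      have : 12 / (n : ℝ) ≤ η ^ 4 / 16 := by
        rw [div_le_div_iff₀ hn' (by norm_num)]
        have : 12 * 16 / η ^ 4 ≤ n := by linarith
        rw [div_le_iff₀ p4] at this
        linarith
      have e : 2 * (4 * η' + 6 / (n : ℝ)) = 8 * η' + 12 / n := by ring
      rw [e]; linarith
    have b2 : (6 / η ^ 4 + q ^ 2 / η ^ 2) / k ≤ 1 / 8 := by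
      rw [div_le_iff₀ hk']; linarith
    have hb' := hb.trans (mul_le_mul_of_nonneg_left (add_le_add b1 b2) hM0.le)
    set g : Fin k ↪ Fin n := ⟨Fin.castLE hkn, Fin.castLE_injective hkn⟩ with hg
    set S0 : Finset (Fin n) := Finset.univ.map g with hS0
    have hS0c : S0.card = k := by simp [hS0]
    have hp := permk hS0c (fun S => if SGood G k A (gcum f) η S then (0 : ℝ) else 1)
    have hle : (∑ π : Equiv.Perm (Fin n),
        if SGood G k A (gcum f) η (S0.map π.toEmbedding) then (0 : ℝ) else 1)
        ≤ ∑ π : Equiv.Perm (Fin n),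
        if GApprox (G.comap fun a : Fin k => π (Fin.castLE hkn a)) A (gcum f) η
          then (0 : ℝ) else 1 := by
      refine Finset.sum_le_sum fun π _ => ?_
      by_cases hga : GApprox (G.comap fun a : Fin k => π (Fin.castLE hkn a)) A (gcum f) η
      · have : SGood G k A (gcum f) η (S0.map π.toEmbedding) := by
          intro h hh
          obtain ⟨e⟩ := comap_iso G (S := S0.map π.toEmbedding) (by rw [Finset.card_map, hS0c])
            (g.trans π.toEmbedding) h (by intro i; simp [hS0]) hh
          exact GApprox.iso e hga
        rw [if_pos this, if_pos hga]
      · rw [if_neg hga]; split_ifs <;> simp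
    have hfin : M * ∑ S ∈ Finset.powersetCard k Finset.univ,
        (if SGood G k A (gcum f) η S then (0 : ℝ) else 1) ≤ M * (1 / 4 * n.choose k) := by
      have e : M * ∑ S ∈ Finset.powersetCard k Finset.univ,
        (if SGood G k A (gcum f) η S then (0 : ℝ) else 1) = _ := hp.symm
      rw [e]
      calc _ ≤ (M * (1 / 8 + 1 / 8)) * (n.choose k : ℝ) :=
            mul_le_mul_of_nonneg_right (hle.trans hb') (Nat.cast_nonneg _)
        _ = _ := by ring
    have hfin' := le_of_mul_le_mul_left hfin hM0
    have hsplit : (∑ S ∈ Finset.powersetCard k (Finset.univ : Finset (Fin n)),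
          (if SGood G k A (gcum f) η S then (0 : ℝ) else 1))
        + (((Finset.powersetCard k Finset.univ).filter (SGood G k A (gcum f) η)).card : ℝ)
        = n.choose k := by
      have hc : (((Finset.powersetCard k Finset.univ).filter (SGood G k A (gcum f) η)).card : ℝ)
        = ∑ S ∈ Finset.powersetCard k (Finset.univ : Finset (Fin n)),
          (if SGood G k A (gcum f) η S then (1 : ℝ) else 0) := by
        rw [Finset.sum_boole]
      rw [hc, ← Finset.sum_add_distrib]
      have : ∀ S ∈ Finset.powersetCard k (Finset.univ : Finset (Fin n)),
          ((if SGood G k A (gcum f) η S then (0 : ℝ) else 1) +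
            (if SGood G k A (gcum f) η S then (1 : ℝ) else 0)) = 1 := by
        intro S _; split_ifs <;> simp
      rw [Finset.sum_congr rfl this]
      simp
    have : (3 * n.choose k : ℝ) ≤
        4 * (((Finset.powersetCard k Finset.univ).filter (SGood G k A (gcum f) η)).card : ℝ) := by
      linarith
    exact_mod_cast this

lemma schedule (N : ℕ → ℕ) : ∃ j : ℕ → ℕ, Tendsto j atTop atTop ∧
    ∀ k, j k ≠ 0 → N (j k) ≤ k := by
  classical
  refine ⟨fun k => Nat.findGreatest (fun i => N i ≤ k) k, ?_, ?_⟩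
  · refine tendsto_atTop.2 fun b => ?_
    filter_upwards [eventually_ge_atTop (max b (N b))] with k hk
    exact Nat.le_findGreatest ((le_max_left _ _).trans hk) ((le_max_right _ _).trans hk)
  · intro k hk
    exact Nat.findGreatest_of_ne_zero (P := fun i => N i ≤ k) rfl hk

lemma deltaCut_tri {U V W : ℝ → ℝ → ℝ} (hU : IsGraphon U) (hV : IsGraphon V) (hW : IsGraphon W) :
    deltaCut U W ≤ deltaCut U V + deltaCut V W :=
  dist_triangle (⟨U, hU⟩ : GSpace) ⟨V, hV⟩ ⟨W, hW⟩

lemma core_limit {R : Set (ℝ → ℝ → ℝ)} (hR : ∀ W ∈ R, IsGraphon W) (hflex : FlexibleFamily R)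
    (hpull : ∀ W ∈ R, ∀ φ, pull W φ ∈ R) (W V : ℕ → ℝ → ℝ → ℝ) (hW : ∀ n, IsGraphon (W n))
    (hV : ∀ n, IsGraphon (V n)) (hWV : Tendsto (fun n => deltaCut (W n) (V n)) atTop (𝓝 0))
    (hcl : ∀ U, IsGraphon U → ∀ σ : ℕ → ℕ, StrictMono σ →
      Tendsto (fun n => deltaCut (V (σ n)) U) atTop (𝓝 0) → U ∈ R) {ε : ℝ} (hε : 0 < ε) :
    ∃ σ : ℕ → ℕ, StrictMono σ ∧ ∀ᶠ n in atTop, d1SetE (W (σ n)) R < ENNReal.ofReal ε := by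
  obtain ⟨U, hU, σ, hσ, hlim⟩ := graphon_compact V hV
  refine ⟨σ, hσ, flex_lemma hR hflex hpull (hcl U hU σ hσ hlim) (fun n => W (σ n))
    (fun n => hW _) ?_ ε hε⟩
  have h := (hWV.comp hσ.tendsto_atTop).add hlim
  rw [add_zero] at h
  exact squeeze_zero (fun n => deltaCut_nonneg _ _) (fun n => deltaCut_tri (hW _) (hV _) hU) h

lemma tendsto_of_near {W V : ℕ → ℝ → ℝ → ℝ} (hW : ∀ n, IsGraphon (W n))
    (hV : ∀ n, IsGraphon (V n)) {j : ℕ → ℕ} (hj : Tendsto j atTop atTop)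
    (h : ∀ n, Near (W n) (V n) (12 * (1 / (j n : ℝ)))) :
    Tendsto (fun n => deltaCut (W n) (V n)) atTop (𝓝 0) := by
  have h1 : Tendsto (fun n => 12 * (1 / (j n : ℝ))) atTop (𝓝 (12 * 0)) :=
    (tendsto_one_div_atTop_nhds_zero_nat.comp hj).const_mul _
  rw [mul_zero] at h1
  exact squeeze_zero (fun n => deltaCut_nonneg _ _) (fun n => (h n).deltaCut_le (hW n) (hV n)) h1

/-- The tester of a graphon property. -/
def testR (R : Set (ℝ → ℝ → ℝ)) (j : ℕ → ℕ) : GraphProp := fun k =>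
  {F | j k = 0 ∨ ∃ V ∈ R, ∃ (q : ℕ) (A : Fin q → Fin q → ℝ) (P : Fin q → ℝ),
    (∀ i j, A i j ∈ Set.Icc (0 : ℝ) 1) ∧ Approx V A P (1 / (j k : ℝ)) ∧
    GApprox F A P (1 / (j k : ℝ))}

/-- The tester of a graph property. -/
def testP (Q : GraphProp) (j : ℕ → ℕ) : GraphProp := fun k =>
  {F | j k = 0 ∨ ∃ n, k ≤ n ∧ ∃ H ∈ Q n, ∃ (q : ℕ) (A : Fin q → Fin q → ℝ) (P : Fin q → ℝ),
    (∀ i j, A i j ∈ Set.Icc (0 : ℝ) 1) ∧ GApprox H A P (1 / (j k : ℝ)) ∧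
    GApprox F A P (1 / (j k : ℝ))}

lemma testR_prop (R : Set (ℝ → ℝ → ℝ)) (j : ℕ → ℕ) : IsGraphProperty (testR R j) := by
  have key : ∀ k (G H : SimpleGraph (Fin k)), Nonempty (G ≃g H) →
      G ∈ testR R j k → H ∈ testR R j k := by
    rintro k G H ⟨e⟩ (h | ⟨V, hV, q, A, P, hA, h1, h2⟩)
    · exact Or.inl h
    · exact Or.inr ⟨V, hV, q, A, P, hA, h1, h2.iso e⟩
  exact fun k G H e => ⟨key k G H e, key k H G ⟨e.some.symm⟩⟩

lemma testP_prop (Q : GraphProp) (j : ℕ → ℕ) : IsGraphProperty (testP Q j) := by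
  have key : ∀ k (G H : SimpleGraph (Fin k)), Nonempty (G ≃g H) →
      G ∈ testP Q j k → H ∈ testP Q j k := by
    rintro k G H ⟨e⟩ (h | ⟨n, hn, V, hV, q, A, P, hA, h1, h2⟩)
    · exact Or.inl h
    · exact Or.inr ⟨n, hn, V, hV, q, A, P, hA, h1, h2.iso e⟩
  exact fun k G H e => ⟨key k G H e, key k H G ⟨e.some.symm⟩⟩

lemma closureP_pull (Q : GraphProp) : ∀ W ∈ closureP Q, ∀ φ, pull W φ ∈ closureP Q := by
  rintro W ⟨hW, n, G, hG, hn, hlim⟩ φ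
  refine ⟨hW.pull φ, n, G, hG, hn, ?_⟩
  refine squeeze_zero (fun n => deltaCut_nonneg _ _) (fun m => ?_) hlim
  have h0 : deltaCut (pull W φ) W ≤ 0 := by
    refine Near.deltaCut_le (hW.pull φ) hW ⟨φ, ?_⟩
    intro S T hS hT
    simp
  have h1 := deltaCut_tri (graphonOf_isGraphon (G m)) hW (hW.pull φ)
  have h2 := deltaCut_symm_le hW (hW.pull φ)
  linarith

open Classical in
theorem part_a {R : Set (ℝ → ℝ → ℝ)} (hR : IsGraphonProperty R) (hcl : CutClosed R)
    (hflex : FlexibleFamily R) : GraphonTestable R := by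
  have hpull : ∀ W ∈ R, ∀ φ, pull W φ ∈ R := fun W hW φ =>
    (hR.2 _ _ ((hR.1 W hW).pull φ) (hR.1 W hW) (graphonIso_pull (hR.1 W hW) φ)).2 hW
  have hs : ∀ i : ℕ, ∃ N : ℕ, i ≠ 0 → 0 < N ∧ ∀ W, IsGraphon W → ∃ (q : ℕ)
      (A : Fin q → Fin q → ℝ) (P : Fin q → ℝ), (∀ i j, A i j ∈ Set.Icc (0 : ℝ) 1) ∧
      Approx W A P (1 / (i : ℝ)) ∧ ∀ k, N ≤ k →
        3 / 4 ≤ ∑ F : SimpleGraph (Fin k),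
          if GApprox F A P (1 / (i : ℝ)) then indDensity F W else 0 := by
    intro i
    by_cases hi : i = 0
    · exact ⟨0, fun h => absurd hi h⟩
    · have : 0 < (1 / (i : ℝ)) := by
        have : 0 < i := Nat.pos_of_ne_zero hi
        positivity
      obtain ⟨N, h⟩ := sample_graphon _ this
      exact ⟨N, fun _ => h⟩
  choose N hN using hs
  obtain ⟨j, hj, hjN⟩ := schedule N
  refine ⟨testR R j, testR_prop R j, ?_, ?_⟩
  · intro W hWR k hk
    have hW := hR.1 W hWR
    unfold probIn
    by_cases h0 : j k = 0
    · have : ∀ F : SimpleGraph (Fin k), (if F ∈ testR R j k then indDensity F W else 0)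
          = indDensity F W := fun F => if_pos (Or.inl h0)
      rw [Finset.sum_congr rfl fun F _ => this F, indDensity_sum k hW]
      norm_num
    · obtain ⟨q, A, P, hA, h1, h2⟩ := (hN _ h0).2 W hW
      refine le_trans (by norm_num) ((h2 k (hjN k h0)).trans (Finset.sum_le_sum fun F _ => ?_))
      by_cases hF : GApprox F A P (1 / (j k : ℝ))
      · rw [if_pos hF, if_pos (show F ∈ testR R j k from Or.inr ⟨W, hWR, q, A, P, hA, h1, hF⟩)]
      · rw [if_neg hF]
        split_ifs
        · exact indDensity_nonneg F hW
        · exact le_rfl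
  · intro ε hε
    by_contra hcon
    push Not at hcon
    obtain ⟨K, hK⟩ := (tendsto_atTop.1 hj 1).exists_forall_of_atTop
    have hex : ∀ m : ℕ, ∃ k W V, m ≤ k ∧ IsGraphon W ∧ V ∈ R ∧
        ENNReal.ofReal ε ≤ d1SetE W R ∧ Near W V (12 * (1 / (j k : ℝ))) := by
      intro m
      obtain ⟨k, hk, W, hW, hd, hp⟩ := hcon (max (m + 1) K) (le_max_of_le_left (by omega))
      have hjk : j k ≠ 0 := by
        have := hK k ((le_max_right _ _).trans hk)
        omega
      have hk0 : 0 < k := by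
        have := (le_max_left _ _).trans hk
        omega
      have hη : 0 ≤ 1 / (j k : ℝ) := by positivity
      obtain ⟨q, A, P, hA, h1, h2⟩ := (hN _ hjk).2 W hW
      have h2 := h2 k (hjN k hjk)
      have hF : ∃ F : SimpleGraph (Fin k), F ∈ testR R j k ∧ GApprox F A P (1 / (j k : ℝ)) := by
        by_contra hno
        push Not at hno
        have hsum := Finset.sum_le_sum (s := (Finset.univ : Finset (SimpleGraph (Fin k))))
          (f := fun F => (if F ∈ testR R j k then indDensity F W else 0) +
            (if GApprox F A P (1 / (j k : ℝ)) then indDensity F W else 0))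
          (g := fun F => indDensity F W) (fun F _ => by
            have := indDensity_nonneg F hW
            by_cases hF : F ∈ testR R j k
            · simp only [if_pos hF, if_neg (hno F hF), add_zero, le_refl]
            · simp only [if_neg hF, zero_add]
              split_ifs
              · exact le_rfl
              · exact this)
        rw [Finset.sum_add_distrib, indDensity_sum k hW] at hsum
        unfold probIn at hp
        linarith
      obtain ⟨F, hF1, hF2⟩ := hF
      rcases hF1 with h | ⟨V, hV, q', A', P', hA', h1', h2'⟩
      · exact absurd h hjk
      · have hg := graphonOf_isGraphon F
        have n1 := near_of_approx hW hg hA h1 (hF2.approx hk0 hA hη)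
        have n2 := near_of_approx hg (hR.1 V hV) hA' (h2'.approx hk0 hA' hη) h1'
        have n3 := Near.trans hW hg (hR.1 V hV) n1 n2
        refine ⟨k, W, V, ?_, hW, hV, hd, ?_⟩
        · have := (le_max_left _ _).trans hk
          omega
        · convert n3 using 1
          ring
    choose k W V hk hW hV hd hnear using hex
    have hkt : Tendsto k atTop atTop := tendsto_atTop_mono hk tendsto_id
    obtain ⟨σ, hσ, hev⟩ := core_limit hR.1 hflex hpull W V hW (fun n => hR.1 _ (hV n))
      (tendsto_of_near hW (fun n => hR.1 _ (hV n)) (hj.comp hkt) hnear) (by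
        intro U hU σ hσ hlim
        refine hcl U hU fun δ hδ => ?_
        have hlt := (hlim.eventually (gt_mem_nhds (half_pos hδ))).exists
        obtain ⟨m, hm⟩ := hlt
        have hVg := hR.1 _ (hV (σ m))
        obtain ⟨φ, hφ⟩ := Near.symm hVg hU (near_of_deltaCut_lt hVg hU hm)
        refine ⟨pull (V (σ m)) φ, hpull _ (hV _) φ, ?_⟩
        have := cutNorm_le (sub_meas hU (hVg.pull φ)) (sub_bdd hU (hVg.pull φ)) hφ
        linarith) hε
    obtain ⟨m, hm⟩ := hev.exists
    exact absurd (hd (σ m)) (not_le.2 hm)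

open Classical in
theorem part_b {Q : GraphProp} (hrob : Robust Q) (hflex : FlexibleFamily (closureP Q)) :
    GraphTestable Q := by
  have hs : ∀ i : ℕ, ∃ N : ℕ, i ≠ 0 → 0 < N ∧ ∀ n, N ≤ n → ∀ G : SimpleGraph (Fin n),
      ∃ (q : ℕ) (A : Fin q → Fin q → ℝ) (P : Fin q → ℝ), (∀ i j, A i j ∈ Set.Icc (0 : ℝ) 1) ∧
      GApprox G A P (1 / (i : ℝ)) ∧ ∀ k, N ≤ k → k ≤ n →
        3 * n.choose k ≤ 4 * ((Finset.powersetCard k Finset.univ).filter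
          (SGood G k A P (1 / (i : ℝ)))).card := by
    intro i
    by_cases hi : i = 0
    · exact ⟨0, fun h => absurd hi h⟩
    · have : 0 < (1 / (i : ℝ)) := by
        have : 0 < i := Nat.pos_of_ne_zero hi
        positivity
      obtain ⟨N, h⟩ := sample_graph _ this
      exact ⟨N, fun _ => h⟩
  choose N hN using hs
  obtain ⟨j, hj, hjN⟩ := schedule N
  have hgc : ∀ {n : ℕ} (G : SimpleGraph (Fin n)) (k : ℕ) (P : GraphProp), goodCount G k P =
      ((Finset.powersetCard k Finset.univ).filter (fun S => inducedMem G S k P)).card := by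
    intro n G k P
    unfold goodCount
    rw [← Set.ncard_coe_finset]
    congr 1
    ext S
    simp [Finset.mem_powersetCard]
  have hind : ∀ {n : ℕ} (G : SimpleGraph (Fin n)) (k : ℕ) (P : GraphProp) (S : Finset (Fin n)),
      S.card = k → (∀ f : Fin k ↪ Fin n, (∀ i, f i ∈ S) → G.comap f ∈ P k) →
      inducedMem G S k P := by
    intro n G k P S hS h
    let f : Fin k ↪ Fin n := (S.orderEmbOfFin hS).toEmbedding
    have hf : ∀ i, f i ∈ S := fun i => Finset.orderEmbOfFin_mem S hS i
    exact ⟨G.comap f, h f hf, f, hf, fun _ _ => Iff.rfl⟩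
  refine ⟨testP Q j, testP_prop Q j, ?_, ?_⟩
  · intro n G hG k hk hkn
    rw [hgc]
    by_cases h0 : j k = 0
    · rw [Finset.filter_true_of_mem]
      · rw [Finset.card_powersetCard, Finset.card_univ, Fintype.card_fin]
        omega
      · intro S hS
        exact hind G k _ S (Finset.mem_powersetCard.1 hS).2 fun f _ => Or.inl h0
    · have hNk := hjN k h0
      obtain ⟨q, A, P, hA, h1, h2⟩ := (hN _ h0).2 n (hNk.trans hkn) G
      have h2 := h2 k hNk hkn
      have hle : ((Finset.powersetCard k Finset.univ).filter
          (SGood G k A P (1 / (j k : ℝ)))).card ≤ ((Finset.powersetCard k Finset.univ).filter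
          (fun S => inducedMem G S k (testP Q j))).card := by
        refine Finset.card_le_card fun S hS => ?_
        rw [Finset.mem_filter] at hS ⊢
        exact ⟨hS.1, hind G k _ S (Finset.mem_powersetCard.1 hS.1).2 fun f hf =>
          Or.inr ⟨n, hkn, G, hG, q, A, P, hA, h1, hS.2 f hf⟩⟩
      omega
  · intro ε hε
    obtain ⟨N₀, ε', hN₀, hε', hrob'⟩ := hrob (ε / 2) (half_pos hε)
    by_contra hcon
    push Not at hcon
    obtain ⟨K, hK⟩ := (tendsto_atTop.1 hj 1).exists_forall_of_atTop
    have hex : ∀ m : ℕ, ∃ (k n : ℕ) (G : SimpleGraph (Fin n)) (n' : ℕ) (H : SimpleGraph (Fin n')),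
        m ≤ k ∧ k ≤ n ∧ k ≤ n' ∧ H ∈ Q n' ∧ ENNReal.ofReal ε ≤ graphD1P G Q ∧
        Near (graphonOf G) (graphonOf H) (12 * (1 / (j k : ℝ))) := by
      intro m
      obtain ⟨n, G, k, hk, hkn, hd, hp⟩ := hcon (max (m + 1) K) (le_max_of_le_left (by omega))
      have hjk : j k ≠ 0 := by
        have := hK k ((le_max_right _ _).trans hk)
        omega
      have hkm : m + 1 ≤ k := (le_max_left _ _).trans hk
      have hk0 : 0 < k := by omega
      have hη : 0 ≤ 1 / (j k : ℝ) := by positivity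
      have hNk := hjN k hjk
      obtain ⟨q, A, P, hA, h1, h2⟩ := (hN _ hjk).2 n (hNk.trans hkn) G
      have h2 := h2 k hNk hkn
      rw [hgc] at hp
      have hS : ∃ S ∈ Finset.powersetCard k (Finset.univ : Finset (Fin n)),
          inducedMem G S k (testP Q j) ∧ SGood G k A P (1 / (j k : ℝ)) S := by
        by_contra hno
        push Not at hno
        have hdis : Disjoint ((Finset.powersetCard k Finset.univ).filter
            (fun S => inducedMem G S k (testP Q j)))
            ((Finset.powersetCard k Finset.univ).filter (SGood G k A P (1 / (j k : ℝ)))) := by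
          rw [Finset.disjoint_left]
          intro S hS hS'
          rw [Finset.mem_filter] at hS hS'
          exact hno S hS.1 hS.2 hS'.2
        have hc := Finset.card_le_card (Finset.union_subset
          (Finset.filter_subset (fun S => inducedMem G S k (testP Q j))
            (Finset.powersetCard k Finset.univ))
          (Finset.filter_subset (SGood G k A P (1 / (j k : ℝ)))
            (Finset.powersetCard k Finset.univ)))
        rw [Finset.card_union_of_disjoint hdis, Finset.card_powersetCard, Finset.card_univ,
          Fintype.card_fin] at hc
        omega
      obtain ⟨S, -, ⟨F, hF, f, hfS, hadj⟩, hgood⟩ := hS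
      have hFe : G.comap f = F := by
        ext a b
        exact (hadj a b).symm
      have hF2 := hgood f hfS
      rw [hFe] at hF2
      rcases hF with h | ⟨n', hn', H, hH, q', A', P', hA', h1', h2'⟩
      · exact absurd h hjk
      · have hG := graphonOf_isGraphon G
        have hFg := graphonOf_isGraphon F
        have hHg := graphonOf_isGraphon H
        have n1 := near_of_approx hG hFg hA (h1.approx (by omega) hA hη) (hF2.approx hk0 hA hη)
        have n2 := near_of_approx hFg hHg hA' (h2'.approx hk0 hA' hη)
          (h1'.approx (by omega) hA' hη)
        have n3 := Near.trans hG hFg hHg n1 n2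
        refine ⟨k, n, G, n', H, by omega, hkn, hn', hH, hd, ?_⟩
        convert n3 using 1
        ring
    choose k n G n' H hk hkn hkn' hH hd hnear using hex
    have hkt : Tendsto k atTop atTop := tendsto_atTop_mono hk tendsto_id
    obtain ⟨σ, hσ, hev⟩ := core_limit (fun W hW => hW.1) hflex (closureP_pull Q)
      (fun m => graphonOf (G m)) (fun m => graphonOf (H m)) (fun m => graphonOf_isGraphon _)
      (fun m => graphonOf_isGraphon _)
      (tendsto_of_near (fun m => graphonOf_isGraphon _) (fun m => graphonOf_isGraphon _)
        (hj.comp hkt) hnear) (by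
        intro U hU σ hσ hlim
        exact ⟨hU, fun m => n' (σ m), fun m => H (σ m), fun m => hH _,
          (tendsto_atTop_mono hkn' hkt).comp hσ.tendsto_atTop, hlim⟩) hε'
    have hnt : Tendsto (fun m => n (σ m)) atTop atTop :=
      (tendsto_atTop_mono hkn hkt).comp hσ.tendsto_atTop
    obtain ⟨m, hm, hnm⟩ := (hev.and (tendsto_atTop.1 hnt N₀)).exists
    have h1 := hrob' _ hnm (G (σ m)) hm.le
    have h2 := (hd (σ m)).trans h1
    rw [ENNReal.ofReal_le_ofReal_iff (half_pos hε).le] at h2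
    linarith

theorem flexible_testable :
    (∀ R : Set (ℝ → ℝ → ℝ), IsGraphonProperty R → CutClosed R → FlexibleFamily R →
      GraphonTestable R) ∧
    (∀ P : GraphProp, IsGraphProperty P → Robust P → FlexibleFamily (closureP P) →
      GraphTestable P) := by
  exact ⟨fun R hR hc hf => part_a hR hc hf, fun Q _ hr hf => part_b hr hf⟩

end
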